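/- arXiv:0901.1247 — 5 statements merged into one kernel-verified Lean document; each statement's English description precedes it below -/
import Mathlib

section
/- Let T be a measure-preserving automorphism of a standard probability space (X,B,μ). If the topological lens (C₂(μ), T̃) is pointwise recurrent (every point returns arbitrarily close to itself infinitely often), then T is rigid: there exists an increasing sequence (n_i) with μ(T^{n_i}A Δ A) → 0 for every measurable set A. -/
open MeasureTheory Filter

/-- The topological lens of an automorphism `T`, acting on probability measures on
`X × X` by pushforward under `T × T`. -/
noncomputable def lensP {X : Type*} [MeasurableSpace X] (T : X ≃ᵐ X)
    (ξ : ProbabilityMeasure (X × X)) : ProbabilityMeasure (X × X) :=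
  ξ.map (f := ⇑(T.prodCongr T)) (T.prodCongr T).measurable.aemeasurable

noncomputable def Kop {H : Type*} [NormedAddCommGroup H] [InnerProductSpace ℝ H]
    (c : ℕ → ℝ) (f : ℕ → H) (x : H) : H := ∑' k, (c k * inner ℝ (f k) x) • f k

section abs
variable {H : Type*} [NormedAddCommGroup H] [InnerProductSpace ℝ H] [CompleteSpace H]

lemma Kop_bound {c : ℕ → ℝ} {f : ℕ → H} (hc : ∀ k, 0 < c k) (hf : ∀ k, ‖f k‖ ≤ 1) (x : H)
    (k : ℕ) : ‖(c k * inner ℝ (f k) x) • f k‖ ≤ c k * ‖x‖ := by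
  rw [norm_smul, norm_mul, Real.norm_of_nonneg (hc k).le]
  have h1 : ‖inner ℝ (f k) x‖ ≤ ‖f k‖ * ‖x‖ := norm_inner_le_norm _ _
  have h2 : ‖f k‖ * ‖x‖ ≤ 1 * ‖x‖ := by gcongr; exact hf k
  calc c k * ‖inner ℝ (f k) x‖ * ‖f k‖ ≤ c k * (1 * ‖x‖) * 1 := by
        have := (hc k).le
        gcongr
        · exact h1.trans h2
        · exact hf k
    _ = _ := by ring

lemma Kop_summable {c : ℕ → ℝ} {f : ℕ → H} (hc : ∀ k, 0 < c k) (hs : Summable c)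
    (hf : ∀ k, ‖f k‖ ≤ 1) (x : H) : Summable fun k => (c k * inner ℝ (f k) x) • f k :=
  Summable.of_norm_bounded (hs.mul_right ‖x‖) (Kop_bound hc hf x)

lemma inner_Kop {c : ℕ → ℝ} {f : ℕ → H} (hc : ∀ k, 0 < c k) (hs : Summable c)
    (hf : ∀ k, ‖f k‖ ≤ 1) (w x : H) :
    HasSum (fun k => c k * (inner ℝ w (f k) * inner ℝ (f k) x)) (inner ℝ w (Kop c f x)) := by
  have := (Kop_summable hc hs hf x).hasSum.mapL (innerSL ℝ w)
  simp only [innerSL_apply_apply, inner_smul_right] at this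
  have e : (fun k => c k * (inner ℝ w (f k) * inner ℝ (f k) x)) =
      fun k => c k * inner ℝ (f k) x * inner ℝ w (f k) := funext fun k => by ring
  rw [e]
  exact this

lemma Kop_dense {c : ℕ → ℝ} {f : ℕ → H} (hc : ∀ k, 0 < c k) (hs : Summable c)
    (hf : ∀ k, ‖f k‖ ≤ 1) (htot : ∀ u : H, (∀ k, inner ℝ (f k) u = 0) → u = 0) :
    Dense (Submodule.span ℝ (Set.range (Kop c f)) : Set H) := by
  rw [Submodule.dense_iff_topologicalClosure_eq_top,
    Submodule.topologicalClosure_eq_top_iff, Submodule.eq_bot_iff]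
  intro u hu
  rw [Submodule.mem_orthogonal'] at hu
  have h0 := hu (Kop c f u) (Submodule.subset_span ⟨u, rfl⟩)
  have h1 := inner_Kop hc hs hf u u
  rw [h0] at h1
  have hnn : ∀ k, 0 ≤ c k * (inner ℝ u (f k) * inner ℝ (f k) u) := fun k => by
    rw [real_inner_comm]
    exact mul_nonneg (hc k).le (mul_self_nonneg _)
  have h2 := (hasSum_zero_iff_of_nonneg hnn).1 h1
  apply htot
  intro k
  have h3 := congrFun h2 k
  simp only [Pi.zero_apply, mul_eq_zero, (hc k).ne', false_or] at h3
  rcases h3 with h | h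
  · rwa [real_inner_comm]
  · exact h

lemma cauchy_of_comm {c : ℕ → ℝ} {f : ℕ → H} (hc : ∀ k, 0 < c k) (hs : Summable c)
    (hf : ∀ k, ‖f k‖ ≤ 1) (htot : ∀ u : H, (∀ k, inner ℝ (f k) u = 0) → u = 0)
    (V : ℕ → H →ₗᵢ[ℝ] H) (U : Ultrafilter ℕ)
    (hcomm : ∀ x, Tendsto (fun n => V n (Kop c f x) - Kop c f (V n x)) U (nhds 0)) (x : H)
    (ε : ℝ) (hε : 0 < ε) : ∃ S ∈ U, ∀ m ∈ S, ∀ n ∈ S, ‖V m x - V n x‖ < ε := by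
  have hK : ∀ x, ∃ h, Tendsto (fun n => Kop c f (V n x)) U (nhds h) := by
    intro x
    have ha : ∀ k, ∃ a, Tendsto (fun n => inner ℝ (f k) (V n x)) U (nhds a) := by
      intro k
      have hcpt : IsCompact (Set.Icc (-‖x‖) ‖x‖) := isCompact_Icc
      have := hcpt.ultrafilter_le_nhds (U.map fun n => inner ℝ (f k) (V n x)) (by
        rw [le_principal_iff, Ultrafilter.coe_map, Filter.mem_map]
        refine Filter.univ_mem' fun n => ?_
        have h1 : |inner ℝ (f k) (V n x)| ≤ ‖f k‖ * ‖V n x‖ := abs_real_inner_le_norm _ _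
        rw [LinearIsometry.norm_map] at h1
        have h2 : ‖f k‖ * ‖x‖ ≤ 1 * ‖x‖ := by gcongr; exact hf k
        exact abs_le.1 (by linarith))
      obtain ⟨a, -, h⟩ := this
      exact ⟨a, h⟩
    choose a ha using ha
    refine ⟨∑' k, (c k * a k) • f k, ?_⟩
    refine tendsto_tsum_of_dominated_convergence (bound := fun k => c k * ‖x‖)
      (hs.mul_right _) ?_ ?_
    · intro k
      exact ((ha k).const_mul _).smul_const _
    · refine Eventually.of_forall fun n k => ?_
      have := Kop_bound hc hf (V n x) k
      rwa [LinearIsometry.norm_map] at this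
  have hspan : ∀ y ∈ Submodule.span ℝ (Set.range (Kop c f)),
      ∃ h, Tendsto (fun n => V n y) U (nhds h) := by
    intro y hy
    induction hy using Submodule.span_induction with
    | mem y hy =>
      obtain ⟨x, rfl⟩ := hy
      obtain ⟨h, hh⟩ := hK x
      exact ⟨0 + h, by simpa using (hcomm x).add hh⟩
    | zero => exact ⟨0, by simp⟩
    | add y z _ _ hy hz =>
      obtain ⟨a, ha⟩ := hy
      obtain ⟨b, hb⟩ := hz
      exact ⟨a + b, by simpa using ha.add hb⟩
    | smul r y _ hy =>
      obtain ⟨a, ha⟩ := hy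
      exact ⟨r • a, by simpa using ha.const_smul r⟩
  obtain ⟨y, hy, hxy⟩ := Metric.mem_closure_iff.1 (Kop_dense hc hs hf htot x) (ε / 4) (by positivity)
  obtain ⟨h, hh⟩ := hspan y hy
  refine ⟨_, Metric.tendsto_nhds.1 hh (ε / 4) (by positivity), ?_⟩
  intro m hm n hn
  have hm : dist (V m y) h < ε / 4 := hm
  have hn : dist (V n y) h < ε / 4 := hn
  rw [← dist_eq_norm]
  have e1 : dist (V m x) (V m y) < ε / 4 := by rwa [LinearIsometry.dist_map]
  have e2 : dist (V n x) (V n y) < ε / 4 := by rwa [LinearIsometry.dist_map]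
  rw [dist_comm] at e2 hn
  calc dist (V m x) (V n x) ≤ dist (V m x) (V m y) + dist (V m y) h + dist h (V n y)
        + dist (V n y) (V n x) :=
        (dist_triangle _ (V n y) _).trans (by
          gcongr
          exact (dist_triangle _ h _).trans (by gcongr; exact dist_triangle _ _ _))
    _ < ε := by linarith

lemma rigid_of_cauchy [TopologicalSpace.SeparableSpace H]
    (V : ℕ → H →ₗᵢ[ℝ] H) (hV : ∀ m n x, V m (V n x) = V (n + m) x) (U : Ultrafilter ℕ)
    (hU : (U : Filter ℕ) ≤ atTop)
    (hC : ∀ x, ∀ ε > 0, ∃ S ∈ U, ∀ m ∈ S, ∀ n ∈ S, ‖V m x - V n x‖ < ε) :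
    ∃ n : ℕ → ℕ, StrictMono n ∧ ∀ x, Tendsto (fun i => V (n i) x) atTop (nhds x) := by
  let d := TopologicalSpace.denseSeq H
  have hd : DenseRange d := TopologicalSpace.denseRange_denseSeq H
  have hfreq : ∀ i : ℕ, ∃ᶠ k in atTop, ∀ j ≤ i, ‖V k (d j) - d j‖ < 1 / ((i : ℝ) + 1) := by
    intro i
    rw [frequently_atTop]
    intro N
    choose S hS hS2 using fun j => hC (d j) (1 / ((i : ℝ) + 1)) (by positivity)
    have hI : (⋂ j ∈ Set.Iic i, S j) ∈ U :=
      (biInter_mem (Set.finite_Iic i)).2 fun j _ => hS j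
    obtain ⟨m, hm⟩ := U.nonempty_of_mem hI
    obtain ⟨n, hn, hn2⟩ := U.nonempty_of_mem (inter_mem hI (hU (Ici_mem_atTop (m + N))))
    refine ⟨n - m, ?_, ?_⟩
    · have : m + N ≤ n := hn2
      omega
    · intro j hj
      have hmn : m + N ≤ n := hn2
      rw [← (V m).norm_map, map_sub, hV, Nat.sub_add_cancel (by omega)]
      exact hS2 j n (Set.mem_iInter₂.1 hn j hj) m (Set.mem_iInter₂.1 hm j hj)
  obtain ⟨n, hn, hn2⟩ := extraction_forall_of_frequently hfreq
  refine ⟨n, hn, fun x => ?_⟩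
  rw [Metric.tendsto_atTop]
  intro ε hε
  obtain ⟨j, hj⟩ := hd.exists_dist_lt x (ε := ε / 3) (by positivity)
  obtain ⟨N, hN⟩ := exists_nat_one_div_lt (K := ℝ) (ε := ε / 3) (by positivity)
  refine ⟨max N j, fun i hi => ?_⟩
  have h1 := hn2 i j (le_of_max_le_right hi)
  have h2 : 1 / ((i : ℝ) + 1) ≤ 1 / ((N : ℝ) + 1) := by
    have : (N : ℝ) ≤ i := by exact_mod_cast le_of_max_le_left hi
    gcongr
  rw [← dist_eq_norm] at h1
  have e1 : dist (V (n i) x) (V (n i) (d j)) < ε / 3 := by rwa [LinearIsometry.dist_map]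
  rw [dist_comm] at hj
  have := dist_triangle4 (V (n i) x) (V (n i) (d j)) (d j) x
  linarith
end abs

lemma map_Kop {H : Type*} [NormedAddCommGroup H] [InnerProductSpace ℝ H] [CompleteSpace H]
    {c : ℕ → ℝ} {f : ℕ → H} (hc : ∀ k, 0 < c k) (hs : Summable c)
    (hf : ∀ k, ‖f k‖ ≤ 1) (V : H →ₗᵢ[ℝ] H) (x : H) :
    V (Kop c f x) = Kop c (fun k => V (f k)) (V x) := by
  have := ((Kop_summable hc hs hf x).hasSum.mapL V.toContinuousLinearMap).tsum_eq
  simp only [LinearIsometry.coe_toContinuousLinearMap, map_smul] at this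
  simp only [Kop, LinearIsometry.inner_map_map]
  exact this.symm

section meas
variable {X : Type*} [MeasurableSpace X] (μ : Measure X) [IsProbabilityMeasure μ]

lemma bilin {c : ℕ → ℝ} {φ : ℕ → X → ℝ} (hc : ∀ k, 0 < c k) (hs : Summable c)
    (hm : ∀ k, Measurable (φ k)) (hb : ∀ k x, |φ k x| ≤ 1) {w g : X → ℝ}
    (hw : Integrable w μ) (hg : Integrable g μ) :
    HasSum (fun k => c k * ((∫ x, w x * φ k x ∂μ) * ∫ x, φ k x * g x ∂μ))
      (∫ z, w z.1 * g z.2 * (∑' k, c k * (φ k z.1 * φ k z.2)) ∂(μ.prod μ)) := by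
  have hwg := hw.mul_prod hg
  have key := hasSum_integral_of_dominated_convergence (μ := μ.prod μ)
    (F := fun k z => w z.1 * g z.2 * (c k * (φ k z.1 * φ k z.2)))
    (f := fun z => w z.1 * g z.2 * (∑' k, c k * (φ k z.1 * φ k z.2)))
    (fun k z => ‖w z.1 * g z.2‖ * c k) ?_ ?_ ?_ ?_ ?_
  · have e : (fun k => c k * ((∫ x, w x * φ k x ∂μ) * ∫ x, φ k x * g x ∂μ)) =
        fun k => ∫ z, w z.1 * g z.2 * (c k * (φ k z.1 * φ k z.2)) ∂(μ.prod μ) := by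
      funext k
      rw [← integral_prod_mul, ← integral_const_mul]
      congr 1
      ext z
      ring
    rw [e]
    exact key
  · intro k
    refine hwg.aestronglyMeasurable.mul ?_
    have := hm k
    apply Measurable.aestronglyMeasurable
    fun_prop
  · intro k
    refine Eventually.of_forall fun z => ?_
    rw [norm_mul, norm_mul (c k), Real.norm_of_nonneg (hc k).le, norm_mul (φ k z.1)]
    have h1 := hb k z.1
    have h2 := hb k z.2
    rw [← Real.norm_eq_abs] at h1 h2
    have h3 : ‖φ k z.1‖ * ‖φ k z.2‖ ≤ 1 := mul_le_one₀ h1 (norm_nonneg _) h2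
    have := (hc k).le
    calc ‖w z.1 * g z.2‖ * (c k * (‖φ k z.1‖ * ‖φ k z.2‖)) ≤ ‖w z.1 * g z.2‖ * (c k * 1) := by
          gcongr
      _ = _ := by ring
  · exact Eventually.of_forall fun z => hs.mul_left _
  · simp_rw [tsum_mul_left]
    exact hwg.norm.mul_const _
  · refine Eventually.of_forall fun z => ?_
    apply HasSum.mul_left
    apply Summable.hasSum
    refine Summable.of_norm_bounded hs fun k => ?_
    rw [norm_mul (c k), Real.norm_of_nonneg (hc k).le, norm_mul (φ k z.1)]
    have h1 := hb k z.1
    have h2 := hb k z.2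
    rw [← Real.norm_eq_abs] at h1 h2
    exact mul_le_of_le_one_right (hc k).le (mul_le_one₀ h1 (norm_nonneg _) h2)

lemma inner_Kop_eq {c : ℕ → ℝ} {φ : ℕ → X → ℝ} (hc : ∀ k, 0 < c k) (hs : Summable c)
    (hm : ∀ k, Measurable (φ k)) (hb : ∀ k x, |φ k x| ≤ 1) (Φ : ℕ → Lp ℝ 2 μ)
    (hΦ : ∀ k, Φ k =ᵐ[μ] φ k) (hΦ1 : ∀ k, ‖Φ k‖ ≤ 1) (w g : Lp ℝ 2 μ) :
    inner ℝ w (Kop c Φ g) =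
      ∫ z, w z.1 * g z.2 * (∑' k, c k * (φ k z.1 * φ k z.2)) ∂(μ.prod μ) := by
  have h1 := inner_Kop hc hs hΦ1 w g
  have h2 := bilin μ hc hs hm hb ((Lp.memLp w).integrable one_le_two)
    ((Lp.memLp g).integrable one_le_two)
  refine h1.unique ?_
  convert h2 using 4 with k
  · rw [L2.inner_def]
    apply integral_congr_ae
    filter_upwards [hΦ k] with x hx
    simp [hx, mul_comm]
  · rw [L2.inner_def]
    apply integral_congr_ae
    filter_upwards [hΦ k] with x hx
    simp [hx, mul_comm]

lemma l2_cs {Y : Type*} [MeasurableSpace Y] (ν : Measure Y) {a b : Y → ℝ} (ha : MemLp a 2 ν)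
    (hb : MemLp b 2 ν) : (∫ y, a y * b y ∂ν) ^ 2 ≤ (∫ y, a y ^ 2 ∂ν) * ∫ y, b y ^ 2 ∂ν := by
  have key : ∀ {a b : Y → ℝ} (ha : MemLp a 2 ν) (hb : MemLp b 2 ν),
      inner ℝ (ha.toLp a) (hb.toLp b) = ∫ y, a y * b y ∂ν := by
    intro a b ha hb
    rw [L2.inner_def]
    apply integral_congr_ae
    filter_upwards [ha.coeFn_toLp, hb.coeFn_toLp] with x hx hy
    simp [hx, hy, mul_comm]
  have h := real_inner_mul_inner_self_le (ha.toLp a) (hb.toLp b)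
  rw [key, key, key] at h
  simpa [pow_two] using h

lemma norm_sq_Lp (w : Lp ℝ 2 μ) : ∫ x, w x ^ 2 ∂μ = ‖w‖ ^ 2 := by
  rw [← real_inner_self_eq_norm_sq, L2.inner_def]
  simp [pow_two]

lemma tsum_meas {c : ℕ → ℝ} {φ : ℕ → X → ℝ} (hc : ∀ k, 0 < c k) (hs : Summable c)
    (hm : ∀ k, Measurable (φ k)) (hb : ∀ k x, |φ k x| ≤ 1) :
    MemLp (fun z : X × X => ∑' k, c k * (φ k z.1 * φ k z.2)) 2 (μ.prod μ) := by
  refine MemLp.of_bound (C := ∑' k, c k) ?_ ?_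
  · apply Measurable.aestronglyMeasurable
    apply Measurable.tsum
    intro k
    have := hm k
    fun_prop
  · refine Eventually.of_forall fun z => ?_
    refine tsum_of_norm_bounded hs.hasSum fun k => ?_
    rw [norm_mul (c k), Real.norm_of_nonneg (hc k).le, norm_mul (φ k z.1)]
    have h1 := hb k z.1
    have h2 := hb k z.2
    rw [← Real.norm_eq_abs] at h1 h2
    exact mul_le_of_le_one_right (hc k).le (mul_le_one₀ h1 (norm_nonneg _) h2)

lemma Kop_diff {c : ℕ → ℝ} {φ ψ : ℕ → X → ℝ} (hc : ∀ k, 0 < c k) (hs : Summable c)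
    (hm : ∀ k, Measurable (φ k)) (hb : ∀ k x, |φ k x| ≤ 1) (Φ : ℕ → Lp ℝ 2 μ)
    (hΦ : ∀ k, Φ k =ᵐ[μ] φ k) (hΦ1 : ∀ k, ‖Φ k‖ ≤ 1)
    (hm' : ∀ k, Measurable (ψ k)) (hb' : ∀ k x, |ψ k x| ≤ 1) (Ψ : ℕ → Lp ℝ 2 μ)
    (hΨ : ∀ k, Ψ k =ᵐ[μ] ψ k) (hΨ1 : ∀ k, ‖Ψ k‖ ≤ 1) (g : Lp ℝ 2 μ) :
    ‖Kop c Φ g - Kop c Ψ g‖ ^ 2 ≤ ‖g‖ ^ 2 *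
      ∫ z, ((∑' k, c k * (φ k z.1 * φ k z.2)) - (∑' k, c k * (ψ k z.1 * ψ k z.2))) ^ 2
        ∂(μ.prod μ) := by
  set w := Kop c Φ g - Kop c Ψ g with hw
  have hwg : MemLp (fun z : X × X => w z.1 * g z.2) 2 (μ.prod μ) := by
    have i0 := ((Lp.memLp w).integrable one_le_two).mul_prod ((Lp.memLp g).integrable one_le_two)
    rw [memLp_two_iff_integrable_sq i0.aestronglyMeasurable]
    have := (Lp.memLp w).integrable_sq.mul_prod (Lp.memLp g).integrable_sq
    simpa only [mul_pow] using this
  have e1 := inner_Kop_eq μ hc hs hm hb Φ hΦ hΦ1 w g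
  have e2 := inner_Kop_eq μ hc hs hm' hb' Ψ hΨ hΨ1 w g
  have m1 := tsum_meas μ hc hs hm hb
  have m2 := tsum_meas μ hc hs hm' hb'
  have e3 : ‖w‖ ^ 2 = ∫ z, (w z.1 * g z.2) * ((∑' k, c k * (φ k z.1 * φ k z.2))
      - (∑' k, c k * (ψ k z.1 * ψ k z.2))) ∂(μ.prod μ) := by
    simp_rw [mul_sub]
    rw [integral_sub, ← e1, ← e2, ← inner_sub_right, ← hw, real_inner_self_eq_norm_sq]
    · exact hwg.integrable_mul m1
    · exact hwg.integrable_mul m2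
  have h := l2_cs _ hwg (m1.sub m2)
  simp only [Pi.sub_apply] at h
  rw [← e3] at h
  have e4 : ∫ z, (w z.1 * g z.2) ^ 2 ∂(μ.prod μ) = ‖w‖ ^ 2 * ‖g‖ ^ 2 := by
    simp_rw [mul_pow]
    rw [integral_prod_mul (fun x => w x ^ 2) (fun x => g x ^ 2), norm_sq_Lp, norm_sq_Lp]
  rw [e4] at h
  set J := ∫ z, ((∑' k, c k * (φ k z.1 * φ k z.2)) - (∑' k, c k * (ψ k z.1 * ψ k z.2))) ^ 2
        ∂(μ.prod μ)
  have hJ : 0 ≤ J := integral_nonneg fun z => sq_nonneg _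
  by_cases h0 : ‖w‖ ^ 2 = 0
  · rw [h0]; positivity
  · have hp : 0 < ‖w‖ ^ 2 := lt_of_le_of_ne (sq_nonneg _) (Ne.symm h0)
    rw [pow_two (‖w‖ ^ 2), mul_assoc] at h
    exact le_of_mul_le_mul_left h hp

end meas

section topo
variable {X : Type*} [MetricSpace X] [CompactSpace X]
    [SecondCountableTopology X] [MeasurableSpace X] [BorelSpace X]
    (μ : Measure X) [IsProbabilityMeasure μ]

lemma exists_family : ∃ f : ℕ → C(X, ℝ), f 0 = 1 ∧ (∀ k x, |f k x| ≤ 1) ∧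
    (∀ k, ∫ x, f (k + 1) x ∂μ = 0) ∧
    ∀ u : Lp ℝ 2 μ, (∀ k, inner ℝ (ContinuousMap.toLp 2 μ ℝ (f k)) u = 0) → u = 0 := by
  let d := TopologicalSpace.denseSeq C(X, ℝ)
  have hd : DenseRange d := TopologicalSpace.denseRange_denseSeq _
  let f : ℕ → C(X, ℝ) := fun k => Nat.casesOn k 1 fun k =>
    (2 * (‖d k‖ + 1))⁻¹ • (d k - (∫ x, d k x ∂μ) • (1 : C(X, ℝ)))
  have hm : ∀ k, |∫ x, d k x ∂μ| ≤ ‖d k‖ := by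
    intro k
    have := norm_integral_le_of_norm_le_const (μ := μ) (f := d k) (C := ‖d k‖)
      (Eventually.of_forall fun x => (d k).norm_coe_le_norm x)
    simpa using this
  have hi : ∀ g : C(X, ℝ), Integrable g μ := fun g =>
    g.continuous.integrable_of_hasCompactSupport (HasCompactSupport.of_compactSpace _)
  refine ⟨f, rfl, ?_, ?_, ?_⟩
  · intro k x
    cases k with
    | zero => simp [f]
    | succ k =>
      have h1 := (d k).norm_coe_le_norm x
      rw [Real.norm_eq_abs] at h1
      have h2 := hm k
      have h3 : |d k x - ∫ x, d k x ∂μ| ≤ 2 * (‖d k‖ + 1) :=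
        (abs_sub _ _).trans (by linarith)
      have hp : 0 < 2 * (‖d k‖ + 1) := by positivity
      simp only [f, ContinuousMap.smul_apply, ContinuousMap.sub_apply, ContinuousMap.one_apply,
        smul_eq_mul, mul_one]
      rw [abs_mul, abs_of_pos (inv_pos.2 hp), inv_mul_le_iff₀ hp, mul_one]
      exact h3
  · intro k
    simp only [f, ContinuousMap.smul_apply, ContinuousMap.sub_apply, ContinuousMap.one_apply,
        smul_eq_mul, mul_one]
    rw [integral_const_mul, integral_sub (hi _) (integrable_const _)]
    simp
  · intro u hu
    have h0 : inner ℝ (ContinuousMap.toLp 2 μ ℝ (1 : C(X, ℝ))) u = 0 := hu 0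
    have hk : ∀ k, inner ℝ (ContinuousMap.toLp 2 μ ℝ (d k)) u = 0 := by
      intro k
      have := hu (k + 1)
      simp only [f, map_smul, map_sub, inner_smul_left, inner_sub_left, h0] at this
      have hp : ‖d k‖ + 1 ≠ 0 := by positivity
      simpa [hp] using this
    have hall : ∀ g : C(X, ℝ), inner ℝ (ContinuousMap.toLp 2 μ ℝ g) u = 0 := by
      intro g
      refine hd.induction_on (p := fun g => inner ℝ (ContinuousMap.toLp 2 μ ℝ g) u = 0) g ?_ hk
      exact isClosed_eq (by fun_prop) continuous_const
    have hv : ∀ v : Lp ℝ 2 μ, inner ℝ v u = 0 := by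
      intro v
      refine (ContinuousMap.toLp_denseRange ℝ μ ℝ (p := 2) (by simp)).induction_on
        (p := fun v => inner ℝ v u = 0) v ?_ hall
      exact isClosed_eq (by fun_prop) continuous_const
    exact inner_self_eq_zero.1 (hv u)

lemma exists_weights : ∃ c : ℕ → ℝ, c 0 = 1 ∧ (∀ k, 0 < c k) ∧ Summable c ∧
    ∑' k, c (k + 1) ≤ 1 := by
  refine ⟨fun k => (1 / 2) ^ k, by simp, fun k => by positivity, summable_geometric_two, ?_⟩
  have := summable_geometric_two.tsum_eq_zero_add
  rw [tsum_geometric_two] at this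
  simp only [pow_zero] at this
  linarith

lemma lens_iter (T : X ≃ᵐ X) (ξ : ProbabilityMeasure (X × X)) (k : ℕ) :
    (((lensP T)^[k] ξ : ProbabilityMeasure (X × X)) : Measure (X × X)) =
      (ξ : Measure (X × X)).map (fun z => (T^[k] z.1, T^[k] z.2)) := by
  induction k with
  | zero => simp
  | succ k ih =>
    rw [Function.iterate_succ_apply']
    change (((lensP T)^[k] ξ : ProbabilityMeasure (X × X)) : Measure (X × X)).map
      (T.prodCongr T) = _
    have hk : Measurable (T^[k]) := T.measurable.iterate k
    rw [ih, Measure.map_map (T.prodCongr T).measurable (by fun_prop)]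
    congr 1
    funext z
    simp only [Function.comp, Function.iterate_succ_apply']
    rfl

lemma isProb_of_marg {ξ : Measure (X × X)} (h : ξ.map Prod.fst = μ) : IsProbabilityMeasure ξ := by
  constructor
  have : (ξ.map Prod.fst) Set.univ = 1 := by rw [h]; exact measure_univ
  rwa [Measure.map_apply measurable_fst MeasurableSet.univ, Set.preimage_univ] at this

/-- marginal computation -/
lemma marg_fst {p : X × X → ℝ} (hp : Continuous p) (h0 : ∀ z, 0 ≤ p z)
    (h1 : ∀ x, ∫ y, p (x, y) ∂μ = 1) :
    ((μ.prod μ).withDensity fun z => ENNReal.ofReal (p z)).map Prod.fst = μ := by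
  ext A hA
  rw [Measure.map_apply measurable_fst hA, withDensity_apply _ (measurable_fst hA),
    ← Set.prod_univ, ← Measure.prod_restrict, lintegral_prod _ (by fun_prop)]
  have : ∀ x, ∫⁻ y, ENNReal.ofReal (p (x, y)) ∂(μ.restrict Set.univ) = 1 := by
    intro x
    rw [Measure.restrict_univ, ← ofReal_integral_eq_lintegral_ofReal, h1 x, ENNReal.ofReal_one]
    · exact (hp.comp (by fun_prop : Continuous fun y => (x, y))).integrable_of_hasCompactSupport
        (HasCompactSupport.of_compactSpace _)
    · exact Eventually.of_forall fun y => h0 _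
  simp only [this]
  simp

lemma marg_snd {p : X × X → ℝ} (hp : Continuous p) (h0 : ∀ z, 0 ≤ p z)
    (h1 : ∀ y, ∫ x, p (x, y) ∂μ = 1) :
    ((μ.prod μ).withDensity fun z => ENNReal.ofReal (p z)).map Prod.snd = μ := by
  ext A hA
  rw [Measure.map_apply measurable_snd hA, withDensity_apply _ (measurable_snd hA),
    ← Set.univ_prod, ← Measure.prod_restrict, lintegral_prod_symm _ (by fun_prop)]
  have : ∀ y, ∫⁻ x, ENNReal.ofReal (p (x, y)) ∂(μ.restrict Set.univ) = 1 := by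
    intro y
    rw [Measure.restrict_univ, ← ofReal_integral_eq_lintegral_ofReal, h1 y, ENNReal.ofReal_one]
    · exact (hp.comp (by fun_prop : Continuous fun x => (x, y))).integrable_of_hasCompactSupport
        (HasCompactSupport.of_compactSpace _)
    · exact Eventually.of_forall fun y => h0 _
  simp only [this]
  simp

lemma l2_return (T : X ≃ᵐ X) (hT : MeasurePreserving T μ μ)
    (hrec : ∀ ξ : ProbabilityMeasure (X × X),
      (ξ : Measure (X × X)).map Prod.fst = μ → (ξ : Measure (X × X)).map Prod.snd = μ →
      MapClusterPt ξ atTop (fun k => (lensP T)^[k] ξ))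
    {p : X × X → ℝ} (hp : Continuous p) (h0 : ∀ z, 0 ≤ p z)
    (h1 : ∀ x, ∫ y, p (x, y) ∂μ = 1) (h2 : ∀ y, ∫ x, p (x, y) ∂μ = 1) :
    ∃ U : Ultrafilter ℕ, (U : Filter ℕ) ≤ atTop ∧
      Tendsto (fun n => ∫ z, (p (T^[n] z.1, T^[n] z.2) - p z) ^ 2 ∂(μ.prod μ)) U (nhds 0) := by
  have m1 := marg_fst μ hp h0 h1
  have m2 := marg_snd μ hp h0 h2
  have hP := isProb_of_marg μ m1
  obtain ⟨ξ, hξ⟩ : ∃ ξ : ProbabilityMeasure (X × X), (ξ : Measure (X × X)) =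
    (μ.prod μ).withDensity fun z => ENNReal.ofReal (p z) := ⟨⟨_, hP⟩, rfl⟩
  rw [← hξ] at m1 m2
  obtain ⟨U, hU, hUt⟩ := mapClusterPt_iff_ultrafilter.1 (hrec ξ m1 m2)
  refine ⟨U, hU, ?_⟩
  rw [ProbabilityMeasure.tendsto_iff_forall_integral_tendsto] at hUt
  have h3 := hUt (BoundedContinuousFunction.mkOfCompact ⟨p, hp⟩)
  have hS : ∀ n, MeasurePreserving (fun z : X × X => (T^[n] z.1, T^[n] z.2)) (μ.prod μ)
    (μ.prod μ) := fun n => (hT.iterate n).prod (hT.iterate n)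
  have hd : ∀ q : X × X → ℝ, ∫ z, q z ∂((μ.prod μ).withDensity fun z => ENNReal.ofReal (p z)) =
      ∫ z, p z * q z ∂(μ.prod μ) := by
    intro q
    rw [integral_withDensity_eq_integral_toReal_smul (by fun_prop) (by simp)]
    simp [ENNReal.toReal_ofReal, h0]
  simp only [lens_iter, BoundedContinuousFunction.mkOfCompact_apply, ContinuousMap.coe_mk, hξ] at h3
  have h4 : Tendsto (fun n => ∫ z, p z * p (T^[n] z.1, T^[n] z.2) ∂(μ.prod μ)) U
      (nhds (∫ z, p z * p z ∂(μ.prod μ))) := by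
    rw [hd] at h3
    refine h3.congr fun n => ?_
    rw [integral_map (hS n).measurable.aemeasurable hp.aestronglyMeasurable, hd]
  have hL : MemLp p 2 (μ.prod μ) :=
    hp.memLp_of_hasCompactSupport (HasCompactSupport.of_compactSpace _)
  have hLn : ∀ n, MemLp (fun z : X × X => p (T^[n] z.1, T^[n] z.2)) 2 (μ.prod μ) :=
    fun n => hL.comp_measurePreserving (hS n)
  have e : ∀ n, ∫ z, (p (T^[n] z.1, T^[n] z.2) - p z) ^ 2 ∂(μ.prod μ) =
      2 * (∫ z, p z * p z ∂(μ.prod μ)) -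
        2 * ∫ z, p z * p (T^[n] z.1, T^[n] z.2) ∂(μ.prod μ) := by
    intro n
    have e1 : ∫ z, p (T^[n] z.1, T^[n] z.2) * p (T^[n] z.1, T^[n] z.2) ∂(μ.prod μ) =
        ∫ z, p z * p z ∂(μ.prod μ) := by
      conv_rhs => rw [← (hS n).map_eq]
      rw [integral_map (hS n).measurable.aemeasurable (by fun_prop)]
    have i1 : Integrable (fun z : X × X => p (T^[n] z.1, T^[n] z.2) *
      p (T^[n] z.1, T^[n] z.2)) (μ.prod μ) := (hLn n).integrable_mul (hLn n)
    have i2 : Integrable (fun z : X × X => p z * p z) (μ.prod μ) := hL.integrable_mul hL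
    have i3 : Integrable (fun z : X × X => p z * p (T^[n] z.1, T^[n] z.2)) (μ.prod μ) :=
      hL.integrable_mul (hLn n)
    have i12 : Integrable (fun z : X × X => p (T^[n] z.1, T^[n] z.2) *
      p (T^[n] z.1, T^[n] z.2) + p z * p z) (μ.prod μ) := i1.add i2
    calc ∫ z, (p (T^[n] z.1, T^[n] z.2) - p z) ^ 2 ∂(μ.prod μ) =
        ∫ z, (p (T^[n] z.1, T^[n] z.2) * p (T^[n] z.1, T^[n] z.2) + p z * p z) -
          2 * (p z * p (T^[n] z.1, T^[n] z.2)) ∂(μ.prod μ) := by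
          congr 1
          ext z
          ring
      _ = _ := by
          rw [integral_sub i12 (i3.const_mul 2), integral_add i1 i2, e1,
            integral_const_mul]
          ring
  simp_rw [e]
  have := (tendsto_const_nhds (x := 2 * (∫ z, p z * p z ∂(μ.prod μ)))).sub (h4.const_mul 2)
  simpa using this

end topo

/-- If the topological lens `(C₂(μ), T̃)` is pointwise recurrent
(every coupling returns arbitrarily close to itself infinitely often, i.e. every
coupling is a cluster point of its own forward orbit), then `T` is rigid: there is an
increasing sequence `(n i)` with `μ(T^{n i} A Δ A) → 0` for every measurable `A`. -/
theorem lens_stmt11 {X : Type*} [MetricSpace X] [CompactSpace X]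
    [SecondCountableTopology X] [MeasurableSpace X] [BorelSpace X]
    (μ : Measure X) [IsProbabilityMeasure μ]
    (T : X ≃ᵐ X) (hT : MeasurePreserving T μ μ)
    (hrec : ∀ ξ : ProbabilityMeasure (X × X),
      (ξ : Measure (X × X)).map Prod.fst = μ → (ξ : Measure (X × X)).map Prod.snd = μ →
      MapClusterPt ξ atTop (fun k => (lensP T)^[k] ξ)) :
    ∃ n : ℕ → ℕ, StrictMono n ∧ ∀ A : Set X, MeasurableSet A →
      Tendsto (fun i => μ (symmDiff ((⇑T)^[n i] ⁻¹' A) A)) atTop (nhds 0) := by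
  obtain ⟨f, hf0, hf1, hfi, htot⟩ := exists_family μ
  obtain ⟨c, hc0, hc, hs, hc1⟩ := exists_weights
  -- the kernel
  let p : X × X → ℝ := fun z => ∑' k, c k * (f k z.1 * f k z.2)
  have hbd : ∀ k (z : X × X), ‖c k * (f k z.1 * f k z.2)‖ ≤ c k := by
    intro k z
    rw [norm_mul (c k), Real.norm_of_nonneg (hc k).le, norm_mul (f k z.1)]
    have h1 := hf1 k z.1
    have h2 := hf1 k z.2
    rw [← Real.norm_eq_abs] at h1 h2
    exact mul_le_of_le_one_right (hc k).le (mul_le_one₀ h1 (norm_nonneg _) h2)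
  have hsz : ∀ z : X × X, Summable fun k => c k * (f k z.1 * f k z.2) := fun z =>
    Summable.of_norm_bounded hs fun k => hbd k z
  have hpc : Continuous p := continuous_tsum (fun k => by fun_prop) hs hbd
  have hp0 : ∀ z, 0 ≤ p z := by
    intro z
    have e := (hsz z).tsum_eq_zero_add
    have hs' : Summable fun k => c (k + 1) := (summable_nat_add_iff 1).2 hs
    have h := tsum_of_norm_bounded hs'.hasSum fun k => hbd (k + 1) z
    have h' := (abs_le.1 (Real.norm_eq_abs _ ▸ h)).1
    simp only [hf0, hc0, ContinuousMap.one_apply, mul_one] at e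
    change 0 ≤ ∑' k, c k * (f k z.1 * f k z.2)
    linarith
  have hint : ∀ (g : C(X, ℝ)), Integrable g μ := fun g =>
    g.continuous.integrable_of_hasCompactSupport (HasCompactSupport.of_compactSpace _)
  have hp1 : ∀ x, ∫ y, p (x, y) ∂μ = 1 := by
    intro x
    have hF := hasSum_integral_of_dominated_convergence (μ := μ)
      (F := fun k y => c k * (f k x * f k y)) (f := fun y => p (x, y))
      (fun k _ => c k) (fun k => ((hint (f k)).const_mul _).const_mul _ |>.aestronglyMeasurable)
      (fun k => Eventually.of_forall fun y => hbd k (x, y))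
      (Eventually.of_forall fun y => hs) (integrable_const _)
      (Eventually.of_forall fun y => (hsz (x, y)).hasSum)
    refine hF.unique ?_
    have := hasSum_single (f := fun k => ∫ y, c k * (f k x * f k y) ∂μ) 0 (by
      intro k hk
      obtain ⟨j, rfl⟩ := Nat.exists_eq_succ_of_ne_zero hk
      rw [integral_const_mul, integral_const_mul, hfi]
      simp)
    simpa [hf0, hc0] using this
  have hp2 : ∀ y, ∫ x, p (x, y) ∂μ = 1 := by
    intro y
    rw [← hp1 y]
    congr 1
    ext x
    simp only [p]
    congr 1
    ext k
    ring
  obtain ⟨U, hU, hUt⟩ := l2_return μ T hT hrec hpc hp0 hp1 hp2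
  -- Koopman isometries
  let V : ℕ → Lp ℝ 2 μ →ₗᵢ[ℝ] Lp ℝ 2 μ := fun n =>
    Lp.compMeasurePreservingₗᵢ ℝ (T^[n]) (hT.iterate n)
  have hVae : ∀ n (g : Lp ℝ 2 μ), V n g =ᵐ[μ] g ∘ T^[n] := fun n g =>
    Lp.coeFn_compMeasurePreserving g (hT.iterate n)
  have hVV : ∀ m n x, V m (V n x) = V (n + m) x := by
    intro m n x
    apply Lp.ext
    refine (hVae m _).trans (.trans ?_ (hVae (n + m) x).symm)
    rw [Function.iterate_add, ← Function.comp_assoc]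
    exact (hT.iterate m).quasiMeasurePreserving.ae_eq_comp (hVae n x)
  let F : ℕ → Lp ℝ 2 μ := fun k => ContinuousMap.toLp 2 μ ℝ (f k)
  have hFae : ∀ k, F k =ᵐ[μ] f k := fun k => ContinuousMap.coeFn_toLp μ (f k)
  have hF1 : ∀ k, ‖F k‖ ≤ 1 := by
    intro k
    have h := norm_sq_Lp μ (F k)
    have h2 : ∫ x, F k x ^ 2 ∂μ ≤ ∫ x, (1 : ℝ) ∂μ := by
      refine integral_mono_ae (Lp.memLp (F k)).integrable_sq (integrable_const _) ?_
      filter_upwards [hFae k] with x hx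
      rw [hx]
      exact (sq_le_one_iff_abs_le_one _).2 (hf1 k x)
    rw [h] at h2
    simp only [integral_const, probReal_univ, smul_eq_mul, mul_one] at h2
    exact (sq_le_one_iff₀ (norm_nonneg _)).1 h2
  have hcomm : ∀ x, Tendsto (fun n => V n (Kop c F x) - Kop c F (V n x)) U (nhds 0) := by
    intro x
    have hb : ∀ n, ‖V n (Kop c F x) - Kop c F (V n x)‖ ^ 2 ≤ ‖x‖ ^ 2 *
        ∫ z, (p (T^[n] z.1, T^[n] z.2) - p z) ^ 2 ∂(μ.prod μ) := by
      intro n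
      rw [map_Kop hc hs hF1]
      have := Kop_diff μ hc hs (φ := fun k => f k ∘ T^[n]) (ψ := fun k => f k)
        (fun k => (f k).continuous.measurable.comp (T.measurable.iterate n))
        (fun k x => hf1 k _) (fun k => V n (F k))
        (fun k => (hVae n (F k)).trans
          ((hT.iterate n).quasiMeasurePreserving.ae_eq_comp (hFae k)))
        (fun k => by rw [LinearIsometry.norm_map]; exact hF1 k)
        (fun k => (f k).continuous.measurable) hf1 F hFae hF1 (V n x)
      rw [LinearIsometry.norm_map] at this
      exact this
    have h0 : Tendsto (fun n => ‖V n (Kop c F x) - Kop c F (V n x)‖ ^ 2) U (nhds 0) := by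
      refine squeeze_zero (fun n => sq_nonneg _) hb ?_
      simpa using hUt.const_mul (‖x‖ ^ 2)
    rw [tendsto_zero_iff_norm_tendsto_zero]
    have := h0.sqrt
    simpa [Real.sqrt_sq (norm_nonneg _)] using this
  have hsep : TopologicalSpace.SeparableSpace (Lp ℝ 2 μ) :=
    (ContinuousMap.toLp_denseRange ℝ μ ℝ (p := 2) (by simp)).separableSpace
      (ContinuousMap.toLp 2 μ ℝ).continuous
  obtain ⟨n, hn, hlim⟩ := rigid_of_cauchy V hVV U hU
    fun x ε hε => cauchy_of_comm hc hs hF1 htot V U hcomm x ε hε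
  refine ⟨n, hn, fun A hA => ?_⟩
  have h1 := hlim (indicatorConstLp 2 hA (measure_ne_top μ A) (1 : ℝ))
  have h2 : ∀ i, V (n i) (indicatorConstLp 2 hA (measure_ne_top μ A) (1 : ℝ)) =
      indicatorConstLp 2 ((hT.iterate (n i)).measurable hA) (measure_ne_top μ _) (1 : ℝ) :=
    fun i => Lp.indicatorConstLp_compMeasurePreserving hA (measure_ne_top μ A) 1
      (hT.iterate (n i))
  simp only [h2] at h1
  rw [tendsto_iff_edist_tendsto_0] at h1
  simp only [edist_indicatorConstLp_eq_enorm] at h1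
  have h3 : ∀ i, μ (symmDiff ((⇑T)^[n i] ⁻¹' A) A) =
      ‖indicatorConstLp 2 (((hT.iterate (n i)).measurable hA).symmDiff hA)
        (measure_ne_top μ _) (1 : ℝ)‖ₑ ^ 2 := by
    intro i
    unfold indicatorConstLp
    rw [Lp.enorm_toLp, eLpNorm_indicator_const
      (((hT.iterate (n i)).measurable hA).symmDiff hA) (by simp) (by simp)]
    simp only [enorm_one, one_mul, ENNReal.toReal_ofNat]
    rw [← ENNReal.rpow_natCast, ← ENNReal.rpow_mul]
    norm_num
  simp only [h3]
  have := ENNReal.Tendsto.pow (n := 2) h1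
  simpa using this
end

section
/- For a measure-preserving automorphism T of a standard probability space (X,B,μ), the following are equivalent: (i) T is rigid; (ii) the lens T̃ on C₂(μ) is pointwise recurrent; (iii) T̃ is rigid (T̃^{n_i} → Id pointwise for some increasing (n_i)); (iv) T̃ is uniformly rigid. -/
open MeasureTheory Filter

section LensAux

variable {X : Type*} [MetricSpace X] [CompactSpace X]
    [SecondCountableTopology X] [MeasurableSpace X] [BorelSpace X]

lemma lensP_iterate {X : Type*} [MeasurableSpace X] (T : X ≃ᵐ X)
    (ξ : ProbabilityMeasure (X × X)) (k : ℕ) :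
    (((lensP T)^[k] ξ : ProbabilityMeasure (X × X)) : Measure (X × X))
      = (ξ : Measure (X × X)).map (Prod.map (⇑T)^[k] (⇑T)^[k]) := by
  induction k with
  | zero => simp
  | succ k ih =>
    have hm : Measurable (Prod.map (⇑T)^[k] (⇑T)^[k]) :=
      (T.measurable.iterate k).prodMap (T.measurable.iterate k)
    rw [Function.iterate_succ_apply', lensP, ProbabilityMeasure.toMeasure_map, ih,
      Measure.map_map (T.prodCongr T).measurable hm]
    congr 1
    ext x
    · simp only [MeasurableEquiv.prodCongr]
      exact (Function.iterate_succ_apply' T k _).symm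
    · simp only [MeasurableEquiv.prodCongr]
      exact (Function.iterate_succ_apply' T k _).symm

/-- rigidity gives convergence in measure of `T^n x` to `x`. -/
lemma rigid_dist (μ : Measure X) [IsProbabilityMeasure μ]
    (T : X ≃ᵐ X) (hT : MeasurePreserving T μ μ) (n : ℕ → ℕ)
    (h : ∀ f : Lp ℝ 2 μ, Tendsto (fun i =>
              ‖Lp.compMeasurePreserving ((⇑T)^[n i]) (hT.iterate (n i)) f - f‖)
            atTop (nhds 0)) (ε : ℝ) (hε : 0 < ε) :
    Tendsto (fun i => μ {x | ε ≤ dist ((⇑T)^[n i] x) x}) atTop (nhds 0) := by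
  obtain ⟨t, -, htf, ht⟩ := (isCompact_univ (X := X)).finite_cover_balls (e := ε / 3) (by positivity)
  have key : ∀ y : X, Tendsto (fun i => μ {x | ε / 3 ≤ ‖dist ((⇑T)^[n i] x) y - dist x y‖})
      atTop (nhds 0) := by
    intro y
    have hmem : MemLp (fun x : X => dist x y) 2 μ := by
      refine MemLp.of_bound (by fun_prop) (Metric.diam (Set.univ : Set X)) (ae_of_all _ fun x => ?_)
      rw [Real.norm_of_nonneg dist_nonneg]
      exact Metric.dist_le_diam_of_mem isCompact_univ.isBounded (Set.mem_univ _) (Set.mem_univ _)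
    have h1 := h (hmem.toLp _)
    have h2 : TendstoInMeasure μ (fun i x => dist ((⇑T)^[n i] x) y) atTop (fun x => dist x y) := by
      refine tendstoInMeasure_of_tendsto_eLpNorm (p := 2) (by simp) ?_ hmem.1 ?_
      · intro i
        exact ((hmem.comp_measurePreserving (hT.iterate (n i)))).1
      · have : ∀ i, eLpNorm ((fun x => dist ((⇑T)^[n i] x) y) - (fun x => dist x y)) 2 μ =
          ENNReal.ofReal ‖Lp.compMeasurePreserving ((⇑T)^[n i]) (hT.iterate (n i)) (hmem.toLp _)
            - hmem.toLp _‖ := by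
          intro i
          rw [Lp.toLp_compMeasurePreserving hmem, ← MemLp.toLp_sub, Lp.norm_toLp,
            ENNReal.ofReal_toReal]
          · rfl
          · exact ((hmem.comp_measurePreserving (hT.iterate (n i))).sub hmem).2.ne
        simp_rw [this]
        simpa using (ENNReal.tendsto_ofReal h1)
    have := tendstoInMeasure_iff_norm.1 h2 (ε/3) (by positivity)
    exact this
  have hsum : Tendsto (fun i => ∑ y ∈ htf.toFinset,
      μ {x | ε / 3 ≤ ‖dist ((⇑T)^[n i] x) y - dist x y‖}) atTop (nhds 0) := by
    have := tendsto_finsetSum htf.toFinset (fun y _ => key y)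
    simpa using this
  refine tendsto_of_tendsto_of_tendsto_of_le_of_le tendsto_const_nhds hsum (fun _ => zero_le) ?_
  intro i
  refine le_trans (measure_mono ?_) (measure_biUnion_finset_le _ _)
  intro x hx
  obtain ⟨y, hy, hxy⟩ := Set.mem_iUnion₂.1 (ht (Set.mem_univ x))
  refine Set.mem_iUnion₂.2 ⟨y, by simpa using hy, ?_⟩
  simp only [Set.mem_ofPred_eq, Metric.mem_ball] at hx hxy ⊢
  have := dist_triangle_right ((⇑T)^[n i] x) x y
  have h3 := le_abs_self (dist ((⇑T)^[n i] x) y - dist x y)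
  rw [Real.norm_eq_abs]
  linarith

lemma lp_bound (μ : Measure X) [IsProbabilityMeasure μ]
    (T : X ≃ᵐ X) (k : ℕ) (ε : ℝ) (hε : 0 < ε)
    (h : μ {x | ε ≤ dist ((⇑T)^[k] x) x} ≤ ENNReal.ofReal (ε / 2))
    (ξ : ProbabilityMeasure (X × X))
    (h1 : (ξ : Measure (X × X)).map Prod.fst = μ)
    (h2 : (ξ : Measure (X × X)).map Prod.snd = μ) :
    levyProkhorovDist (((lensP T)^[k] ξ : ProbabilityMeasure (X × X)) : Measure (X × X))
                  (ξ : Measure (X × X)) ≤ ε := by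
  have hTk : Measurable (⇑T)^[k] := T.measurable.iterate k
  refine levyProkhorovDist_le_of_forall_le _ _ hε.le ?_
  intro δ B hδ hB
  have hm : Measurable (Prod.map (⇑T)^[k] (⇑T)^[k]) := hTk.prodMap hTk
  set E : Set X := {x | ε ≤ dist ((⇑T)^[k] x) x} with hE
  have hEm : MeasurableSet E := measurableSet_le measurable_const (hTk.dist measurable_id)
  rw [lensP_iterate, Measure.map_apply hm hB]
  have hsub : Prod.map (⇑T)^[k] (⇑T)^[k] ⁻¹' B ⊆
      Metric.thickening δ B ∪ (Prod.fst ⁻¹' E ∪ Prod.snd ⁻¹' E) := by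
    intro z hz
    by_cases hz1 : z.1 ∈ E
    · right; left; exact hz1
    by_cases hz2 : z.2 ∈ E
    · right; right; exact hz2
    left
    rw [Metric.mem_thickening_iff]
    refine ⟨_, hz, ?_⟩
    simp only [hE, Set.mem_ofPred_eq, not_le] at hz1 hz2
    rw [dist_comm, Prod.dist_eq]
    exact max_lt (hz1.trans hδ) (hz2.trans hδ)
  refine (measure_mono hsub).trans ((measure_union_le _ _).trans ?_)
  gcongr
  refine (measure_union_le _ _).trans ?_
  rw [← Measure.map_apply measurable_fst hEm, ← Measure.map_apply measurable_snd hEm, h1, h2]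
  calc μ E + μ E ≤ ENNReal.ofReal (ε/2) + ENNReal.ofReal (ε/2) := add_le_add h h
    _ = ENNReal.ofReal ε := by rw [← ENNReal.ofReal_add (by positivity) (by positivity)]; simp
    _ ≤ _ := ENNReal.ofReal_le_ofReal hδ.le

lemma lpd_le_one {Ω : Type*} [MeasurableSpace Ω] [PseudoMetricSpace Ω]
   (ξ η : ProbabilityMeasure Ω) :
    levyProkhorovDist (ξ : Measure Ω) (η : Measure Ω) ≤ 1 := by
  refine ENNReal.toReal_le_of_le_ofReal zero_le_one ?_
  simpa using levyProkhorovEDist_le_max_measure_univ (ξ : Measure Ω) (η : Measure Ω)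

end LensAux

section LensAux2

variable {X : Type*} [MeasurableSpace X]

/-- marginals of the rank-one perturbation of the product coupling -/
lemma rankone_marg (μ : Measure X) [IsProbabilityMeasure μ] (g : X → ℝ) (hg : Measurable g)
    (hb : ∀ x, |g x| ≤ 1) (h0 : ∫ x, g x ∂μ = 0) :
    ((μ.prod μ).withDensity (fun z => ENNReal.ofReal (1 + g z.1 * g z.2))).map Prod.fst = μ ∧
    ((μ.prod μ).withDensity (fun z => ENNReal.ofReal (1 + g z.1 * g z.2))).map Prod.snd = μ := by
  have hint : Integrable g μ := Integrable.of_bound hg.aestronglyMeasurable 1 (ae_of_all _ hb)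
  have hlin : ∀ a : X, ∫⁻ y, ENNReal.ofReal (1 + g a * g y) ∂μ = 1 := by
    intro a
    rw [← ofReal_integral_eq_lintegral_ofReal]
    · rw [integral_add (integrable_const _) (hint.const_mul _), integral_const_mul, h0]
      simp
    · exact (integrable_const _).add (hint.const_mul _)
    · refine ae_of_all _ fun y => ?_
      have : |g a * g y| ≤ 1 := by
        rw [abs_mul]; exact mul_le_one₀ (hb _) (abs_nonneg _) (hb _)
      have := (abs_le.1 this).1
      simp only [Pi.zero_apply]
      linarith
  have hK : Measurable (fun z : X × X => ENNReal.ofReal (1 + g z.1 * g z.2)) := by fun_prop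
  constructor
  · ext A hA
    rw [Measure.map_apply measurable_fst hA, withDensity_apply _ (measurable_fst hA),
      ← lintegral_indicator (measurable_fst hA),
      lintegral_prod _ (hK.indicator (measurable_fst hA)).aemeasurable]
    have : ∀ x, ∫⁻ y, (Prod.fst ⁻¹' A).indicator
        (fun z : X × X => ENNReal.ofReal (1 + g z.1 * g z.2)) (x, y) ∂μ = A.indicator 1 x := by
      intro x
      by_cases hx : x ∈ A
      · simp [Set.indicator, hx, hlin]
      · simp [Set.indicator, hx]
    simp_rw [this]
    rw [lintegral_indicator_one hA]
  · ext A hA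
    rw [Measure.map_apply measurable_snd hA, withDensity_apply _ (measurable_snd hA),
      ← lintegral_indicator (measurable_snd hA),
      lintegral_prod_symm _ (hK.indicator (measurable_snd hA)).aemeasurable]
    have : ∀ x, ∫⁻ y, (Prod.snd ⁻¹' A).indicator
        (fun z : X × X => ENNReal.ofReal (1 + g z.1 * g z.2)) (y, x) ∂μ = A.indicator 1 x := by
      intro x
      by_cases hx : x ∈ A
      · have := hlin x
        simp_rw [mul_comm (g x)] at this
        simp [Set.indicator, hx, this]
      · simp [Set.indicator, hx]
    simp_rw [this]
    rw [lintegral_indicator_one hA]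

lemma rankone_integral (μ : Measure X) [IsProbabilityMeasure μ] (g : X → ℝ) (hg : Measurable g)
    (hb : ∀ x, |g x| ≤ 1) (f : X → ℝ) (hf : Measurable f) (C : ℝ) (hC : ∀ x, |f x| ≤ C) :
    ∫ z, f z.1 * f z.2 ∂((μ.prod μ).withDensity (fun z => ENNReal.ofReal (1 + g z.1 * g z.2)))
      = (∫ x, f x ∂μ) ^ 2 + (∫ x, f x * g x ∂μ) ^ 2 := by
  have hK : Measurable (fun z : X × X => ENNReal.ofReal (1 + g z.1 * g z.2)) := by fun_prop
  rw [integral_withDensity_eq_integral_toReal_smul hK (ae_of_all _ fun _ => ENNReal.ofReal_lt_top)]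
  have hfi : Integrable f μ := Integrable.of_bound hf.aestronglyMeasurable C (ae_of_all _ hC)
  have hfg : Integrable (fun x => f x * g x) μ := by
    refine Integrable.of_bound (by fun_prop) C (ae_of_all _ fun x => ?_)
    rw [Real.norm_eq_abs, abs_mul]
    exact mul_le_of_le_one_right ((abs_nonneg _).trans (hC x)) (hb x) |>.trans' (by gcongr; exact hC x)
  have : ∀ z : X × X, (ENNReal.ofReal (1 + g z.1 * g z.2)).toReal • (f z.1 * f z.2)
      = f z.1 * f z.2 + (f z.1 * g z.1) * (f z.2 * g z.2) := by
    intro z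
    have h1 : |g z.1 * g z.2| ≤ 1 := by
        rw [abs_mul]; exact mul_le_one₀ (hb _) (abs_nonneg _) (hb _)
    have := (abs_le.1 h1).1
    rw [ENNReal.toReal_ofReal (by linarith), smul_eq_mul]
    ring
  simp_rw [this]
  rw [integral_add (hfi.mul_prod hfi) (hfg.mul_prod hfg), integral_prod_mul, 
    integral_prod_mul (fun x => f x * g x) (fun x => f x * g x)]
  ring

/-- If `g` is a measurable embedding and `g ∘ S i → g` a.e., then `f ∘ S i → f` in `L²`. -/
lemma tendsto_of_embedding (μ : Measure X) [IsProbabilityMeasure μ] (g : X → ℝ)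
    (hg : MeasurableEmbedding g) (S : ℕ → X → X) (hS : ∀ i, MeasurePreserving (S i) μ μ)
    (hconv : ∀ᵐ x ∂μ, Tendsto (fun i => g (S i x)) atTop (nhds (g x))) (f : Lp ℝ 2 μ) :
    Tendsto (fun i => ‖Lp.compMeasurePreserving (S i) (hS i) f - f‖) atTop (nhds 0) := by
  obtain ⟨F, hF, hFg⟩ := hg.exists_stronglyMeasurable_extend (Lp.stronglyMeasurable f)
    (fun _ => ⟨0⟩)
  have hFL : MemLp F 2 (μ.map g) := by
    rw [hg.memLp_map_measure_iff, hFg]; exact Lp.memLp f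
  rw [Metric.tendsto_atTop]
  intro ε hε
  have := Measure.isProbabilityMeasure_map (μ := μ) hg.measurable.aemeasurable
  obtain ⟨H, hH, hHL⟩ := hFL.exists_boundedContinuous_eLpNorm_sub_le (by simp)
    (ε := ENNReal.ofReal (ε / 4)) (by simpa using hε)
  have hHL' : MemLp (H ∘ g) 2 μ := (hg.memLp_map_measure_iff).1 hHL
  set h := hHL'.toLp _ with hh
  have hfh : ‖f - h‖ ≤ ε / 4 := by
    rw [← Lp.toLp_coeFn f (Lp.memLp f), hh, ← MemLp.toLp_sub, Lp.norm_toLp]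
    refine ENNReal.toReal_le_of_le_ofReal (by positivity) ?_
    rw [hg.eLpNorm_map_measure] at hH
    convert hH using 2
    rw [← hFg]; rfl
  have hconv2 : Tendsto (fun i => ‖Lp.compMeasurePreserving (S i) (hS i) h - h‖ ^ 2)
      atTop (nhds 0) := by
    have e : ∀ i, ‖Lp.compMeasurePreserving (S i) (hS i) h - h‖ ^ 2
        = ∫ x, (H (g (S i x)) - H (g x)) ^ 2 ∂μ := by
      intro i
      rw [hh, Lp.toLp_compMeasurePreserving hHL', ← MemLp.toLp_sub, ← real_inner_self_eq_norm_sq,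
        L2.inner_def]
      refine integral_congr_ae ?_
      filter_upwards [MemLp.coeFn_toLp ((hHL'.comp_measurePreserving (hS i)).sub hHL')] with x hx
      rw [hx]
      simp [sq]
    simp_rw [e]
    have : (0:ℝ) = ∫ x, (0:ℝ) ∂μ := by simp
    rw [this]
    refine tendsto_integral_of_dominated_convergence (fun _ => (2 * ‖H‖) ^ 2) ?_ 
      (integrable_const _) ?_ ?_
    · intro i
      have := (hS i).measurable
      have h3 := hg.measurable
      have h4 := H.continuous.measurable
      exact (((h4.comp (h3.comp this)).sub (h4.comp h3)).pow_const 2).aestronglyMeasurable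
    · intro i
      refine ae_of_all _ fun x => ?_
      rw [norm_pow]
      gcongr
      refine (norm_sub_le _ _).trans ?_
      have := H.norm_coe_le_norm (g (S i x))
      have := H.norm_coe_le_norm (g x)
      linarith
    · filter_upwards [hconv] with x hx
      have : Tendsto (fun i => H (g (S i x))) atTop (nhds (H (g x))) :=
        (H.continuous.tendsto _).comp hx
      simpa using (this.sub_const (H (g x))).pow 2
  obtain ⟨N, hN⟩ := Metric.tendsto_atTop.1 hconv2 ((ε/4)^2) (by positivity)
  refine ⟨N, fun i hi => ?_⟩
  have h1 := hN i hi
  rw [Real.dist_eq, sub_zero, abs_of_nonneg (by positivity)] at h1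
  have h2 := lt_of_pow_lt_pow_left₀ 2 (by positivity) h1
  rw [Real.dist_eq, sub_zero, abs_of_nonneg (by positivity)]
  have e : Lp.compMeasurePreserving (S i) (hS i) f - f
     = Lp.compMeasurePreserving (S i) (hS i) (f - h)
      + (Lp.compMeasurePreserving (S i) (hS i) h - h) - (f - h) := by
    rw [map_sub]; abel
  rw [e]
  have t1 := norm_sub_le (Lp.compMeasurePreserving (S i) (hS i) (f - h)
      + (Lp.compMeasurePreserving (S i) (hS i) h - h)) (f - h)
  have t2 := norm_add_le (Lp.compMeasurePreserving (S i) (hS i) (f - h))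
      (Lp.compMeasurePreserving (S i) (hS i) h - h)
  rw [Lp.norm_compMeasurePreserving] at t2
  linarith

end LensAux2

section LensAux3

variable {X : Type*} [MetricSpace X] [CompactSpace X]
    [SecondCountableTopology X] [MeasurableSpace X] [BorelSpace X]

/-- recurrence of the rank-one coupling: correlations of `g` return. -/
lemma corr_frequently (μ : Measure X) [IsProbabilityMeasure μ]
    (T : X ≃ᵐ X) (hT : MeasurePreserving T μ μ)
    (hrec : ∀ ξ : ProbabilityMeasure (X × X),
          (ξ : Measure (X × X)).map Prod.fst = μ →
          (ξ : Measure (X × X)).map Prod.snd = μ →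
          MapClusterPt ξ atTop (fun k => (lensP T)^[k] ξ))
    (g : X → ℝ) (hg : Measurable g)
    (hb : ∀ x, |g x| ≤ 1) (h0 : ∫ x, g x ∂μ = 0) (hgL : MemLp g 2 μ) (ε : ℝ) (hε : 0 < ε) :
    ∃ᶠ k in atTop, (‖hgL.toLp g‖ ^ 2) ^ 2 - ε <
      (inner ℝ (Lp.compMeasurePreserving ((⇑T)^[k]) (hT.iterate k) (hgL.toLp g)) (hgL.toLp g)) ^ 2 := by
  set G := hgL.toLp g with hG
  have hG1 : ‖G‖ ≤ 1 := by
    rw [hG, Lp.norm_toLp]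
    refine ENNReal.toReal_le_of_le_ofReal zero_le_one ?_
    refine (eLpNorm_le_of_ae_bound (C := 1) (ae_of_all _ hb)).trans ?_
    simp
  -- the coupling
  obtain ⟨hm1, hm2⟩ := rankone_marg μ g hg hb h0
  set ν := (μ.prod μ).withDensity (fun z => ENNReal.ofReal (1 + g z.1 * g z.2)) with hν
  have hνp : IsProbabilityMeasure ν := by
    constructor
    have := congrArg (fun m : Measure X => m Set.univ) hm1
    simpa [Measure.map_apply measurable_fst MeasurableSet.univ] using this
  obtain ⟨ζ, hζ⟩ : ∃ ζ : ProbabilityMeasure (X × X), (ζ : Measure (X × X)) = ν :=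
    ⟨⟨ν, hνp⟩, rfl⟩
  -- approximation
  obtain ⟨δ, hδ0, hδ1, hδ⟩ : ∃ δ : ℝ, 0 < δ ∧ δ ≤ 1 ∧ 6 * δ < ε / 2 :=
    ⟨min 1 (ε / 24), by positivity, min_le_left _ _, by
      have := min_le_right 1 (ε / 24); linarith⟩
  obtain ⟨f, hf, hfL⟩ := hgL.exists_boundedContinuous_eLpNorm_sub_le (by simp)
    (ε := ENNReal.ofReal δ) (by simpa using hδ0)
  set F := hfL.toLp _ with hF
  have hGF : ‖G - F‖ ≤ δ := by
    rw [hG, hF, ← MemLp.toLp_sub, Lp.norm_toLp]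
    exact ENNReal.toReal_le_of_le_ofReal hδ0.le hf
  let U : ℕ → Lp ℝ 2 μ →+ Lp ℝ 2 μ := fun k => Lp.compMeasurePreserving ((⇑T)^[k]) (hT.iterate k)
  have hUn : ∀ k (u : Lp ℝ 2 μ), ‖U k u‖ = ‖u‖ := fun k u => Lp.norm_compMeasurePreserving _ _
  have hinner : ∀ k, ∫ x, f ((⇑T)^[k] x) * g x ∂μ = inner ℝ (U k F) G := by
    intro k
    simp only [U]
    rw [hF, hG, Lp.toLp_compMeasurePreserving hfL, L2.inner_def]
    refine integral_congr_ae ?_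
    filter_upwards [MemLp.coeFn_toLp (hfL.comp_measurePreserving (hT.iterate k)),
      MemLp.coeFn_toLp hgL] with x hx hx'
    rw [hx, hx']
    simp [mul_comm]
  let Φ : BoundedContinuousFunction (X × X) ℝ := 
    BoundedContinuousFunction.mkOfCompact ⟨fun z => f z.1 * f z.2, by fun_prop⟩
  have hint : ∀ k, ∫ z, Φ z ∂(((lensP T)^[k] ζ : ProbabilityMeasure (X × X)) : Measure (X × X))
      = (∫ x, f x ∂μ) ^ 2 + (inner ℝ (U k F) G) ^ 2 := by
    intro k
    have hTk := T.measurable.iterate k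
    rw [lensP_iterate, hζ, integral_map (hTk.prodMap hTk).aemeasurable
      Φ.continuous.aestronglyMeasurable]
    have := rankone_integral μ g hg hb (fun x => f ((⇑T)^[k] x))
      (f.continuous.measurable.comp hTk) ‖f‖ (fun x => f.norm_coe_le_norm _)
    have e : ∫ x, f ((⇑T)^[k] x) ∂μ = ∫ x, f x ∂μ := by
      rw [← integral_map (φ := (⇑T)^[k]) (f := f) hTk.aemeasurable
        f.continuous.aestronglyMeasurable, (hT.iterate k).map_eq]
    rw [e, hinner] at this
    exact this
  have hcl := hrec ζ (by rw [hζ]; exact hm1) (by rw [hζ]; exact hm2)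
  have hcont : Continuous (fun ξ : ProbabilityMeasure (X × X) => ∫ z, Φ z ∂(ξ : Measure (X × X))) :=
    ProbabilityMeasure.continuous_integral_boundedContinuousFunction Φ
  have hev := (hcont.tendsto ζ).eventually (lt_mem_nhds (sub_lt_self _ (half_pos hε)))
  have hfr := hcl.frequently hev
  have hU0 : U 0 F = F := by
    simp only [U]
    rw [hF, Lp.toLp_compMeasurePreserving hfL]; rfl
  have h00 := hint 0
  rw [hU0] at h00
  simp only [Function.iterate_zero, id] at h00
  refine hfr.mono fun k hk => ?_
  rw [hint k, h00] at hk
  change _ < (inner ℝ (U k G) G) ^ 2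
  have hbnd : ∀ u v : Lp ℝ 2 μ, |inner ℝ u v| ≤ ‖u‖ * ‖v‖ := fun u v => abs_real_inner_le_norm u v
  have hG0 := norm_nonneg G
  have hd : ∀ u : Lp ℝ 2 μ, |inner ℝ u G| ≤ ‖u‖ := fun u =>
    (hbnd u G).trans (mul_le_of_le_one_right (norm_nonneg _) hG1)
  have d1 : |inner ℝ (U k G) G - inner ℝ (U k F) G| ≤ δ := by
    rw [← inner_sub_left, ← map_sub]
    exact (hd _).trans (by rw [hUn]; exact hGF)
  have d0 : |inner ℝ G G - inner ℝ F G| ≤ δ := by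
    rw [← inner_sub_left]
    exact (hd _).trans hGF
  have b1 : |inner ℝ (U k G) G| ≤ 1 := (hd _).trans (by rw [hUn]; exact hG1)
  have b0 : |inner ℝ G G| ≤ 1 := (hd _).trans hG1
  rw [← real_inner_self_eq_norm_sq]
  have sq_close : ∀ a b : ℝ, |a - b| ≤ δ → |a| ≤ 1 → |a ^ 2 - b ^ 2| ≤ 3 * δ := by
    intro a b h1 h2
    have e : a ^ 2 - b ^ 2 = (a - b) * (2 * a - (a - b)) := by ring
    rw [e, abs_mul, mul_comm]
    gcongr
    calc |2 * a - (a - b)| ≤ |2 * a| + |a - b| := abs_sub _ _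
      _ ≤ 3 := by rw [abs_mul, abs_two]; linarith
  have c1 := abs_le.1 (sq_close _ _ d1 b1)
  have c0 := abs_le.1 (sq_close _ _ d0 b0)
  linarith [c1.1, c0.2]

lemma return_frequently (μ : Measure X) [IsProbabilityMeasure μ]
    (T : X ≃ᵐ X) (hT : MeasurePreserving T μ μ) (g : X → ℝ) (hgL : MemLp g 2 μ)
    (h : ∀ ε : ℝ, 0 < ε → ∃ᶠ k in atTop, (‖hgL.toLp g‖ ^ 2) ^ 2 - ε <
      (inner ℝ (Lp.compMeasurePreserving ((⇑T)^[k]) (hT.iterate k) (hgL.toLp g)) (hgL.toLp g)) ^ 2)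
    (ρ : ℝ) (hρ : 0 < ρ) :
    ∃ᶠ k in atTop, ‖Lp.compMeasurePreserving ((⇑T)^[2 * k]) (hT.iterate (2 * k)) (hgL.toLp g)
      - hgL.toLp g‖ < ρ := by
  set G := hgL.toLp g with hG
  refine (h ((ρ ^ 2 / 8) ^ 2) (by positivity)).mono fun k hk => ?_
  let V : Lp ℝ 2 μ →+ Lp ℝ 2 μ := Lp.compMeasurePreserving ((⇑T)^[k]) (hT.iterate k)
  have hVn : ∀ (u : Lp ℝ 2 μ), ‖V u‖ = ‖u‖ := fun u => Lp.norm_compMeasurePreserving _ _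
  have h2 : Lp.compMeasurePreserving ((⇑T)^[2 * k]) (hT.iterate (2 * k)) G = V (V G) := by
    simp only [V]
    rw [hG, Lp.toLp_compMeasurePreserving hgL, Lp.toLp_compMeasurePreserving hgL,
      Lp.toLp_compMeasurePreserving (hgL.comp_measurePreserving (hT.iterate k))]
    congr 1
    rw [two_mul, Function.iterate_add]; rfl
  rw [h2]
  change _ < (inner ℝ (V G) G) ^ 2 at hk
  set b := inner ℝ (V G) G with hb
  have hbs : |b| ≤ ‖G‖ ^ 2 := by
    have := abs_real_inner_le_norm (V G) G
    rw [hVn] at this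
    rwa [sq]
  have hs : ‖G‖ ^ 2 - |b| < ρ ^ 2 / 8 := by
    by_contra hcon
    push Not at hcon
    have hb0 := abs_nonneg b
    have : (ρ ^ 2 / 8) ^ 2 ≤ (‖G‖ ^ 2 - |b|) ^ 2 := by gcongr
    rw [← sq_abs b] at hk
    nlinarith
  have em := norm_sub_sq_real (V G) G
  have ep := norm_add_sq_real (V G) G
  rw [hVn, ← hb] at em ep
  rcases le_total 0 b with h0 | h0
  · rw [abs_of_nonneg h0] at hs
    have h3 : ‖V G - G‖ < ρ / 2 := by
      refine lt_of_pow_lt_pow_left₀ 2 (by positivity) ?_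
      linarith [show (ρ / 2) ^ 2 = ρ ^ 2 / 4 by ring]
    have e : V (V G) - G = V (V G - G) + (V G - G) := by rw [map_sub]; abel
    rw [e]
    refine (norm_add_le _ _).trans_lt ?_
    rw [hVn]; linarith
  · rw [abs_of_nonpos h0] at hs
    have h3 : ‖V G + G‖ < ρ / 2 := by
      refine lt_of_pow_lt_pow_left₀ 2 (by positivity) ?_
      linarith [show (ρ / 2) ^ 2 = ρ ^ 2 / 4 by ring]
    have e : V (V G) - G = V (V G + G) - (V G + G) := by rw [map_add]; abel
    rw [e]
    refine (norm_sub_le _ _).trans_lt ?_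
    rw [hVn]; linarith

lemma rigid_of_recurrent (μ : Measure X) [IsProbabilityMeasure μ]
    (T : X ≃ᵐ X) (hT : MeasurePreserving T μ μ)
    (hrec : ∀ ξ : ProbabilityMeasure (X × X),
          (ξ : Measure (X × X)).map Prod.fst = μ →
          (ξ : Measure (X × X)).map Prod.snd = μ →
          MapClusterPt ξ atTop (fun k => (lensP T)^[k] ξ)) :
    ∃ n : ℕ → ℕ, StrictMono n ∧ ∀ f : Lp ℝ 2 μ,
          Tendsto (fun i =>
              ‖Lp.compMeasurePreserving ((⇑T)^[n i]) (hT.iterate (n i)) f - f‖)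
            atTop (nhds 0) := by
  let φ : X → ℝ := fun x => Real.arctan (embeddingReal X x) / 4
  have hφm : Measurable φ := by
    have := measurable_embeddingReal X
    fun_prop
  have hφb : ∀ x, |φ x| ≤ 1 / 2 := by
    intro x
    have h1 := Real.arctan_lt_pi_div_two (embeddingReal X x)
    have h2 := Real.neg_pi_div_two_lt_arctan (embeddingReal X x)
    have h3 := Real.pi_le_four
    rw [abs_le]
    constructor <;> simp only [φ] <;> linarith
  have hφi : Function.Injective φ := by
    intro x y hxy
    have : Real.arctan (embeddingReal X x) = Real.arctan (embeddingReal X y) := by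
      simp only [φ] at hxy; linarith
    exact (measurableEmbedding_embeddingReal X).injective (Real.arctan_injective this)
  have hφint : Integrable φ μ :=
    Integrable.of_bound hφm.aestronglyMeasurable (1 / 2) (ae_of_all _ hφb)
  set c := ∫ x, φ x ∂μ with hc
  have hcb : |c| ≤ 1 / 2 := by
    have := norm_integral_le_of_norm_le_const (μ := μ) (f := φ) (C := 1 / 2) (ae_of_all _ hφb)
    simpa using this
  let g : X → ℝ := fun x => φ x - c
  have hgm : Measurable g := hφm.sub_const c
  have hgi : Function.Injective g := fun x y hxy => hφi (by simpa [g] using hxy)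
  have hge : MeasurableEmbedding g := hgm.measurableEmbedding hgi
  have hgb : ∀ x, |g x| ≤ 1 := fun x => (abs_sub _ _).trans (by linarith [hφb x])
  have hg0 : ∫ x, g x ∂μ = 0 := by
    simp only [g]
    rw [integral_sub hφint (integrable_const _)]
    simp [hc]
  have hgL : MemLp g 2 μ := MemLp.of_bound hgm.aestronglyMeasurable 1 (ae_of_all _ hgb)
  have hret := return_frequently μ T hT g hgL
    (corr_frequently μ T hT hrec g hgm hgb hg0 hgL)
  obtain ⟨ψ, hψ, hψr⟩ := extraction_forall_of_frequently
    (fun i : ℕ => hret (1 / ((i : ℝ) + 1)) (by positivity))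
  have hlim : Tendsto (fun i => ‖Lp.compMeasurePreserving ((⇑T)^[2 * ψ i]) (hT.iterate (2 * ψ i))
      (hgL.toLp g) - hgL.toLp g‖) atTop (nhds 0) :=
    squeeze_zero (fun _ => norm_nonneg _) (fun i => (hψr i).le)
      tendsto_one_div_add_atTop_nhds_zero_nat
  have hmeas : TendstoInMeasure μ (fun i x => g ((⇑T)^[2 * ψ i] x)) atTop g := by
    refine tendstoInMeasure_of_tendsto_eLpNorm (p := 2) (by simp) ?_ hgL.1 ?_
    · intro i
      exact (hgL.comp_measurePreserving (hT.iterate _)).1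
    · have : ∀ i, eLpNorm ((fun x => g ((⇑T)^[2 * ψ i] x)) - g) 2 μ =
          ENNReal.ofReal ‖Lp.compMeasurePreserving ((⇑T)^[2 * ψ i]) (hT.iterate (2 * ψ i))
            (hgL.toLp g) - hgL.toLp g‖ := by
        intro i
        rw [Lp.toLp_compMeasurePreserving hgL, ← MemLp.toLp_sub, Lp.norm_toLp,
          ENNReal.ofReal_toReal]
        · rfl
        · exact ((hgL.comp_measurePreserving (hT.iterate (2 * ψ i))).sub hgL).2.ne
      simp_rw [this]
      simpa using (ENNReal.tendsto_ofReal hlim)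
  obtain ⟨ns, hns, hae⟩ := hmeas.exists_seq_tendsto_ae
  refine ⟨fun i => 2 * ψ (ns i), fun i j hij => ?_, ?_⟩
  · have := hψ (hns hij)
    simp only
    omega
  · exact tendsto_of_embedding μ g hge (fun i => (⇑T)^[2 * ψ (ns i)])
      (fun i => hT.iterate _) hae

end LensAux3
/-- For a measure-preserving automorphism `T` of a standard
probability space, the following are equivalent:
(i) `T` is rigid (`U_T^{n i} → Id` strongly on `L²(μ)` along some increasing sequence);
(ii) the lens `T̃` on `C₂(μ)` is pointwise recurrent;
(iii) `T̃` is rigid (`T̃^{n i} → Id` pointwise on `C₂(μ)` for some increasing sequence);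
(iv) `T̃` is uniformly rigid. -/
theorem lens_stmt12 {X : Type*} [MetricSpace X] [CompactSpace X]
    [SecondCountableTopology X] [MeasurableSpace X] [BorelSpace X]
    (μ : Measure X) [IsProbabilityMeasure μ]
    (T : X ≃ᵐ X) (hT : MeasurePreserving T μ μ) :
    List.TFAE
      [ -- (i) `T` is rigid
        (∃ n : ℕ → ℕ, StrictMono n ∧ ∀ f : Lp ℝ 2 μ,
          Tendsto (fun i =>
              ‖Lp.compMeasurePreserving ((⇑T)^[n i]) (hT.iterate (n i)) f - f‖)
            atTop (nhds 0)),
        -- (ii) the lens is pointwise recurrent on `C₂(μ)`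
        (∀ ξ : ProbabilityMeasure (X × X),
          (ξ : Measure (X × X)).map Prod.fst = μ →
          (ξ : Measure (X × X)).map Prod.snd = μ →
          MapClusterPt ξ atTop (fun k => (lensP T)^[k] ξ)),
        -- (iii) the lens is rigid on `C₂(μ)`
        (∃ n : ℕ → ℕ, StrictMono n ∧ ∀ ξ : ProbabilityMeasure (X × X),
          (ξ : Measure (X × X)).map Prod.fst = μ →
          (ξ : Measure (X × X)).map Prod.snd = μ →
          Tendsto (fun i => (lensP T)^[n i] ξ) atTop (nhds ξ)),
        -- (iv) the lens is uniformly rigid on `C₂(μ)`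
        (∃ n : ℕ → ℕ, StrictMono n ∧
          Tendsto (fun i =>
              ⨆ ξ : {ξ : ProbabilityMeasure (X × X) //
                  (ξ : Measure (X × X)).map Prod.fst = μ ∧
                  (ξ : Measure (X × X)).map Prod.snd = μ},
                levyProkhorovDist
                  (((lensP T)^[n i] ξ.1 : ProbabilityMeasure (X × X)) : Measure (X × X))
                  (ξ.1 : Measure (X × X)))
            atTop (nhds 0)) ] := by
  tfae_have 1 → 4 := by
    rintro ⟨n, hn, h⟩
    refine ⟨n, hn, ?_⟩
    rw [Metric.tendsto_atTop]
    intro ε hε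
    have h1 := rigid_dist μ T hT n h (ε / 2) (half_pos hε)
    have h2 := h1.eventually_le_const (u := ENNReal.ofReal (ε / 2 / 2))
      (ENNReal.ofReal_pos.2 (by positivity))
    obtain ⟨N, hN⟩ := eventually_atTop.1 h2
    refine ⟨N, fun i hi => ?_⟩
    rw [Real.dist_eq, sub_zero, abs_of_nonneg (by exact Real.iSup_nonneg fun _ => ENNReal.toReal_nonneg)]
    refine lt_of_le_of_lt (Real.iSup_le (fun ξ => ?_) (half_pos hε).le) (half_lt_self hε)
    exact lp_bound μ T (n i) (ε / 2) (half_pos hε) (hN i hi) ξ.1 ξ.2.1 ξ.2.2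
  tfae_have 4 → 3 := by
    rintro ⟨n, hn, h⟩
    refine ⟨n, hn, fun ξ h1 h2 => ?_⟩
    have key : Tendsto (fun i => LevyProkhorov.ofMeasure ((lensP T)^[n i] ξ)) atTop
        (nhds (LevyProkhorov.ofMeasure ξ)) := by
      rw [tendsto_iff_dist_tendsto_zero]
      refine squeeze_zero (fun _ => dist_nonneg) (fun i => ?_) h
      rw [LevyProkhorov.dist_probabilityMeasure_def]
      exact le_ciSup (f := fun ξ : {ξ : ProbabilityMeasure (X × X) //
                  (ξ : Measure (X × X)).map Prod.fst = μ ∧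
                  (ξ : Measure (X × X)).map Prod.snd = μ} =>
                levyProkhorovDist
                  (((lensP T)^[n i] ξ.1 : ProbabilityMeasure (X × X)) : Measure (X × X))
                  (ξ.1 : Measure (X × X)))
        ⟨1, by rintro _ ⟨η, rfl⟩; exact lpd_le_one _ _⟩ ⟨ξ, h1, h2⟩
    exact (LevyProkhorov.continuous_toMeasure_probabilityMeasure.tendsto _).comp key
  tfae_have 3 → 2 := by
    rintro ⟨n, hn, h⟩ ξ h1 h2
    exact MapClusterPt.of_comp hn.tendsto_atTop (h ξ h1 h2).mapClusterPt
  tfae_have 2 → 1 := rigid_of_recurrent μ T hT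
  tfae_finish
end

section
/- Let T be an ergodic automorphism of a standard probability space (X,B,μ) such that the lens T̃ on C₂(μ) is distal. Then T has discrete spectrum, i.e., L²(μ) is spanned by eigenfunctions of the Koopman operator U_T. -/
open MeasureTheory Filter

/-- The `k`-th power (for `k : ℤ`) of the topological lens of the automorphism `T`. -/
noncomputable def lensZ {X : Type*} [MeasurableSpace X] (T : X ≃ᵐ X) (k : ℤ) :
    ProbabilityMeasure (X × X) → ProbabilityMeasure (X × X) :=
  if 0 ≤ k then (lensP T)^[k.toNat] else (lensP T.symm)^[(-k).toNat]


set_option linter.unusedSectionVars false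

section LensHilbert
open Topology

variable {H : Type*} [NormedAddCommGroup H] [InnerProductSpace ℂ H] [CompleteSpace H]

lemma lens_norm_pow (U : H →L[ℂ] H) (hU : ∀ x, ‖U x‖ = ‖x‖) (n : ℕ) (x : H) :
    ‖(U ^ n) x‖ = ‖x‖ := by
  induction n with
  | zero => simp
  | succ n ih => rw [pow_succ', mul_apply_eq_comp, hU, ih]

/-- weak limits of powers along an ultrafilter -/
lemma lens_exists_lim (U : H →L[ℂ] H) (hU : ∀ x, ‖U x‖ = ‖x‖) (p : Ultrafilter ℕ) :
    ∃ P : H →L[ℂ] H, ∀ g k, Tendsto (fun n => inner ℂ ((U ^ n) g) k) (p : Filter ℕ)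
      (𝓝 (inner ℂ (P g) k)) := by
  have h1 : ∀ g k : H, ∃ z : ℂ, ‖z‖ ≤ ‖g‖ * ‖k‖ ∧
      Tendsto (fun n => inner ℂ ((U ^ n) g) k) (p : Filter ℕ) (𝓝 z) := by
    intro g k
    have hc := isCompact_closedBall (0 : ℂ) (‖g‖ * ‖k‖)
    have hm : Metric.closedBall (0 : ℂ) (‖g‖ * ‖k‖) ∈
        p.map (fun n => inner ℂ ((U ^ n) g) k) := by
      rw [Ultrafilter.mem_map]
      apply Filter.univ_mem'
      intro n
      simp only [Set.mem_preimage, mem_closedBall_zero_iff]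
      calc _ ≤ ‖(U ^ n) g‖ * ‖k‖ := norm_inner_le_norm _ _
        _ = _ := by rw [lens_norm_pow U hU]
    obtain ⟨z, hz, hz'⟩ := hc.ultrafilter_le_nhds' _ hm
    exact ⟨z, by simpa using hz, hz'⟩
  choose L hL hLt using h1
  let B0 : H →ₗ⋆[ℂ] H →ₗ[ℂ] ℂ := LinearMap.mk₂'ₛₗ (starRingEnd ℂ) (RingHom.id ℂ) L
    (fun a b c => tendsto_nhds_unique (hLt _ _)
      (((hLt a c).add (hLt b c)).congr fun n => by simp))
    (fun r a c => tendsto_nhds_unique (hLt _ _)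
      (((hLt a c).const_mul ((starRingEnd ℂ) r)).congr fun n => by simp [mul_comm]))
    (fun a b c => tendsto_nhds_unique (hLt _ _)
      (((hLt a b).add (hLt a c)).congr fun n => by simp))
    (fun r a c => tendsto_nhds_unique (hLt _ _)
      (((hLt a c).const_mul r).congr fun n => by simp))
  let B : H →L⋆[ℂ] H →L[ℂ] ℂ := B0.mkContinuous₂ 1 (fun g k => by
    simpa [B0] using hL g k)
  refine ⟨InnerProductSpace.continuousLinearMapOfBilin B, fun g k => ?_⟩
  rw [InnerProductSpace.continuousLinearMapOfBilin_apply]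
  exact hLt g k

attribute [local instance] Ultrafilter.add Ultrafilter.addSemigroup

lemma lens_idem (U : H →L[ℂ] H) (p : Ultrafilter ℕ)
    (hp : p + p = p) (P : H →L[ℂ] H)
    (hP : ∀ g k, Tendsto (fun n => inner ℂ ((U ^ n) g) k) (p : Filter ℕ)
      (𝓝 (inner ℂ (P g) k))) (g : H) : P (P g) = P g := by
  refine ext_inner_right ℂ fun k => ?_
  refine tendsto_nhds_unique (hP (P g) k) ?_
  rw [Metric.nhds_basis_closedBall.tendsto_right_iff]
  intro ε hε
  have h1 : ∀ᶠ s in ((p + p : Ultrafilter ℕ) : Filter ℕ),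
      inner ℂ ((U ^ s) g) k ∈ Metric.closedBall (inner ℂ (P g) k) ε := by
    rw [hp]
    exact (hP g k).eventually (Metric.closedBall_mem_nhds _ hε)
  rw [Ultrafilter.eventually_add] at h1
  filter_upwards [h1] with n hn
  have h2 := hP g ((ContinuousLinearMap.adjoint (U ^ n)) k)
  rw [ContinuousLinearMap.adjoint_inner_right] at h2
  refine Metric.isClosed_closedBall.mem_of_tendsto h2 ?_
  filter_upwards [hn] with m hm
  rw [ContinuousLinearMap.adjoint_inner_right]
  simpa [pow_add] using hm

/-- if `U` is weakly the identity along all idempotents then orbits are totally bounded -/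
lemma lens_tb (U : H →L[ℂ] H) (hU : ∀ x, ‖U x‖ = ‖x‖)
    (hI : ∀ p : Ultrafilter ℕ, p + p = p → ∀ g k,
      Tendsto (fun n => inner ℂ ((U ^ n) g) k) (p : Filter ℕ) (𝓝 (inner ℂ g k)))
    (f : H) : TotallyBounded (Set.range fun n => (U ^ n) f) := by
  rw [Metric.totallyBounded_iff]
  intro ε hε
  set S : Set ℕ := {n | ‖(U ^ n) f - f‖ < ε} with hS
  -- syndeticity
  have hsyn : ∃ M : ℕ, ∀ m, ∃ i ≤ M, m + i ∈ S := by
    by_contra hcon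
    push Not at hcon
    let K : ℕ → Set (Ultrafilter ℕ) := fun M => {p | ∀ i ≤ M, ∀ᶠ n in (p : Filter ℕ), n + i ∉ S}
    have hKc : ∀ M, IsClosed (K M) := by
      intro M
      have : K M = ⋂ i, ⋂ (_ : i ≤ M), {p : Ultrafilter ℕ | {n | n + i ∉ S} ∈ p} := by
        ext p; simp [K, Filter.Eventually]
      rw [this]
      exact isClosed_iInter fun i => isClosed_iInter fun _ => ultrafilter_isClosed_basic _
    have hne : (⋂ M, K M).Nonempty := by
      apply IsCompact.nonempty_iInter_of_sequence_nonempty_isCompact_isClosed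
      · intro n p hp i hi
        exact hp i (by omega)
      · intro n
        obtain ⟨m, hm⟩ := hcon n
        exact ⟨pure m, fun i hi => by simpa using hm i hi⟩
      · exact (hKc 0).isCompact
      · exact hKc
    obtain ⟨p, hpK, hp⟩ := exists_idempotent_in_compact_add_subsemigroup
      (fun r => Ultrafilter.continuous_add_left r) (⋂ M, K M) hne
      (isClosed_iInter hKc).isCompact (by
        intro q hq r hr
        simp only [Set.mem_iInter] at hq hr ⊢
        intro M i hi
        rw [Ultrafilter.eventually_add]
        filter_upwards with n
        filter_upwards [hr (n + i) (n + i) le_rfl] with m hm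
        convert! hm using 1
        ring_nf)
    have h0 : ∀ᶠ n in (p : Filter ℕ), n ∉ S := by
      simpa using (Set.mem_iInter.1 hpK 0) 0 le_rfl
    have h1 := hI p hp f f
    have h2 : Tendsto (fun n => ‖(U ^ n) f - f‖ ^ 2) (p : Filter ℕ) (𝓝 0) := by
      have h3 : Tendsto (fun n => 2 * ‖f‖ ^ 2 - 2 * (inner ℂ ((U ^ n) f) f).re) (p : Filter ℕ)
          (𝓝 (2 * ‖f‖ ^ 2 - 2 * (inner ℂ f f : ℂ).re)) :=
        (((Complex.continuous_re.tendsto _).comp h1).const_mul 2).const_sub _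
      have h4 : (inner ℂ f f : ℂ).re = ‖f‖ ^ 2 := by
        rw [inner_self_eq_norm_sq_to_K]; norm_cast
      rw [h4, sub_self] at h3
      refine h3.congr fun n => ?_
      rw [@norm_sub_sq ℂ, lens_norm_pow U hU]
      simp only [RCLike.re_to_complex]
      ring
    have h5 := h2.eventually (gt_mem_nhds (pow_pos hε 2))
    obtain ⟨n, hn, hn'⟩ := (h0.and h5).exists
    exact hn (lt_of_pow_lt_pow_left₀ 2 hε.le hn')
  obtain ⟨M, hM⟩ := hsyn
  refine ⟨(fun n => (U ^ n) f) '' Set.Iic M, (Set.finite_Iic M).image _, ?_⟩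
  rintro _ ⟨n, rfl⟩
  simp only [Set.mem_iUnion, Set.mem_image, exists_prop, exists_exists_and_eq_and, Set.mem_Iic,
    Metric.mem_ball]
  by_cases hn : n ≤ M
  · exact ⟨n, hn, by simpa using hε⟩
  · obtain ⟨i, hi, hs⟩ := hM (n - M)
    refine ⟨M - i, by omega, ?_⟩
    have : n = (M - i) + (n - M + i) := by omega
    rw [this, pow_add, dist_eq_norm]
    rw [mul_apply_eq_comp, ← map_sub, lens_norm_pow U hU]
    exact hs

lemma lens_eig (U : H →L[ℂ] H) (hU : ∀ x, ‖U x‖ = ‖x‖) (u : ℕ → H)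
    (hu : ∀ n, u (n + 1) = U (u n)) (htb : TotallyBounded (Set.range u)) (h0 : u 0 ≠ 0)
    (V : Submodule ℂ H) (hVc : IsClosed (V : Set H)) (hV : ∀ n, u n ∈ V) :
    ∃ v ∈ V, v ≠ 0 ∧ ∃ c : ℂ, U v = c • v := by
  set R := ‖u 0‖ with hR
  have hRpos : 0 < R := norm_pos_iff.2 h0
  have hun : ∀ n, ‖u n‖ = R := by
    intro n
    induction n with
    | zero => rfl
    | succ n ih => rw [hu, hU, ih]
  let A : ℕ → H → H := fun N g =>
    ((N + 1 : ℝ)⁻¹) • ∑ n ∈ Finset.range (N + 1), (inner ℂ (u n) g : ℂ) • u n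
  let D : ℝ → Set H := fun r =>
    (fun x : ℂ × H => x.1 • x.2) '' (Metric.closedBall (0 : ℂ) (R * r) ×ˢ closure (Set.range u))
  have hDc : ∀ r, IsCompact (D r) := by
    intro r
    refine IsCompact.image ?_ (by fun_prop)
    exact (isCompact_closedBall _ _).prod (htb.closure.isCompact_of_isClosed isClosed_closure)
  let K : ℝ → Set H := fun r => closure (convexHull ℝ (D r))
  have hKc : ∀ r, IsCompact (K r) := fun r =>
    (hDc r).totallyBounded.convexHull.closure.isCompact_of_isClosed isClosed_closure
  have hAK : ∀ r N g, ‖g‖ ≤ r → A N g ∈ K r := by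
    intro r N g hg
    apply subset_closure
    simp only [A]
    rw [Finset.smul_sum]
    refine (convex_convexHull ℝ (D r)).sum_mem (fun _ _ => by positivity) ?_ ?_
    · simp
      field_simp
    · intro n _
      apply subset_convexHull
      refine ⟨(inner ℂ (u n) g, u n), ⟨?_, subset_closure ⟨n, rfl⟩⟩, rfl⟩
      rw [mem_closedBall_zero_iff]
      calc _ ≤ ‖u n‖ * ‖g‖ := norm_inner_le_norm _ _
        _ ≤ R * r := by rw [hun]; gcongr
  let q : Ultrafilter ℕ := hyperfilter ℕ
  have hq : (q : Filter ℕ) ≤ atTop := by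
    rw [← Nat.cofinite_eq_atTop]; exact hyperfilter_le_cofinite
  have hlim : ∀ g, ∃ y, Tendsto (fun N => A N g) (q : Filter ℕ) (𝓝 y) := by
    intro g
    obtain ⟨y, -, hy⟩ := (hKc ‖g‖).ultrafilter_le_nhds' (q.map fun N => A N g) (by
      rw [Ultrafilter.mem_map]
      exact Filter.univ_mem' fun N => hAK _ _ _ le_rfl)
    exact ⟨y, hy⟩
  choose Q hQ using hlim
  have hAadd : ∀ N g k, A N (g + k) = A N g + A N k := by
    intro N g k
    simp only [A, ← smul_add, ← Finset.sum_add_distrib, inner_add_right, add_smul]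
  have hAsmul : ∀ N (c : ℂ) g, A N (c • g) = c • A N g := by
    intro N c g
    simp only [A, inner_smul_right, mul_smul]
    rw [smul_comm c, ← Finset.smul_sum]
  let Q0 : H →ₗ[ℂ] H :=
    { toFun := Q
      map_add' := fun g k => tendsto_nhds_unique (hQ _)
        (((hQ g).add (hQ k)).congr fun N => (hAadd N g k).symm)
      map_smul' := fun c g => tendsto_nhds_unique (hQ _)
        (((hQ g).const_smul c).congr fun N => (hAsmul N c g).symm) }
  have hcomp : IsCompactOperator Q0 := by
    rw [isCompactOperator_iff_exists_mem_nhds_image_subset_compact]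
    refine ⟨Metric.closedBall 0 1, Metric.closedBall_mem_nhds _ one_pos, K 1, hKc 1, ?_⟩
    rintro _ ⟨g, hg, rfl⟩
    exact isClosed_closure.mem_of_tendsto (hQ g)
      (Filter.Eventually.of_forall fun N => hAK _ _ _ (by simpa using hg))
  let Q1 : H →L[ℂ] H := ContinuousLinearMap.mkOfIsCompactOperator hcomp
  have hQ1 : ∀ g, Q1 g = Q g := fun g => rfl
  have hcomp1 : IsCompactOperator Q1 := hcomp
  have hinner : ∀ g k, Tendsto (fun N : ℕ => ((N + 1 : ℝ)⁻¹ : ℂ) *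
      ∑ n ∈ Finset.range (N + 1), (inner ℂ g (u n) : ℂ) * inner ℂ (u n) k) (q : Filter ℕ)
      (𝓝 (inner ℂ g (Q k))) := by
    intro g k
    refine ((tendsto_const_nhds (x := g)).inner (hQ k)).congr fun N => ?_
    simp only [A]
    rw [← Complex.coe_smul, inner_smul_right, inner_sum]
    simp only [inner_smul_right]
    push_cast
    congr 1
    exact Finset.sum_congr rfl fun n _ => mul_comm _ _
  have hsymm : (Q1 : H →ₗ[ℂ] H).IsSymmetric := by
    intro g k
    change inner ℂ (Q g) k = inner ℂ g (Q k)
    refine tendsto_nhds_unique ?_ (hinner g k)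
    rw [← inner_conj_symm]
    refine ((Complex.continuous_conj.tendsto _).comp (hinner k g)).congr fun N => ?_
    simp only [Function.comp, map_mul, map_sum, inner_conj_symm]
    congr 1
    · simp
    · exact Finset.sum_congr rfl fun n _ => mul_comm _ _
  have hQV : ∀ g, Q g ∈ V := by
    intro g
    refine hVc.mem_of_tendsto (hQ g) (Filter.Eventually.of_forall fun N => ?_)
    simp only [A]
    rw [← Complex.coe_smul]
    exact V.smul_mem _ (V.sum_mem fun n _ => V.smul_mem _ (hV n))
  have hUin : ∀ x y, (inner ℂ (U x) (U y) : ℂ) = inner ℂ x y := by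
    let U' : H →ₗᵢ[ℂ] H := ⟨U, hU⟩
    exact fun x y => U'.inner_map_map x y
  have hcomm : ∀ g, U (Q g) = Q (U g) := by
    intro g
    have h1 : Tendsto (fun N => U (A N g) - A N (U g)) (q : Filter ℕ)
        (𝓝 (U (Q g) - Q (U g))) :=
      ((U.continuous.tendsto _).comp (hQ g)).sub (hQ (U g))
    have h2 : Tendsto (fun N => U (A N g) - A N (U g)) (q : Filter ℕ) (𝓝 0) := by
      refine Tendsto.mono_left ?_ hq
      have h3 : Tendsto (fun N : ℕ => ((N : ℝ) + 1)⁻¹ * (2 * (R * ‖g‖ * R))) atTop (𝓝 0) := by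
        have := (tendsto_one_div_add_atTop_nhds_zero_nat (𝕜 := ℝ)).mul_const (2 * (R * ‖g‖ * R))
        simpa using this
      refine squeeze_zero_norm (fun N => ?_) h3
      have h4 : U (A N g) - A N (U g) = ((N + 1 : ℝ)⁻¹) •
          ((inner ℂ (u (N + 1)) (U g) : ℂ) • u (N + 1) - (inner ℂ (u 0) (U g) : ℂ) • u 0) := by
        simp only [A]
        rw [← Complex.coe_smul, map_smul, ← Complex.coe_smul, ← smul_sub, ← Complex.coe_smul,
          map_sum, ← Finset.sum_sub_distrib]
        congr 1
        rw [← Finset.sum_range_sub (fun n => (inner ℂ (u n) (U g) : ℂ) • u n)]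
        refine Finset.sum_congr rfl fun n _ => ?_
        rw [map_smul, hu, hUin]
      rw [h4, norm_smul, Real.norm_of_nonneg (by positivity)]
      gcongr
      have h5 : ∀ n, ‖(inner ℂ (u n) (U g) : ℂ) • u n‖ ≤ R * ‖g‖ * R := by
        intro n
        rw [norm_smul, hun]
        gcongr
        calc _ ≤ ‖u n‖ * ‖U g‖ := norm_inner_le_norm _ _
          _ = _ := by rw [hun, hU]
      calc _ ≤ _ := norm_sub_le _ _
        _ ≤ R * ‖g‖ * R + R * ‖g‖ * R := add_le_add (h5 _) (h5 _)
        _ = _ := by ring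
    exact sub_eq_zero.1 (tendsto_nhds_unique h1 h2)
  have hne : Q1 ≠ 0 := by
    intro hzero
    have hQ0 : ∀ g, Q g = 0 := fun g => by rw [← hQ1, hzero]; rfl
    rw [Metric.totallyBounded_iff] at htb
    obtain ⟨t, ht, hcov⟩ := htb (R / 2) (by positivity)
    have hlow : ∀ n, (R ^ 2 / 4) ^ 2 ≤ ∑ v ∈ ht.toFinset, ‖(inner ℂ v (u n) : ℂ)‖ ^ 2 := by
      intro n
      have := hcov ⟨n, rfl⟩
      simp only [Set.mem_iUnion, Metric.mem_ball, exists_prop] at this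
      obtain ⟨v, hv, hd⟩ := this
      have h1 : R ^ 2 / 4 ≤ ‖(inner ℂ v (u n) : ℂ)‖ := by
        have h2 : (inner ℂ (u n) (u n) : ℂ) = inner ℂ v (u n) + inner ℂ (u n - v) (u n) := by
          rw [← inner_add_left]; simp
        have h3 : ‖(inner ℂ (u n) (u n) : ℂ)‖ = R ^ 2 := by
          rw [inner_self_eq_norm_sq_to_K, hun]; simp
        have h4 : ‖(inner ℂ (u n - v) (u n) : ℂ)‖ ≤ R / 2 * R := by
          calc _ ≤ ‖u n - v‖ * ‖u n‖ := norm_inner_le_norm _ _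
            _ ≤ R / 2 * R := by
              rw [hun, ← dist_eq_norm]; gcongr
        have h5 := norm_add_le (inner ℂ v (u n) : ℂ) (inner ℂ (u n - v) (u n))
        rw [← h2, h3] at h5
        nlinarith
      calc _ ≤ ‖(inner ℂ v (u n) : ℂ)‖ ^ 2 := by gcongr
        _ ≤ _ := Finset.single_le_sum (f := fun v => ‖(inner ℂ v (u n) : ℂ)‖ ^ 2)
          (fun _ _ => by positivity) (ht.mem_toFinset.2 hv)
    have hsum : Tendsto (fun N : ℕ => ∑ v ∈ ht.toFinset, ((N + 1 : ℝ)⁻¹) *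
        ∑ n ∈ Finset.range (N + 1), ‖(inner ℂ v (u n) : ℂ)‖ ^ 2) (q : Filter ℕ) (𝓝 0) := by
      have : Tendsto (fun N : ℕ => ∑ v ∈ ht.toFinset, ((N + 1 : ℝ)⁻¹) *
        ∑ n ∈ Finset.range (N + 1), ‖(inner ℂ v (u n) : ℂ)‖ ^ 2) (q : Filter ℕ)
          (𝓝 (∑ v ∈ ht.toFinset, 0)) := by
        refine tendsto_finsetSum _ fun v _ => ?_
        have h1 := (Complex.continuous_re.tendsto _).comp (hinner v v)
        rw [hQ0, inner_zero_right, Complex.zero_re] at h1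
        refine h1.congr fun N => ?_
        have h2 : ∀ n, (inner ℂ v (u n) : ℂ) * inner ℂ (u n) v
            = ((‖(inner ℂ v (u n) : ℂ)‖ ^ 2 : ℝ) : ℂ) := by
          intro n
          rw [← inner_conj_symm (u n) v, Complex.mul_conj, Complex.normSq_eq_norm_sq]
        simp only [Function.comp, h2]
        rw [← Complex.ofReal_sum]
        norm_cast
      simpa using this
    have hge : (R ^ 2 / 4) ^ 2 ≤ 0 := by
      refine ge_of_tendsto hsum (Filter.Eventually.of_forall fun N => ?_)
      rw [← Finset.mul_sum, Finset.sum_comm]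
      calc (R ^ 2 / 4) ^ 2 = ((N + 1 : ℝ)⁻¹) * ∑ n ∈ Finset.range (N + 1), (R ^ 2 / 4) ^ 2 := by
            simp; field_simp
        _ ≤ _ := by
            gcongr with n hn
            exact hlow n
    have : 0 < (R ^ 2 / 4) ^ 2 := by positivity
    linarith
  -- eigenvalue of `Q1`
  have hex : ∃ l : ℂ, Module.End.HasEigenvalue (Q1 : Module.End ℂ H) l ∧ l ≠ 0 := by
    by_contra hcon
    push Not at hcon
    exact hne ((ContinuousLinearMap.eq_zero_of_forall_hasEigenvalue_eq_zero hcomp1 hsymm).1 hcon)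
  obtain ⟨l, hl, hl0⟩ := hex
  let E := Module.End.eigenspace (Q1 : Module.End ℂ H) l
  have hEfin : FiniteDimensional ℂ E :=
    ContinuousLinearMap.finite_dimensional_eigenspace hcomp1 l hl0
  have hEV : ∀ x ∈ E, x ∈ V := by
    intro x hx
    have h1 : Q x = l • x := Module.End.mem_eigenspace_iff.1 hx
    have h2 : x = l⁻¹ • Q x := by rw [h1, smul_smul, inv_mul_cancel₀ hl0, one_smul]
    rw [h2]
    exact V.smul_mem _ (hQV x)
  have hEU : ∀ x ∈ E, (U : H →ₗ[ℂ] H) x ∈ E := by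
    intro x hx
    have h1 : Q x = l • x := Module.End.mem_eigenspace_iff.1 hx
    refine Module.End.mem_eigenspace_iff.2 ?_
    change Q (U x) = l • U x
    rw [← hcomm, h1, map_smul]
  have hEnt : Nontrivial E := Submodule.nontrivial_iff_ne_bot.2 hl
  obtain ⟨c, hc⟩ := Module.End.exists_eigenvalue ((U : H →ₗ[ℂ] H).restrict hEU)
  obtain ⟨v, hv⟩ := hc.exists_hasEigenvector
  refine ⟨v, hEV _ v.2, ?_, c, ?_⟩
  · simpa using hv.2
  · have := congrArg Subtype.val hv.apply_eq_smul
    simpa using this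

lemma lens_main (U : H →L[ℂ] H) (hU : ∀ x, ‖U x‖ = ‖x‖)
    (hI : ∀ p : Ultrafilter ℕ, p + p = p → ∀ g k,
      Tendsto (fun n => inner ℂ ((U ^ n) g) k) (p : Filter ℕ) (𝓝 (inner ℂ g k))) :
    (Submodule.span ℂ {f : H | ∃ c : ℂ, U f = c • f}).topologicalClosure = ⊤ := by
  rw [Submodule.topologicalClosure_eq_top_iff, Submodule.eq_bot_iff]
  set W := Submodule.span ℂ {f : H | ∃ c : ℂ, U f = c • f} with hW
  intro f hf
  by_contra hf0
  have hUin : ∀ x y, (inner ℂ (U x) (U y) : ℂ) = inner ℂ x y := by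
    let U' : H →ₗᵢ[ℂ] H := ⟨U, hU⟩
    exact fun x y => U'.inner_map_map x y
  have hinv : ∀ x ∈ Wᗮ, U x ∈ Wᗮ := by
    intro x hx
    rw [Submodule.mem_orthogonal]
    intro y hy
    rw [hW] at hy
    induction hy using Submodule.span_induction with
    | zero => simp
    | add a b _ _ ha hb => rw [inner_add_left, ha, hb, add_zero]
    | smul c a _ ha => rw [inner_smul_left, ha, mul_zero]
    | mem y hy =>
      obtain ⟨c, hc⟩ := hy
      by_cases hy0 : y = 0
      · simp [hy0]
      have hc0 : c ≠ 0 := by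
        rintro rfl
        apply hy0
        rw [← norm_eq_zero, ← hU, hc]; simp
      have h1 : y = c⁻¹ • U y := by rw [hc, smul_smul, inv_mul_cancel₀ hc0, one_smul]
      rw [h1, inner_smul_left, hUin]
      rw [(Submodule.mem_orthogonal _ _).1 hx y (Submodule.subset_span ⟨c, hc⟩), mul_zero]
  have hmem : ∀ n, (U ^ n) f ∈ Wᗮ := by
    intro n
    induction n with
    | zero => simpa using hf
    | succ n ih => rw [pow_succ', mul_apply_eq_comp]; exact hinv _ ih
  obtain ⟨v, hvV, hv0, c, hc⟩ := lens_eig U hU (fun n => (U ^ n) f)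
    (fun n => by rw [pow_succ', mul_apply_eq_comp]) (lens_tb U hU hI f)
    (by simpa using hf0) Wᗮ (Submodule.isClosed_orthogonal _) hmem
  apply hv0
  have := (Submodule.mem_orthogonal _ _).1 hvV v (Submodule.subset_span ⟨c, hc⟩)
  exact inner_self_eq_zero.1 this

end LensHilbert

/-! Couplings with density `1 + h ⊗ h`. -/
section LensCoupling
open Topology

variable {X : Type*} [MeasurableSpace X]

/-- The measure with density `1 + h(x) h(y)`. -/
noncomputable def lensXi (μ : Measure X) (h : X → ℝ) : Measure (X × X) :=
  (μ.prod μ).withDensity (fun z => ENNReal.ofReal (1 + h z.1 * h z.2))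

lemma lensXi_dens_nonneg (h : X → ℝ) (hb : ∀ x, |h x| ≤ 1) (x y : X) :
    0 ≤ 1 + h x * h y := by
  have h1 : |h x * h y| ≤ 1 := by
    rw [abs_mul]; exact mul_le_one₀ (hb x) (abs_nonneg _) (hb y)
  linarith [(abs_le.1 h1).1]

lemma lens_integrable (μ : Measure X) [IsProbabilityMeasure μ] (a : X → ℝ) (ha : Measurable a)
    (C : ℝ) (hC : ∀ x, |a x| ≤ C) : Integrable a μ :=
  Integrable.of_bound ha.aestronglyMeasurable C (Eventually.of_forall hC)

lemma lensXi_lint (μ : Measure X) [IsProbabilityMeasure μ] (h : X → ℝ) (hm : Measurable h)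
    (hb : ∀ x, |h x| ≤ 1) (h0 : ∫ x, h x ∂μ = 0) (x : X) :
    ∫⁻ y, ENNReal.ofReal (1 + h x * h y) ∂μ = 1 := by
  have hi := lens_integrable μ h hm 1 hb
  have hi2 : Integrable (fun y => 1 + h x * h y) μ := (integrable_const _).add (hi.const_mul _)
  rw [← ofReal_integral_eq_lintegral_ofReal hi2
    (Eventually.of_forall fun y => lensXi_dens_nonneg h hb x y)]
  rw [integral_add (integrable_const _) (hi.const_mul _), integral_const_mul, h0]
  simp

lemma lensXi_fst (μ : Measure X) [IsProbabilityMeasure μ] (h : X → ℝ) (hm : Measurable h)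
    (hb : ∀ x, |h x| ≤ 1) (h0 : ∫ x, h x ∂μ = 0) : (lensXi μ h).map Prod.fst = μ := by
  ext s hs
  rw [Measure.map_apply measurable_fst hs, lensXi, withDensity_apply _ (measurable_fst hs)]
  have : (Prod.fst ⁻¹' s : Set (X × X)) = s ×ˢ Set.univ := by ext; simp
  rw [this, ← Measure.prod_restrict, lintegral_prod _ (by fun_prop)]
  simp [lensXi_lint μ h hm hb h0]

lemma lensXi_snd (μ : Measure X) [IsProbabilityMeasure μ] (h : X → ℝ) (hm : Measurable h)
    (hb : ∀ x, |h x| ≤ 1) (h0 : ∫ x, h x ∂μ = 0) : (lensXi μ h).map Prod.snd = μ := by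
  ext s hs
  rw [Measure.map_apply measurable_snd hs, lensXi, withDensity_apply _ (measurable_snd hs)]
  have : (Prod.snd ⁻¹' s : Set (X × X)) = Set.univ ×ˢ s := by ext; simp
  rw [this, ← Measure.prod_restrict, lintegral_prod_symm _ (by fun_prop)]
  have this' : ∀ y, ∫⁻ x, ENNReal.ofReal (1 + h x * h y) ∂μ = 1 := by
    intro y
    rw [← lensXi_lint μ h hm hb h0 y]
    exact lintegral_congr fun x => by rw [mul_comm]
  simp only [Measure.restrict_univ]
  simp [this']

lemma lensXi_prob (μ : Measure X) [IsProbabilityMeasure μ] (h : X → ℝ) (hm : Measurable h)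
    (hb : ∀ x, |h x| ≤ 1) (h0 : ∫ x, h x ∂μ = 0) : IsProbabilityMeasure (lensXi μ h) := by
  constructor
  have h1 := congrArg (fun ν => ν Set.univ) (lensXi_fst μ h hm hb h0)
  simpa [Measure.map_apply measurable_fst MeasurableSet.univ] using h1

lemma lensXi_integral (μ : Measure X) [IsProbabilityMeasure μ] (h : X → ℝ) (hm : Measurable h)
    (hb : ∀ x, |h x| ≤ 1) (a b : X → ℝ) (ha : Measurable a) (hbm : Measurable b) (C : ℝ)
    (hC : ∀ x, |a x| ≤ C) (hC' : ∀ x, |b x| ≤ C) :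
    ∫ z, a z.1 * b z.2 ∂(lensXi μ h) =
      (∫ x, a x ∂μ) * (∫ x, b x ∂μ) + (∫ x, a x * h x ∂μ) * (∫ x, b x * h x ∂μ) := by
  have hbd : ∀ c : X → ℝ, (∀ x, |c x| ≤ C) → ∀ x, |c x * h x| ≤ C := by
    intro c hc x
    rw [abs_mul]
    calc |c x| * |h x| ≤ |c x| * 1 := by gcongr; exact hb x
      _ ≤ C := by simpa using hc x
  rw [lensXi, integral_withDensity_eq_integral_toReal_smul (by fun_prop) (by simp)]
  have h1 : ∀ z : X × X, (ENNReal.ofReal (1 + h z.1 * h z.2)).toReal • (a z.1 * b z.2) =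
      a z.1 * b z.2 + (a z.1 * h z.1) * (b z.2 * h z.2) := by
    intro z
    rw [ENNReal.toReal_ofReal (lensXi_dens_nonneg h hb _ _), smul_eq_mul]
    ring
  simp only [h1]
  rw [integral_add, integral_prod_mul, integral_prod_mul (fun x => a x * h x) (fun x => b x * h x)]
  · exact (lens_integrable μ a ha C hC).mul_prod (lens_integrable μ b hbm C hC')
  · exact (lens_integrable μ _ (ha.mul hm) C (hbd a hC)).mul_prod
      (lens_integrable μ _ (hbm.mul hm) C (hbd b hC'))

lemma lensXi_map (μ : Measure X) [IsProbabilityMeasure μ] (T : X ≃ᵐ X)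
    (hT : MeasurePreserving T μ μ) (h : X → ℝ) (hm : Measurable h) :
    (lensXi μ h).map (T.symm.prodCongr T.symm) = lensXi μ (h ∘ T) := by
  have hTT : MeasurePreserving (Prod.map T T) (μ.prod μ) (μ.prod μ) := hT.prod hT
  ext s hs
  rw [MeasurableEquiv.map_apply, lensXi, lensXi,
    withDensity_apply _ ((T.symm.prodCongr T.symm).measurable hs), withDensity_apply _ hs,
    ← hTT.setLIntegral_comp_preimage ((T.symm.prodCongr T.symm).measurable hs) (by fun_prop)]
  congr 2
  ext z
  rcases z with ⟨a, b⟩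
  simp [MeasurableEquiv.prodCongr]

lemma lensXi_iter (μ : Measure X) [IsProbabilityMeasure μ] (T : X ≃ᵐ X)
    (hT : MeasurePreserving T μ μ) (h : X → ℝ) (hm : Measurable h)
    (ξ : ProbabilityMeasure (X × X)) (hξ : (ξ : Measure (X × X)) = lensXi μ h) (n : ℕ) :
    ((lensZ T (-(n : ℤ)) ξ : ProbabilityMeasure (X × X)) : Measure (X × X))
      = lensXi μ (h ∘ T^[n]) := by
  have key : ∀ n : ℕ, (((lensP T.symm)^[n] ξ : ProbabilityMeasure (X × X)) : Measure (X × X))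
      = lensXi μ (h ∘ T^[n]) := by
    intro n
    induction n with
    | zero => simpa using hξ
    | succ n ih =>
      rw [Function.iterate_succ_apply']
      simp only [lensP, ProbabilityMeasure.toMeasure_map]
      rw [ih, lensXi_map μ T hT _ (hm.comp (T.measurable.iterate n))]
      rw [Function.comp_assoc, Function.iterate_succ]
  by_cases hn : n = 0
  · subst hn
    simpa [lensZ] using hξ
  · have : ¬ (0 ≤ -(n : ℤ)) := by omega
    rw [lensZ, if_neg this]
    simpa using key n

end LensCoupling

section LensMeasure
open Topology

variable {X : Type*} [MetricSpace X] [CompactSpace X]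
    [SecondCountableTopology X] [MeasurableSpace X] [BorelSpace X]

lemma lens_zero (μ : Measure X) [IsProbabilityMeasure μ]
    (T : X ≃ᵐ X) (hT : MeasurePreserving T μ μ)
    (hdist : ∀ ξ₁ ξ₂ : ProbabilityMeasure (X × X),
      (ξ₁ : Measure (X × X)).map Prod.fst = μ → (ξ₁ : Measure (X × X)).map Prod.snd = μ →
      (ξ₂ : Measure (X × X)).map Prod.fst = μ → (ξ₂ : Measure (X × X)).map Prod.snd = μ →
      ξ₁ ≠ ξ₂ → ∃ ε > (0 : ℝ), ∀ k : ℤ,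
        ε ≤ levyProkhorovDist ((lensZ T k ξ₁ : ProbabilityMeasure (X × X)) : Measure (X × X))
          ((lensZ T k ξ₂ : ProbabilityMeasure (X × X)) : Measure (X × X)))
    (h : X → ℝ) (hm : Measurable h) (hb : ∀ x, |h x| ≤ 1) (p : Ultrafilter ℕ)
    (hp : ∀ f : BoundedContinuousFunction X ℝ,
      Tendsto (fun n => ∫ x, f x * h (T^[n] x) ∂μ) (p : Filter ℕ) (𝓝 0)) :
    h =ᵐ[μ] 0 := by
  have hTn : ∀ n, MeasurePreserving (T^[n]) μ μ := fun n => hT.iterate n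
  have hint : ∀ n, ∫ x, h (T^[n] x) ∂μ = ∫ x, h x ∂μ := by
    intro n
    have := integral_map (μ := μ) (hTn n).measurable.aemeasurable
      (f := h) hm.aestronglyMeasurable
    rw [(hTn n).map_eq] at this
    exact this.symm
  have h0 : ∫ x, h x ∂μ = 0 := by
    have h1 := hp (BoundedContinuousFunction.const X 1)
    simp only [BoundedContinuousFunction.const_apply, one_mul, hint] at h1
    exact tendsto_nhds_unique tendsto_const_nhds h1
  have hmn : ∀ n, Measurable (h ∘ T^[n]) := fun n => hm.comp (hTn n).measurable
  have hbn : ∀ n x, |(h ∘ T^[n]) x| ≤ 1 := fun n x => hb _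
  have h0n : ∀ n, ∫ x, (h ∘ T^[n]) x ∂μ = 0 := fun n => (hint n).trans h0
  let ξ : ℕ → ProbabilityMeasure (X × X) := fun n =>
    ⟨lensXi μ (h ∘ T^[n]), lensXi_prob μ _ (hmn n) (hbn n) (h0n n)⟩
  let ζ : ProbabilityMeasure (X × X) :=
    ⟨lensXi μ (0 : X → ℝ), lensXi_prob μ _ measurable_zero (by simp) (by simp)⟩
  by_contra hne
  have hint2 : Integrable (fun x => h x * h x) μ :=
    lens_integrable μ _ (hm.mul hm) 1 (fun x => by
      rw [abs_mul]; exact mul_le_one₀ (hb x) (abs_nonneg _) (hb x))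
  have hneq : ξ 0 ≠ ζ := by
    intro he
    apply hne
    have he' : lensXi μ h = lensXi μ (0 : X → ℝ) := congrArg Subtype.val he
    have h1 := lensXi_integral μ h hm hb h h hm hm 1 hb hb
    rw [he', lensXi_integral μ 0 measurable_zero (by simp) h h hm hm 1 hb hb, h0] at h1
    simp at h1
    rw [integral_eq_zero_iff_of_nonneg (fun x => mul_self_nonneg _) hint2] at h1
    filter_upwards [h1] with x hx
    simpa using hx
  obtain ⟨ε, hε, hk⟩ := hdist (ξ 0) ζ (lensXi_fst μ _ (hmn 0) (hbn 0) (h0n 0))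
    (lensXi_snd μ _ (hmn 0) (hbn 0) (h0n 0))
    (lensXi_fst μ _ measurable_zero (by simp) (by simp))
    (lensXi_snd μ _ measurable_zero (by simp) (by simp)) hneq
  have hk' : ∀ n, ε ≤ levyProkhorovDist (ξ n : Measure (X × X)) (ζ : Measure (X × X)) := by
    intro n
    have h1 := hk (-(n : ℤ))
    rw [lensXi_iter μ T hT h hm (ξ 0) rfl n, lensXi_iter μ T hT 0 measurable_zero ζ rfl n] at h1
    exact h1
  obtain ⟨η, -, hη⟩ := isCompact_univ.ultrafilter_le_nhds' (p.map ξ) univ_mem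
  have hηt : Tendsto ξ (p : Filter ℕ) (𝓝 η) := hη
  have hηζ : η = ζ := by
    apply Subtype.ext
    haveI : IsProbabilityMeasure η.1 := η.2
    haveI : IsProbabilityMeasure ζ.1 := ζ.2
    refine Measure.ext_of_integral_mul_boundedContinuousFunction fun f g => ?_
    let F : BoundedContinuousFunction (X × X) ℝ :=
      (f.compContinuous ⟨Prod.fst, continuous_fst⟩) * (g.compContinuous ⟨Prod.snd, continuous_snd⟩)
    have h1 := (ProbabilityMeasure.tendsto_iff_forall_integral_tendsto.1 hηt) F
    have hC : ∀ x, |f x| ≤ max ‖f‖ ‖g‖ := fun x => (f.norm_coe_le_norm x).trans (le_max_left _ _)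
    have hC' : ∀ x, |g x| ≤ max ‖f‖ ‖g‖ := fun x => (g.norm_coe_le_norm x).trans (le_max_right _ _)
    refine tendsto_nhds_unique h1 ?_
    change Tendsto (fun n => ∫ z, f z.1 * g z.2 ∂(lensXi μ (h ∘ T^[n]))) _
      (𝓝 (∫ z, f z.1 * g z.2 ∂(lensXi μ 0)))
    rw [lensXi_integral μ 0 measurable_zero (by simp) f g f.continuous.measurable
      g.continuous.measurable _ hC hC']
    have h2 := (tendsto_const_nhds (x := (∫ x, f x ∂μ) * (∫ x, g x ∂μ))).add ((hp f).mul (hp g))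
    simp only [Pi.zero_apply, mul_zero, integral_zero] at h2 ⊢
    refine h2.congr fun n => ?_
    rw [lensXi_integral μ _ (hmn n) (hbn n) f g f.continuous.measurable
      g.continuous.measurable _ hC hC']
    rfl
  rw [hηζ] at hηt
  have hLP := (LevyProkhorov.continuous_ofMeasure_probabilityMeasure.tendsto ζ).comp hηt
  rw [tendsto_iff_dist_tendsto_zero] at hLP
  have hbad : ε ≤ 0 := by
    refine ge_of_tendsto hLP (Eventually.of_forall fun n => ?_)
    exact hk' n
  linarith

lemma lens_re_le (μ : Measure X) [IsProbabilityMeasure μ]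
    (T : X ≃ᵐ X) (hT : MeasurePreserving T μ μ) (U : Lp ℂ 2 μ →L[ℂ] Lp ℂ 2 μ)
    (hUn : ∀ n d, ((U ^ n) d : X → ℂ) =ᵐ[μ] fun x => d (T^[n] x)) (p : Ultrafilter ℕ)
    (P : Lp ℂ 2 μ →L[ℂ] Lp ℂ 2 μ)
    (hP : ∀ g k, Tendsto (fun n => inner ℂ ((U ^ n) g) k) (p : Filter ℕ)
      (𝓝 (inner ℂ (P g) k))) (g : Lp ℂ 2 μ) (C : ℝ) (hC : ∀ᵐ x ∂μ, ‖g x‖ ≤ C) :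
    ∀ᵐ x ∂μ, (P g x).re ≤ C := by
  have hi : ∀ d : Lp ℂ 2 μ, Integrable d μ := fun d =>
    (Lp.memLp d).integrable (by norm_num)
  refine ae_le_of_forall_setIntegral_le (hi (P g)).re (integrable_const C) fun s hs hs' => ?_
  have h1 : ∀ d : Lp ℂ 2 μ,
      (inner ℂ d (indicatorConstLp 2 hs hs'.ne (1 : ℂ))).re = ∫ x in s, (d x).re ∂μ := by
    intro d
    rw [← inner_conj_symm, L2.inner_indicatorConstLp_one, Complex.conj_re]
    exact (integral_re (hi d).integrableOn).symm
  have h2 := (Complex.continuous_re.tendsto _).comp (hP g (indicatorConstLp 2 hs hs'.ne (1 : ℂ)))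
  rw [h1] at h2
  refine le_of_tendsto h2 (Eventually.of_forall fun n => ?_)
  simp only [Function.comp, h1]
  refine integral_mono_ae (hi _).re.integrableOn (integrable_const C) ?_
  refine ae_restrict_of_ae ?_
  filter_upwards [hUn n g, (hT.iterate n).quasiMeasurePreserving.ae hC] with x hx hx'
  rw [hx]
  exact (Complex.re_le_norm _).trans hx'

lemma lens_re_zero (μ : Measure X) [IsProbabilityMeasure μ]
    (T : X ≃ᵐ X) (hT : MeasurePreserving T μ μ)
    (hdist : ∀ ξ₁ ξ₂ : ProbabilityMeasure (X × X),
      (ξ₁ : Measure (X × X)).map Prod.fst = μ → (ξ₁ : Measure (X × X)).map Prod.snd = μ →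
      (ξ₂ : Measure (X × X)).map Prod.fst = μ → (ξ₂ : Measure (X × X)).map Prod.snd = μ →
      ξ₁ ≠ ξ₂ → ∃ ε > (0 : ℝ), ∀ k : ℤ,
        ε ≤ levyProkhorovDist ((lensZ T k ξ₁ : ProbabilityMeasure (X × X)) : Measure (X × X))
          ((lensZ T k ξ₂ : ProbabilityMeasure (X × X)) : Measure (X × X)))
    (U : Lp ℂ 2 μ →L[ℂ] Lp ℂ 2 μ)
    (hUn : ∀ n d, ((U ^ n) d : X → ℂ) =ᵐ[μ] fun x => d (T^[n] x)) (p : Ultrafilter ℕ)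
    (P : Lp ℂ 2 μ →L[ℂ] Lp ℂ 2 μ)
    (hP : ∀ g k, Tendsto (fun n => inner ℂ ((U ^ n) g) k) (p : Filter ℕ)
      (𝓝 (inner ℂ (P g) k))) (hPP : ∀ g, P (P g) = P g)
    (g : Lp ℂ 2 μ) (C : ℝ) (hC : ∀ᵐ x ∂μ, ‖g x‖ ≤ C) :
    ∀ᵐ x ∂μ, ((g - P g : Lp ℂ 2 μ) x).re = 0 := by
  set d : Lp ℂ 2 μ := g - P g with hd
  have hi : ∀ d : Lp ℂ 2 μ, Integrable d μ := fun d =>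
    (Lp.memLp d).integrable (by norm_num)
  have hC0 : 0 ≤ C := by
    obtain ⟨x, hx⟩ := hC.exists
    exact (norm_nonneg _).trans hx
  have hup := lens_re_le μ T hT U hUn p P hP g C hC
  have hlow := lens_re_le μ T hT U hUn p P hP (-g) C (by
    filter_upwards [hC, Lp.coeFn_neg g] with x hx hx'
    rw [hx']; simpa using hx)
  have hdb : ∀ᵐ x ∂μ, |(d x).re| ≤ 2 * C + 1 := by
    rw [map_neg] at hlow
    filter_upwards [hC, hup, hlow, Lp.coeFn_neg (P g), Lp.coeFn_sub g (P g)] with x h1 h2 h3 h4 h5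
    rw [h5]
    rw [h4] at h3
    simp only [Pi.neg_apply, Complex.neg_re, Pi.sub_apply, Complex.sub_re] at h3 ⊢
    have h6 := abs_le.1 ((Complex.abs_re_le_norm (g x)).trans h1)
    rw [abs_le]; constructor <;> linarith [h6.1, h6.2]
  set M := 2 * C + 1 with hM
  have hMpos : 0 < M := by linarith
  let h : X → ℝ := fun x => max (-1) (min 1 ((d x).re / M))
  have hm : Measurable h := by
    have : Measurable (d : X → ℂ) := (Lp.stronglyMeasurable d).measurable
    fun_prop
  have hb : ∀ x, |h x| ≤ 1 := by
    intro x
    rw [abs_le]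
    exact ⟨le_max_left _ _, max_le (by norm_num) (min_le_left _ _)⟩
  have hae : ∀ᵐ x ∂μ, h x = (d x).re / M := by
    filter_upwards [hdb] with x hx
    have h1 := abs_le.1 hx
    simp only [h]
    rw [min_eq_right, max_eq_right]
    · rw [le_div_iff₀ hMpos]; linarith
    · rw [div_le_one hMpos]; linarith
  have hz := lens_zero μ T hT hdist h hm hb p (by
    intro f
    let fc : Lp ℂ 2 μ := MemLp.toLp (fun x => (f x : ℂ)) (MemLp.of_bound (C := ‖f‖)
      (Complex.continuous_ofReal.comp f.continuous).aestronglyMeasurable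
      (Eventually.of_forall fun x => by simpa using f.norm_coe_le_norm x))
    have h1 := hP d fc
    have hPd : P d = 0 := by rw [hd, map_sub, hPP, sub_self]
    rw [hPd, inner_zero_left] at h1
    have h2 := ((Complex.continuous_re.tendsto _).comp h1).div_const M
    simp only [Complex.zero_re, zero_div] at h2
    refine h2.congr fun n => ?_
    simp only [Function.comp]
    rw [L2.inner_def]
    have h3 : (∫ x, inner ℂ (((U ^ n) d) x) (fc x) ∂μ).re
        = ∫ x, (inner ℂ (((U ^ n) d) x) (fc x) : ℂ).re ∂μ :=
      (integral_re (𝕜 := ℂ) (L2.integrable_inner (𝕜 := ℂ) ((U ^ n) d) fc)).symm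
    rw [h3, ← integral_div]
    refine integral_congr_ae ?_
    filter_upwards [hUn n d, (hT.iterate n).quasiMeasurePreserving.ae hae,
      MemLp.coeFn_toLp (f := fun x => (f x : ℂ)) (μ := μ) (p := 2) (MemLp.of_bound (C := ‖f‖)
      (Complex.continuous_ofReal.comp f.continuous).aestronglyMeasurable
      (Eventually.of_forall fun x => by simpa using f.norm_coe_le_norm x))] with x h4 h5 h6
    rw [h5, h4]
    change (inner ℂ (d (T^[n] x)) (MemLp.toLp _ _ x) : ℂ).re / M = _
    rw [h6]
    simp
    ring)
  filter_upwards [hz, hae] with x h1 h2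
  rw [h1] at h2
  have := h2.symm
  simp only [Pi.zero_apply, div_eq_zero_iff] at this
  exact this.resolve_right hMpos.ne'

end LensMeasure

/-- Let `T` be an ergodic automorphism of a standard probability
space such that the lens `T̃` on `C₂(μ)` is distal: any two distinct couplings stay at
distance bounded away from zero along the whole (two-sided) orbit.  Then `T` has
discrete spectrum: `L²(μ; ℂ)` is spanned by eigenfunctions of the Koopman operator. -/
theorem lens_stmt13 {X : Type*} [MetricSpace X] [CompactSpace X]
    [SecondCountableTopology X] [MeasurableSpace X] [BorelSpace X]
    (μ : Measure X) [IsProbabilityMeasure μ]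
    (T : X ≃ᵐ X) (hT : MeasurePreserving T μ μ) (herg : Ergodic T μ)
    (hdist : ∀ ξ₁ ξ₂ : ProbabilityMeasure (X × X),
      (ξ₁ : Measure (X × X)).map Prod.fst = μ → (ξ₁ : Measure (X × X)).map Prod.snd = μ →
      (ξ₂ : Measure (X × X)).map Prod.fst = μ → (ξ₂ : Measure (X × X)).map Prod.snd = μ →
      ξ₁ ≠ ξ₂ → ∃ ε > (0 : ℝ), ∀ k : ℤ,
        ε ≤ levyProkhorovDist ((lensZ T k ξ₁ : ProbabilityMeasure (X × X)) : Measure (X × X))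
          ((lensZ T k ξ₂ : ProbabilityMeasure (X × X)) : Measure (X × X))) :
    (Submodule.span ℂ
        {f : Lp ℂ 2 μ | ∃ c : ℂ,
          Lp.compMeasurePreserving (⇑T) hT f = c • f}).topologicalClosure = ⊤ := by
  classical
  letI := @Ultrafilter.add ℕ _
  let U : Lp ℂ 2 μ →L[ℂ] Lp ℂ 2 μ :=
    (Lp.compMeasurePreservingₗᵢ ℂ (⇑T) hT).toContinuousLinearMap
  have hU : ∀ x, ‖U x‖ = ‖x‖ := fun x => Lp.norm_compMeasurePreserving x hT
  have hUn : ∀ n (d : Lp ℂ 2 μ), ((U ^ n) d : X → ℂ) =ᵐ[μ] fun x => d (T^[n] x) := by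
    intro n
    induction n with
    | zero => intro d; simp
    | succ n ih =>
      intro d
      rw [pow_succ', mul_apply_eq_comp]
      have h1 : (U ((U ^ n) d) : X → ℂ) =ᵐ[μ] ((U ^ n) d) ∘ T :=
        Lp.coeFn_compMeasurePreserving _ hT
      filter_upwards [h1, hT.quasiMeasurePreserving.ae (ih d)] with x h2 h3
      rw [h2, Function.comp_apply, h3, Function.iterate_succ_apply]
  refine lens_main U hU fun p hp g k => ?_
  obtain ⟨P, hP⟩ := lens_exists_lim U hU p
  have hPP := lens_idem U p hp P hP
  have hbdd : ∀ (g : Lp ℂ 2 μ) (C : ℝ), (∀ᵐ x ∂μ, ‖g x‖ ≤ C) → P g = g := by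
    intro g C hC
    have h1 := lens_re_zero μ T hT hdist U hUn p P hP hPP g C hC
    have h2 := lens_re_zero μ T hT hdist U hUn p P hP hPP (Complex.I • g) C (by
      filter_upwards [hC, Lp.coeFn_smul Complex.I g] with x hx hx'
      rw [hx']; simpa using hx)
    rw [map_smul, ← smul_sub] at h2
    have h3 : g - P g = 0 := by
      rw [Lp.eq_zero_iff_ae_eq_zero]
      filter_upwards [h1, h2, Lp.coeFn_smul Complex.I (g - P g)] with x h4 h5 h6
      rw [h6] at h5
      refine Complex.ext h4 ?_
      simpa using h5
    exact (sub_eq_zero.1 h3).symm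
  have hPid : ∀ g, P g = g := by
    intro g
    have hd := ContinuousMap.toLp_denseRange (p := 2) ℂ μ ℂ (by norm_num)
    refine hd.induction_on (p := fun g => P g = g) g
      (isClosed_eq P.continuous continuous_id) fun f => ?_
    refine hbdd _ ‖f‖ ?_
    filter_upwards [ContinuousMap.coeFn_toLp (p := 2) (𝕜 := ℂ) μ f] with x hx
    rw [hx]
    exact f.norm_coe_le_norm x
  have := hP g k
  rwa [hPid] at this
end

section
/- Let T be an ergodic automorphism of a standard probability space (X,B,μ). If T is weakly mixing, then the lens T̃ on C₂(μ) is topologically weakly mixing (T̃ × T̃ is topologically transitive), and in particular T̃ is topologically transitive. -/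
open MeasureTheory Filter

/-- The set `C₂(μ)` of couplings of `μ` inside the space of probability measures on
`X × X` (with the weak* topology). -/
def couplingSet {X : Type*} [MeasurableSpace X] (μ : Measure X) :
    Set (ProbabilityMeasure (X × X)) :=
  {ξ | (ξ : Measure (X × X)).map Prod.fst = μ ∧ (ξ : Measure (X × X)).map Prod.snd = μ}

section Helpers
open scoped Topology ENNReal

theorem erg_corr {Y : Type*} [MeasurableSpace Y] (ν : Measure Y) [IsProbabilityMeasure ν]
    (S : Y → Y) (hS : Ergodic S ν) (A B : Set Y) (hA : MeasurableSet A) (hB : MeasurableSet B) :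
    Tendsto (fun N : ℕ => (N : ℝ)⁻¹ * ∑ n ∈ Finset.range N, ν.real (A ∩ S^[n] ⁻¹' B)) atTop
      (𝓝 (ν.real A * ν.real B)) := by
  have hp := hS.toMeasurePreserving
  let U := (Lp.compMeasurePreservingₗᵢ ℝ (E := ℝ) (p := 2) S hp)
  let f : Lp ℝ 2 ν →L[ℝ] Lp ℝ 2 ν := U.toContinuousLinearMap
  have hf : ‖f‖ ≤ 1 := U.norm_toContinuousLinearMap_le
  let a : Lp ℝ 2 ν := indicatorConstLp 2 hA (measure_ne_top ν A) 1
  let b : Lp ℝ 2 ν := indicatorConstLp 2 hB (measure_ne_top ν B) 1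
  let e : Lp ℝ 2 ν := indicatorConstLp 2 MeasurableSet.univ (measure_ne_top ν _) 1
  have hit : ∀ n, f^[n] b = indicatorConstLp 2 ((hp.iterate n).measurable hB)
      (measure_ne_top ν _) 1 := by
    intro n
    induction n with
    | zero => rfl
    | succ n ih =>
      rw [Function.iterate_succ_apply', ih]
      change Lp.compMeasurePreserving S hp _ = _
      rw [Lp.indicatorConstLp_compMeasurePreserving]
      rfl
  have hin : ∀ (C D : Set Y) (hC : MeasurableSet C) (hD : MeasurableSet D),
      inner ℝ (indicatorConstLp 2 hC (measure_ne_top ν C) (1:ℝ) : Lp ℝ 2 ν)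
        (indicatorConstLp 2 hD (measure_ne_top ν D) (1:ℝ)) = ν.real (C ∩ D) := by
    intro C D hC hD
    rw [L2.inner_indicatorConstLp_one, setIntegral_indicatorConstLp hC]
    simp [Set.inter_comm]
  have key := f.tendsto_birkhoffAverage_orthogonalProjection hf b
  set P := (f.eqLocus (1 : Lp ℝ 2 ν →L[ℝ] Lp ℝ 2 ν)) with hP
  have heP : e ∈ P := by
    change f e = e
    change Lp.compMeasurePreserving S hp _ = _
    rw [Lp.indicatorConstLp_compMeasurePreserving]
    rfl
  obtain ⟨c, hc⟩ : ∃ c : ℝ, (P.orthogonalProjectionOnto b : Lp ℝ 2 ν) = c • e := by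
    have h1 : f (P.orthogonalProjectionOnto b : Lp ℝ 2 ν) = (P.orthogonalProjectionOnto b) :=
      (P.orthogonalProjectionOnto b).2
    have h2 := congrArg (Subtype.val) h1
    obtain ⟨c, hc⟩ := hS.eq_const_of_compMeasurePreserving_eq h2
    refine ⟨c, ?_⟩
    apply Lp.ext
    have h3 : e =ᵐ[ν] fun _ => (1:ℝ) := by
      have h := (indicatorConstLp_coeFn (p := 2) (μ := ν) (hs := MeasurableSet.univ)
        (hμs := measure_ne_top ν _) (c := (1:ℝ)))
      rw [Set.indicator_univ] at h
      exact h
    have h4 := AEEqFun.coeFn_const (μ := ν) Y c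
    rw [← hc] at h4
    filter_upwards [h3, h4, Lp.coeFn_smul c e] with x h3 h4 h5
    rw [h5, Pi.smul_apply, h3]
    simpa using h4
  have hcB : c = ν.real B := by
    have h1 : inner ℝ e (P.orthogonalProjectionOnto b : Lp ℝ 2 ν) = inner ℝ e b := by
      have := P.inner_orthogonalProjectionOnto_eq_of_mem_left ⟨e, heP⟩ b
      exact this
    rw [hc, inner_smul_right, hin, hin] at h1
    simpa using h1
  have h := (Filter.Tendsto.inner (𝕜 := ℝ) (tendsto_const_nhds (x := a)) key)
  rw [hc, inner_smul_right, hin, hcB, Set.inter_univ, mul_comm] at h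
  refine h.congr fun N => ?_
  simp only [birkhoffAverage, birkhoffSum, inner_smul_right, inner_sum, id, hit]
  congr 1
  refine Finset.sum_congr rfl fun n _ => ?_
  exact hin _ _ _ _

theorem wm_corr {X : Type*} [MeasurableSpace X] (μ : Measure X) [IsProbabilityMeasure μ]
    (T : X → X) (herg : Ergodic T μ) (hwm : Ergodic (Prod.map T T) (μ.prod μ))
    (A B : Set X) (hA : MeasurableSet A) (hB : MeasurableSet B) :
    Tendsto (fun N : ℕ => (N : ℝ)⁻¹ * ∑ n ∈ Finset.range N,
      (μ.real (A ∩ T^[n] ⁻¹' B) - μ.real A * μ.real B) ^ 2) atTop (𝓝 0) := by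
  have h1 := erg_corr μ T herg A B hA hB
  have h2 := erg_corr (μ.prod μ) _ hwm (A ×ˢ A) (B ×ˢ B) (hA.prod hA) (hB.prod hB)
  have h3 : ∀ n, (μ.prod μ).real ((A ×ˢ A) ∩ (Prod.map T T)^[n] ⁻¹' (B ×ˢ B)) =
      μ.real (A ∩ T^[n] ⁻¹' B) ^ 2 := by
    intro n
    have : ((A ×ˢ A) ∩ (Prod.map T T)^[n] ⁻¹' (B ×ˢ B)) =
      (A ∩ T^[n] ⁻¹' B) ×ˢ (A ∩ T^[n] ⁻¹' B) := by
      rw [Prod.map_iterate]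
      ext ⟨x, y⟩
      simp
      tauto
    rw [this, measureReal_prod_prod, sq]
  simp only [h3, measureReal_prod_prod] at h2
  set c := μ.real A * μ.real B with hc
  have h4 : Tendsto (fun N : ℕ => (N : ℝ)⁻¹ * ∑ n ∈ Finset.range N, c ^ 2) atTop (𝓝 (c ^ 2)) := by
    apply tendsto_const_nhds.congr'
    filter_upwards [eventually_gt_atTop 0] with N hN
    have : (N : ℝ) ≠ 0 := by positivity
    simp
    field_simp
  have h5 := (h2.sub (h1.const_mul (2 * c))).add h4
  convert h5 using 1
  · ext N
    rw [← mul_assoc, mul_comm (2 * c), mul_assoc, ← mul_sub, ← mul_add, Finset.mul_sum _ _ (2 * c),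
      ← Finset.sum_sub_distrib, ← Finset.sum_add_distrib]
    congr 1
    exact Finset.sum_congr rfl fun n _ => by ring
  · congr 1
    rw [hc]; ring

theorem wm_cells {X : Type*} [MeasurableSpace X] (μ : Measure X) [IsProbabilityMeasure μ]
    (T : X → X) (herg : Ergodic T μ) (hwm : Ergodic (Prod.map T T) (μ.prod μ))
    {ι : Type*} [Fintype ι] (A : ι → Set X) (hA : ∀ i, MeasurableSet (A i))
    (θ : ℝ) (hθ0 : 0 ≤ θ) (hθ : θ < 1) :
    ∃ n : ℕ, ∀ i j, ENNReal.ofReal θ * (μ (A i) * μ (A j)) ≤ μ (A i ∩ T^[n] ⁻¹' A j) := by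
  classical
  let s : ℕ → ℝ := fun n => ∑ k : ι × ι,
    (μ.real (A k.1 ∩ T^[n] ⁻¹' A k.2) - μ.real (A k.1) * μ.real (A k.2)) ^ 2
  have hs : Tendsto (fun N : ℕ => (N : ℝ)⁻¹ * ∑ n ∈ Finset.range N, s n) atTop (𝓝 0) := by
    have := tendsto_finsetSum (Finset.univ : Finset (ι × ι)) fun k _ =>
      wm_corr μ T herg hwm (A k.1) (A k.2) (hA _) (hA _)
    simp only [Finset.sum_const_zero, ← Finset.mul_sum] at this
    refine this.congr fun N => ?_
    rw [Finset.sum_comm]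
  have hex : ∀ k : ℕ, ∃ n, s n < 1 / ((k : ℝ) + 1) := by
    intro k
    by_contra! hcon
    have hpos : (0:ℝ) < 1 / ((k : ℝ) + 1) := by positivity
    have := ((hs.eventually (gt_mem_nhds hpos)).and (eventually_gt_atTop 0)).exists
    obtain ⟨N, hN, hN0⟩ := this
    have h1 : (N : ℝ) * (1 / ((k : ℝ) + 1)) ≤ ∑ n ∈ Finset.range N, s n := by
      have := Finset.card_nsmul_le_sum (Finset.range N) s _ fun n _ => hcon n
      simpa using this
    have hN' : (0:ℝ) < N := by exact_mod_cast hN0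
    rw [inv_mul_lt_iff₀ hN'] at hN
    linarith
  choose n hn using hex
  have hlim : ∀ k : ι × ι, Tendsto (fun m => μ.real (A k.1 ∩ T^[n m] ⁻¹' A k.2)) atTop
      (𝓝 (μ.real (A k.1) * μ.real (A k.2))) := by
    intro k
    have h1 : Tendsto (fun m => (μ.real (A k.1 ∩ T^[n m] ⁻¹' A k.2) -
        μ.real (A k.1) * μ.real (A k.2)) ^ 2) atTop (𝓝 0) := by
      refine squeeze_zero (fun _ => sq_nonneg _) (fun m => ?_) tendsto_one_div_add_atTop_nhds_zero_nat
      refine le_trans ?_ (hn m).le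
      exact Finset.single_le_sum (f := fun k : ι × ι => (μ.real (A k.1 ∩ T^[n m] ⁻¹' A k.2) -
        μ.real (A k.1) * μ.real (A k.2)) ^ 2) (fun _ _ => sq_nonneg _) (Finset.mem_univ k)
    have h2 := h1.sqrt
    simp only [Real.sqrt_sq_eq_abs, Real.sqrt_zero] at h2
    rw [tendsto_iff_dist_tendsto_zero]
    simpa [Real.dist_eq] using h2
  have hev : ∀ k : ι × ι, ∀ᶠ m in atTop, θ * (μ.real (A k.1) * μ.real (A k.2)) ≤
      μ.real (A k.1 ∩ T^[n m] ⁻¹' A k.2) := by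
    intro k
    have h0 : 0 ≤ μ.real (A k.1) * μ.real (A k.2) := by positivity
    rcases h0.eq_or_lt with h | h
    · rw [← h]; simp
    · exact (hlim k).eventually (le_mem_nhds (by nlinarith))
  obtain ⟨m, hm⟩ := (eventually_all.2 hev).exists
  refine ⟨n m, fun i j => ?_⟩
  have := ENNReal.ofReal_le_ofReal (hm (i, j))
  rw [ENNReal.ofReal_mul hθ0, ENNReal.ofReal_mul (by positivity)] at this
  simpa using this

theorem coupling_extend {X : Type*} [MeasurableSpace X] (μ : Measure X) [IsProbabilityMeasure μ]
    (α : Measure (X × X)) (h1 : α.map Prod.fst ≤ μ) (h2 : α.map Prod.snd ≤ μ) :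
    ∃ ζ : Measure (X × X), α ≤ ζ ∧ ζ.map Prod.fst = μ ∧ ζ.map Prod.snd = μ := by
  have f1 : IsFiniteMeasure (α.map Prod.fst) := isFiniteMeasure_of_le μ h1
  have f2 : IsFiniteMeasure (α.map Prod.snd) := isFiniteMeasure_of_le μ h2
  set r1 := μ - α.map Prod.fst with hr1
  set r2 := μ - α.map Prod.snd with hr2
  have e1 : r1 + α.map Prod.fst = μ := Measure.sub_add_cancel_of_le h1
  have e2 : r2 + α.map Prod.snd = μ := Measure.sub_add_cancel_of_le h2
  have g1 : r1 Set.univ + α Set.univ = 1 := by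
    have := congrArg (fun m : Measure X => m Set.univ) e1
    simpa [Measure.map_apply measurable_fst] using this
  have g2 : r2 Set.univ + α Set.univ = 1 := by
    have := congrArg (fun m : Measure X => m Set.univ) e2
    simpa [Measure.map_apply measurable_snd] using this
  have hα : α Set.univ ≠ ∞ := by
    intro h; rw [h] at g1; simp at g1
  have hm : r2 Set.univ = r1 Set.univ := by
    apply (ENNReal.add_left_inj hα).1; rw [g1, g2]
  have fr1 : IsFiniteMeasure r1 := isFiniteMeasure_of_le μ (e1 ▸ Measure.le_add_right le_rfl)
  have fr2 : IsFiniteMeasure r2 := isFiniteMeasure_of_le μ (e2 ▸ Measure.le_add_right le_rfl)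
  set m := r1 Set.univ with hmm
  have hmt : m ≠ ∞ := measure_ne_top _ _
  refine ⟨α + m⁻¹ • r1.prod r2, Measure.le_add_right le_rfl, ?_, ?_⟩
  · rw [Measure.map_add _ _ measurable_fst, Measure.map_smul]
    have : (r1.prod r2).map Prod.fst = r2 Set.univ • r1 := Measure.map_fst_prod
    rw [this, hm, smul_smul]
    rcases eq_or_ne m 0 with h | h
    · have : r1 = 0 := Measure.measure_univ_eq_zero.1 h
      rw [← e1]; simp [this]
    · rw [ENNReal.inv_mul_cancel h hmt, one_smul, add_comm, e1]
  · rw [Measure.map_add _ _ measurable_snd, Measure.map_smul]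
    have : (r1.prod r2).map Prod.snd = r1 Set.univ • r2 := Measure.map_snd_prod
    rw [this, smul_smul]
    rcases eq_or_ne m 0 with h | h
    · have : r2 = 0 := Measure.measure_univ_eq_zero.1 (hm.trans h)
      rw [← e2]; simp [this]
    · rw [ENNReal.inv_mul_cancel h hmt, one_smul, add_comm, e2]

theorem coupling_matrix {X : Type*} [MeasurableSpace X] (μ : Measure X) [IsProbabilityMeasure μ]
    {κ : Type*} [Fintype κ] [MeasurableSpace κ] [MeasurableSingletonClass κ]
    (r : X → κ) (hr : Measurable r) (w : κ → κ → ℝ≥0∞)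
    (hw1 : ∀ k, ∑ l, w k l ≤ μ (r ⁻¹' {k})) (hw2 : ∀ l, ∑ k, w k l ≤ μ (r ⁻¹' {l})) :
    ∃ ζ : Measure (X × X), ζ.map Prod.fst = μ ∧ ζ.map Prod.snd = μ ∧
      ∀ k l, w k l ≤ ζ ((r ⁻¹' {k}) ×ˢ (r ⁻¹' {l})) := by
  classical
  have hC : ∀ k, MeasurableSet (r ⁻¹' {k}) := fun k => hr (measurableSet_singleton k)
  let c : κ → Measure X := fun k => (μ (r ⁻¹' {k}))⁻¹ • μ.restrict (r ⁻¹' {k})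
  have hcs : ∀ k, SFinite (c k) := fun k => by dsimp only [c]; infer_instance
  have hc1 : ∀ k, c k Set.univ ≤ 1 := by
    intro k
    simp only [c, Measure.smul_apply, smul_eq_mul, Measure.restrict_apply MeasurableSet.univ,
      Set.univ_inter]
    exact ENNReal.inv_mul_le_one _
  have hcM : ∀ k E, MeasurableSet E → μ (r ⁻¹' {k}) * c k E ≤ μ (E ∩ r ⁻¹' {k}) := by
    intro k E hE
    simp only [c, Measure.smul_apply, smul_eq_mul, Measure.restrict_apply hE]
    rw [← mul_assoc]
    exact mul_le_of_le_one_left (by simp) (ENNReal.mul_inv_le_one _)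
  have hsum : ∀ E, MeasurableSet E → ∑ k, μ (E ∩ r ⁻¹' {k}) = μ E := by
    intro E hE
    have := sum_measure_preimage_singleton (μ := μ.restrict E) (f := r) Finset.univ
      (fun k _ => hC k)
    simpa [Measure.restrict_apply (hC _), Set.inter_comm] using this
  let α : Measure (X × X) := ∑ k, ∑ l, w k l • (c k).prod (c l)
  have hα : ∀ E F, MeasurableSet E → MeasurableSet F →
      α (E ×ˢ F) = ∑ k, ∑ l, w k l * (c k E * c l F) := by
    intro E F hE hF
    simp [α, Measure.finsetSum_apply, Measure.prod_prod]
  have m1 : α.map Prod.fst ≤ μ := by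
    refine Measure.le_iff.2 fun E hE => ?_
    rw [Measure.map_apply measurable_fst hE, ← Set.prod_univ, hα _ _ hE MeasurableSet.univ,
      ← hsum E hE]
    refine Finset.sum_le_sum fun k _ => ?_
    calc ∑ l, w k l * (c k E * c l Set.univ) ≤ ∑ l, w k l * c k E :=
          Finset.sum_le_sum fun l _ => by
            gcongr; exact mul_le_of_le_one_right (by simp) (hc1 l)
      _ = (∑ l, w k l) * c k E := by rw [Finset.sum_mul]
      _ ≤ _ := (mul_le_mul_left (hw1 k) _).trans (hcM k E hE)
  have m2 : α.map Prod.snd ≤ μ := by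
    refine Measure.le_iff.2 fun E hE => ?_
    rw [Measure.map_apply measurable_snd hE, ← Set.univ_prod, hα _ _ MeasurableSet.univ hE,
      ← hsum E hE, Finset.sum_comm]
    refine Finset.sum_le_sum fun k _ => ?_
    calc ∑ l, w l k * (c l Set.univ * c k E) ≤ ∑ l, w l k * c k E :=
          Finset.sum_le_sum fun l _ => by
            gcongr; exact mul_le_of_le_one_left (by simp) (hc1 l)
      _ = (∑ l, w l k) * c k E := by rw [Finset.sum_mul]
      _ ≤ _ := (mul_le_mul_left (hw2 k) _).trans (hcM k E hE)
  obtain ⟨ζ, hle, z1, z2⟩ := coupling_extend μ α m1 m2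
  refine ⟨ζ, z1, z2, fun k l => ?_⟩
  refine le_trans ?_ (hle _)
  rw [hα _ _ (hC k) (hC l)]
  have hk : w k l ≤ μ (r ⁻¹' {k}) :=
    (Finset.single_le_sum (f := fun l => w k l) (fun _ _ => by simp) (Finset.mem_univ l)).trans (hw1 k)
  have hl : w k l ≤ μ (r ⁻¹' {l}) :=
    (Finset.single_le_sum (f := fun k => w k l) (fun _ _ => by simp) (Finset.mem_univ k)).trans (hw2 l)
  have hone : ∀ k, μ (r ⁻¹' {k}) ≠ 0 → c k (r ⁻¹' {k}) = 1 := by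
    intro k h
    simp only [c, Measure.smul_apply, smul_eq_mul, Measure.restrict_apply (hC k), Set.inter_self]
    exact ENNReal.inv_mul_cancel h (measure_ne_top _ _)
  have hterm : w k l ≤ w k l * (c k (r ⁻¹' {k}) * c l (r ⁻¹' {l})) := by
    rcases eq_or_ne (w k l) 0 with h | h
    · simp [h]
    · rw [hone k, hone l]
      · simp
      · intro h0; rw [h0] at hl; exact h (by simpa using hl)
      · intro h0; rw [h0] at hk; exact h (by simpa using hk)
  refine hterm.trans ?_
  refine le_trans ?_ (Finset.single_le_sum (f := fun k' => ∑ l', w k' l' * (c k' (r ⁻¹' {k}) * c l' (r ⁻¹' {l}))) (fun _ _ => by simp) (Finset.mem_univ k))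
  exact (Finset.single_le_sum (f := fun l' => w k l' * (c k (r ⁻¹' {k}) * c l' (r ⁻¹' {l}))) (fun _ _ => by simp) (Finset.mem_univ l))

theorem coupling_two {X : Type*} [MeasurableSpace X] (μ : Measure X) [IsProbabilityMeasure μ]
    {ι : Type*} [Fintype ι] [MeasurableSpace ι] [MeasurableSingletonClass ι]
    (p q : X → ι) (hp : Measurable p) (hq : Measurable q) (ξ η : Measure (X × X))
    (hξ1 : ξ.map Prod.fst = μ) (hξ2 : ξ.map Prod.snd = μ)
    (hη1 : η.map Prod.fst = μ) (hη2 : η.map Prod.snd = μ) (θ : ℝ≥0∞)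
    (h : ∀ i j, θ * (μ (p ⁻¹' {i}) * μ (p ⁻¹' {j})) ≤ μ (p ⁻¹' {i} ∩ q ⁻¹' {j})) :
    ∃ ζ : Measure (X × X), ζ.map Prod.fst = μ ∧ ζ.map Prod.snd = μ ∧
      (∀ J : Set (ι × ι), θ * ξ (Prod.map p p ⁻¹' J) ≤ ζ (Prod.map p p ⁻¹' J)) ∧
      (∀ J : Set (ι × ι), θ * η (Prod.map p p ⁻¹' J) ≤ ζ (Prod.map q q ⁻¹' J)) := by
  classical
  have hpre : ∀ (p : X → ι) i j, Prod.map p p ⁻¹' {(i, j)} = (p ⁻¹' {i}) ×ˢ (p ⁻¹' {j}) := by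
    intro p i j; ext ⟨x, y⟩; simp
  have hsumJ : ∀ (ξ : Measure (X × X)) (p : X → ι) (_ : Measurable p) (J : Set (ι × ι)),
      ∑ k ∈ J.toFinset, ξ ((p ⁻¹' {k.1}) ×ˢ (p ⁻¹' {k.2})) = ξ (Prod.map p p ⁻¹' J) := by
    intro ξ p hp J
    have := sum_measure_preimage_singleton (μ := ξ) (f := Prod.map p p) J.toFinset
      (fun k _ => (hp.prodMap hp) (measurableSet_singleton k))
    simpa [← hpre] using this
  have hrow : ∀ (ξ : Measure (X × X)), ξ.map Prod.fst = μ → ∀ i,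
      ∑ j, ξ ((p ⁻¹' {i}) ×ˢ (p ⁻¹' {j})) = μ (p ⁻¹' {i}) := by
    intro ξ h1 i
    rw [← h1, Measure.map_apply measurable_fst (hp (measurableSet_singleton i))]
    have := sum_measure_preimage_singleton (μ := ξ.restrict (Prod.fst ⁻¹' (p ⁻¹' {i})))
      (f := fun z : X × X => p z.2) Finset.univ
      (fun k _ => (hp.comp measurable_snd) (measurableSet_singleton k))
    simp only [Finset.coe_univ, Set.preimage_univ, Measure.restrict_apply MeasurableSet.univ,
      Set.univ_inter] at this
    rw [← this]
    refine Finset.sum_congr rfl fun j _ => ?_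
    refine Eq.trans ?_ (Measure.restrict_apply ((hp.comp measurable_snd) (measurableSet_singleton j))).symm
    congr 1
    ext ⟨x, y⟩; simp [and_comm]
  have hcol : ∀ (ξ : Measure (X × X)), ξ.map Prod.snd = μ → ∀ j,
      ∑ i, ξ ((p ⁻¹' {i}) ×ˢ (p ⁻¹' {j})) = μ (p ⁻¹' {j}) := by
    intro ξ h1 i
    rw [← h1, Measure.map_apply measurable_snd (hp (measurableSet_singleton i))]
    have := sum_measure_preimage_singleton (μ := ξ.restrict (Prod.snd ⁻¹' (p ⁻¹' {i})))
      (f := fun z : X × X => p z.1) Finset.univ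
      (fun k _ => (hp.comp measurable_fst) (measurableSet_singleton k))
    simp only [Finset.coe_univ, Set.preimage_univ, Measure.restrict_apply MeasurableSet.univ,
      Set.univ_inter] at this
    rw [← this]
    refine Finset.sum_congr rfl fun j _ => ?_
    refine Eq.trans ?_ (Measure.restrict_apply ((hp.comp measurable_fst) (measurableSet_singleton j))).symm
    congr 1
  have htot : ∑ i, μ (p ⁻¹' {i}) = 1 := by
    have := sum_measure_preimage_singleton (μ := μ) (f := p) Finset.univ
      (fun k _ => hp (measurableSet_singleton k))
    simpa using this
  set a : ι → ι → ℝ≥0∞ := fun i j => ξ ((p ⁻¹' {i}) ×ˢ (p ⁻¹' {j})) with ha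
  set b : ι → ι → ℝ≥0∞ := fun i j => η ((p ⁻¹' {i}) ×ˢ (p ⁻¹' {j})) with hb
  let r : X → ι × ι := fun x => (p x, q x)
  have hr : Measurable r := hp.prodMk hq
  have hrpre : ∀ k : ι × ι, r ⁻¹' {k} = p ⁻¹' {k.1} ∩ q ⁻¹' {k.2} := by
    rintro ⟨i, j⟩; ext x; simp [r]
  obtain ⟨ζ, z1, z2, hz⟩ := coupling_matrix μ r hr
    (fun k l => θ * (a k.1 l.1 * b k.2 l.2)) (by
      rintro ⟨i, i'⟩
      rw [hrpre, ← Finset.mul_sum, Fintype.sum_prod_type]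
      simp only [← Finset.mul_sum, ← Finset.sum_mul]
      simp only [a, b]
      rw [hrow ξ hξ1, hrow η hη1]
      exact h i i') (by
      rintro ⟨i, i'⟩
      rw [hrpre, ← Finset.mul_sum, Fintype.sum_prod_type]
      simp only [← Finset.mul_sum, ← Finset.sum_mul]
      simp only [a, b]
      rw [hcol ξ hξ2, hcol η hη2]
      exact h i i')
  have hb1 : ∑ i', ∑ j', b i' j' = 1 := by
    simp only [b]; simp only [hrow η hη1, htot]
  have ha1 : ∑ i', ∑ j', a i' j' = 1 := by
    simp only [a]; simp only [hrow ξ hξ1, htot]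
  have hcell1 : ∀ i j, θ * a i j ≤ ζ ((p ⁻¹' {i}) ×ˢ (p ⁻¹' {j})) := by
    intro i j
    have h1 : ∑ k : ι × ι, ζ ((r ⁻¹' {(i, k.1)}) ×ˢ (r ⁻¹' {(j, k.2)})) ≤
        ζ ((p ⁻¹' {i}) ×ˢ (p ⁻¹' {j})) := by
      rw [← measure_biUnion_finset]
      · refine measure_mono ?_
        intro z hz
        simp [r] at hz ⊢
        tauto
      · intro k _ l _ hkl
        refine Set.disjoint_left.2 ?_
        rintro ⟨x, y⟩ hx hy
        simp [r] at hx hy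
        apply hkl
        ext <;> simp [← hx.1.2, ← hx.2.2, hy.1.2, hy.2.2]
      · intro k _
        exact (hr (measurableSet_singleton _)).prod (hr (measurableSet_singleton _))
    refine le_trans ?_ h1
    calc θ * a i j = ∑ k : ι × ι, θ * (a i j * b k.1 k.2) := by
          rw [← Finset.mul_sum, ← Finset.mul_sum, Fintype.sum_prod_type, hb1, mul_one]
      _ ≤ _ := Finset.sum_le_sum fun k _ => hz (i, k.1) (j, k.2)
  have hcell2 : ∀ i j, θ * b i j ≤ ζ ((q ⁻¹' {i}) ×ˢ (q ⁻¹' {j})) := by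
    intro i j
    have h1 : ∑ k : ι × ι, ζ ((r ⁻¹' {(k.1, i)}) ×ˢ (r ⁻¹' {(k.2, j)})) ≤
        ζ ((q ⁻¹' {i}) ×ˢ (q ⁻¹' {j})) := by
      rw [← measure_biUnion_finset]
      · refine measure_mono ?_
        intro z hz
        simp [r] at hz ⊢
        tauto
      · intro k _ l _ hkl
        refine Set.disjoint_left.2 ?_
        rintro ⟨x, y⟩ hx hy
        simp [r] at hx hy
        apply hkl
        ext <;> simp [← hx.1.1, ← hx.2.1, hy.1.1, hy.2.1]
      · intro k _
        exact (hr (measurableSet_singleton _)).prod (hr (measurableSet_singleton _))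
    refine le_trans ?_ h1
    calc θ * b i j = ∑ k : ι × ι, θ * (a k.1 k.2 * b i j) := by
          rw [← Finset.mul_sum, ← Finset.sum_mul, Fintype.sum_prod_type, ha1, one_mul]
      _ ≤ _ := Finset.sum_le_sum fun k _ => hz (k.1, i) (k.2, j)
  refine ⟨ζ, z1, z2, fun J => ?_, fun J => ?_⟩
  · rw [← hsumJ ξ p hp, ← hsumJ ζ p hp, Finset.mul_sum]
    exact Finset.sum_le_sum fun k _ => hcell1 k.1 k.2
  · rw [← hsumJ η p hp, ← hsumJ ζ q hq, Finset.mul_sum]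
    exact Finset.sum_le_sum fun k _ => hcell2 k.1 k.2

theorem exists_small_partition {X : Type*} [MetricSpace X] [CompactSpace X]
    [MeasurableSpace X] [BorelSpace X] (δ : ℝ) (hδ : 0 < δ) :
    ∃ (s : Finset X) (p : X → (s → Prop)), Measurable p ∧ ∀ x y, p x = p y → dist x y < δ := by
  obtain ⟨s, -, hs, hcov⟩ := Metric.totallyBounded_iff.1 (isCompact_univ (X := X)).totallyBounded
    (δ / 2) (by positivity) |>.imp fun s h => (⟨trivial, h.1, h.2⟩ : True ∧ _ ∧ _)
  lift s to Finset X using hs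
  refine ⟨s, fun x k => x ∈ Metric.ball (k : X) (δ / 2), ?_, ?_⟩
  · refine measurable_pi_iff.2 fun k => ?_
    exact measurableSet_setOfPred.1 Metric.isOpen_ball.measurableSet
  · intro x y h
    have hx := hcov (Set.mem_univ x)
    simp only [Set.mem_iUnion] at hx
    obtain ⟨k, hk, hxk⟩ := hx
    have hyk : y ∈ Metric.ball k (δ / 2) := (iff_of_eq (congrFun h ⟨k, hk⟩)).1 hxk
    have := dist_triangle_right x y k
    rw [Metric.mem_ball] at hxk hyk
    linarith

theorem conv_of_inner {Y : Type*} [PseudoMetricSpace Y] [MeasurableSpace Y] [BorelSpace Y]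
    (ξ : ProbabilityMeasure Y) (ζ : ℕ → ProbabilityMeasure Y)
    (h : ∀ (k : ℕ) (G : Set Y), IsOpen G →
      ENNReal.ofReal (1 - 1 / ((k : ℝ) + 1)) *
        (ξ : Measure Y) {z | Metric.ball z (1 / ((k : ℝ) + 1)) ⊆ G} ≤ (ζ k : Measure Y) G) :
    Tendsto ζ atTop (𝓝 ξ) := by
  refine tendsto_of_forall_isOpen_le_liminf_nat' fun G hG => ?_
  have hmono : Monotone fun k : ℕ => {z : Y | Metric.ball z (1 / ((k : ℝ) + 1)) ⊆ G} := by
    intro k l hkl z hz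
    exact (Metric.ball_subset_ball (Nat.one_div_le_one_div hkl)).trans hz
  have hU : (⋃ k : ℕ, {z : Y | Metric.ball z (1 / ((k : ℝ) + 1)) ⊆ G}) = G := by
    ext z
    simp only [Set.mem_iUnion, Set.mem_ofPred_eq]
    constructor
    · rintro ⟨k, hk⟩
      exact hk (Metric.mem_ball_self (by positivity))
    · intro hz
      obtain ⟨ε, hε, hb⟩ := Metric.isOpen_iff.1 hG z hz
      obtain ⟨k, hk⟩ := exists_nat_one_div_lt hε
      exact ⟨k, (Metric.ball_subset_ball hk.le).trans hb⟩
  have h1 := tendsto_measure_iUnion_atTop (μ := (ξ : Measure Y)) hmono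
  rw [hU] at h1
  have h2 : Tendsto (fun k : ℕ => ENNReal.ofReal (1 - 1 / ((k : ℝ) + 1))) atTop (𝓝 1) := by
    have : Tendsto (fun k : ℕ => (1 : ℝ) - 1 / ((k : ℝ) + 1)) atTop (𝓝 (1 - 0)) :=
      tendsto_const_nhds.sub tendsto_one_div_add_atTop_nhds_zero_nat
    simpa using ENNReal.tendsto_ofReal this
  have h3 := ENNReal.Tendsto.mul h2 (Or.inl one_ne_zero) h1 (Or.inr ENNReal.one_ne_top)
  rw [one_mul] at h3
  rw [← h3.liminf_eq]
  exact liminf_le_liminf (Eventually.of_forall fun k => h k G hG)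

theorem lensP_iter {X : Type*} [MeasurableSpace X] (T : X ≃ᵐ X)
    (ξ : ProbabilityMeasure (X × X)) (n : ℕ) :
    (((lensP T)^[n] ξ : ProbabilityMeasure (X × X)) : Measure (X × X)) =
      (ξ : Measure (X × X)).map (Prod.map (T^[n]) (T^[n])) := by
  have hTn : ∀ n, Measurable (Prod.map (T^[n]) (T^[n])) := fun n =>
    (T.measurable.iterate n).prodMap (T.measurable.iterate n)
  induction n with
  | zero => simp
  | succ n ih =>
    rw [Function.iterate_succ_apply']
    change Measure.map (T.prodCongr T) _ = _
    rw [ih, Measure.map_map (T.prodCongr T).measurable (hTn n)]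
    congr 1
    ext z <;> simp [Function.iterate_succ_apply', Prod.map] <;> rfl

theorem lens_stage {X : Type*} [MetricSpace X] [CompactSpace X]
    [SecondCountableTopology X] [MeasurableSpace X] [BorelSpace X]
    (μ : Measure X) [IsProbabilityMeasure μ]
    (T : X ≃ᵐ X) (herg : Ergodic T μ)
    (hwm : Ergodic (Prod.map ⇑T ⇑T) (μ.prod μ))
    (ξ η : Fin 2 → ProbabilityMeasure (X × X)) (hξ : ∀ i, ξ i ∈ couplingSet μ)
    (hη : ∀ i, η i ∈ couplingSet μ) (θ δ : ℝ) (hθ0 : 0 ≤ θ) (hθ : θ < 1) (hδ : 0 < δ) :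
    ∃ (n : ℕ) (ζ : Fin 2 → ProbabilityMeasure (X × X)), ∀ i, ζ i ∈ couplingSet μ ∧
      (∀ G : Set (X × X), ENNReal.ofReal θ * (ξ i : Measure (X × X)) {z | Metric.ball z δ ⊆ G} ≤
        (ζ i : Measure (X × X)) G) ∧
      (∀ G : Set (X × X), IsOpen G →
        ENNReal.ofReal θ * (η i : Measure (X × X)) {z | Metric.ball z δ ⊆ G} ≤
        (((lensP T)^[n] (ζ i) : ProbabilityMeasure (X × X)) : Measure (X × X)) G) := by
  classical
  obtain ⟨s, p, hp, hsm⟩ := exists_small_partition (X := X) δ hδ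
  obtain ⟨n, hn⟩ := wm_cells μ T herg hwm (fun k => p ⁻¹' {k})
    (fun k => hp (measurableSet_singleton k)) θ hθ0 hθ
  have hTn : Measurable (T^[n]) := T.measurable.iterate n
  have key := fun i => coupling_two μ p (p ∘ T^[n]) hp (hp.comp hTn) (ξ i) (η i)
    (hξ i).1 (hξ i).2 (hη i).1 (hη i).2 (ENNReal.ofReal θ) hn
  choose ζ z1 z2 h1 h2 using key
  have hprob : ∀ i, IsProbabilityMeasure (ζ i) := by
    intro i
    constructor
    have := congrArg (fun m : Measure X => m Set.univ) (z1 i)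
    simpa [Measure.map_apply measurable_fst] using this
  let Z : Fin 2 → ProbabilityMeasure (X × X) := fun i => (⟨ζ i, hprob i⟩ : ProbabilityMeasure (X × X))
  refine ⟨n, Z, fun i => ⟨⟨z1 i, z2 i⟩, fun G => ?_, fun G hG => ?_⟩⟩
  all_goals
    set J : Set ((s → Prop) × (s → Prop)) := {k | Prod.map p p ⁻¹' {k} ⊆ G} with hJ
    have hsub1 : {z | Metric.ball z δ ⊆ G} ⊆ Prod.map p p ⁻¹' J := by
      intro z hz w hw
      refine hz ?_
      have hw' : Prod.map p p w = Prod.map p p z := hw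
      rw [Metric.mem_ball, Prod.dist_eq]
      exact max_lt (hsm _ _ (congrArg Prod.fst hw')) (hsm _ _ (congrArg Prod.snd hw'))
    have hsub2 : Prod.map p p ⁻¹' J ⊆ G := by
      intro z hz
      exact hz rfl
  · calc _ ≤ ENNReal.ofReal θ * (ξ i : Measure (X × X)) (Prod.map p p ⁻¹' J) := by gcongr
      _ ≤ ζ i (Prod.map p p ⁻¹' J) := h1 i J
      _ ≤ _ := measure_mono hsub2
  · rw [lensP_iter, Measure.map_apply (hTn.prodMap hTn) hG.measurableSet]
    calc _ ≤ ENNReal.ofReal θ * (η i : Measure (X × X)) (Prod.map p p ⁻¹' J) := by gcongr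
      _ ≤ ζ i (Prod.map (p ∘ T^[n]) (p ∘ T^[n]) ⁻¹' J) := h2 i J
      _ ≤ ζ i (Prod.map (T^[n]) (T^[n]) ⁻¹' G) :=
        measure_mono fun z hz => hsub2 (a := Prod.map (T^[n]) (T^[n]) z) hz

end Helpers

open scoped Topology

/-- Let `T` be an ergodic automorphism of a standard probability
space.  If `T` is weakly mixing (`T × T` is ergodic for `μ ⊗ μ`), then the lens `T̃` on
`C₂(μ)` is topologically weakly mixing (`T̃ × T̃` is topologically transitive on
`C₂(μ) × C₂(μ)`), and in particular `T̃` is topologically transitive on `C₂(μ)`. -/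
theorem lens_stmt15 {X : Type*} [MetricSpace X] [CompactSpace X]
    [SecondCountableTopology X] [MeasurableSpace X] [BorelSpace X]
    (μ : Measure X) [IsProbabilityMeasure μ]
    (T : X ≃ᵐ X) (hT : MeasurePreserving T μ μ) (herg : Ergodic T μ)
    (hwm : Ergodic (Prod.map ⇑T ⇑T) (μ.prod μ)) :
    (∀ U V : Set (ProbabilityMeasure (X × X) × ProbabilityMeasure (X × X)),
      IsOpen U → IsOpen V →
      (U ∩ couplingSet μ ×ˢ couplingSet μ).Nonempty →
      (V ∩ couplingSet μ ×ˢ couplingSet μ).Nonempty →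
      ∃ n : ℕ, ((Prod.map ((lensP T)^[n]) ((lensP T)^[n])) ⁻¹' U ∩ V ∩
        couplingSet μ ×ˢ couplingSet μ).Nonempty) ∧
    (∀ U V : Set (ProbabilityMeasure (X × X)), IsOpen U → IsOpen V →
      (U ∩ couplingSet μ).Nonempty → (V ∩ couplingSet μ).Nonempty →
      ∃ n : ℕ, ((lensP T)^[n] ⁻¹' U ∩ V ∩ couplingSet μ).Nonempty) := by
  have main : ∀ U V : Set (ProbabilityMeasure (X × X) × ProbabilityMeasure (X × X)),
      IsOpen U → IsOpen V →
      (U ∩ couplingSet μ ×ˢ couplingSet μ).Nonempty →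
      (V ∩ couplingSet μ ×ˢ couplingSet μ).Nonempty →
      ∃ n : ℕ, ((Prod.map ((lensP T)^[n]) ((lensP T)^[n])) ⁻¹' U ∩ V ∩
        couplingSet μ ×ˢ couplingSet μ).Nonempty := by
    rintro U V hU hV ⟨⟨η0, η1⟩, hηU, hη0, hη1⟩ ⟨⟨ξ0, ξ1⟩, hξV, hξ0, hξ1⟩
    have hst := fun k : ℕ => lens_stage μ T herg hwm ![ξ0, ξ1] ![η0, η1]
      (by intro i; fin_cases i <;> assumption) (by intro i; fin_cases i <;> assumption)
      (1 - 1 / ((k : ℝ) + 1)) (1 / ((k : ℝ) + 1))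
      (by
        have : 1 / ((k : ℝ) + 1) ≤ 1 := by
          rw [div_le_one (by positivity)]
          linarith [(Nat.cast_nonneg k : (0 : ℝ) ≤ k)]
        linarith)
      (by
        have : 0 < 1 / ((k : ℝ) + 1) := by positivity
        linarith)
      (by positivity)
    choose n ζ hζ using hst
    have c0 : Tendsto (fun k => ζ k 0) atTop (𝓝 ξ0) :=
      conv_of_inner ξ0 _ fun k G _ => (hζ k 0).2.1 G
    have c1 : Tendsto (fun k => ζ k 1) atTop (𝓝 ξ1) :=
      conv_of_inner ξ1 _ fun k G _ => (hζ k 1).2.1 G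
    have d0 : Tendsto (fun k => (lensP T)^[n k] (ζ k 0)) atTop (𝓝 η0) :=
      conv_of_inner η0 _ fun k G hG => (hζ k 0).2.2 G hG
    have d1 : Tendsto (fun k => (lensP T)^[n k] (ζ k 1)) atTop (𝓝 η1) :=
      conv_of_inner η1 _ fun k G hG => (hζ k 1).2.2 G hG
    have eV := (c0.prodMk_nhds c1).eventually (hV.mem_nhds hξV)
    have eU := (d0.prodMk_nhds d1).eventually (hU.mem_nhds hηU)
    obtain ⟨k, hkV, hkU⟩ := (eV.and eU).exists
    exact ⟨n k, (ζ k 0, ζ k 1), ⟨hkU, hkV⟩, (hζ k 0).1, (hζ k 1).1⟩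
  refine ⟨main, ?_⟩
  rintro U V hU hV ⟨η, hηU, hη⟩ ⟨ξ, hξV, hξ⟩
  obtain ⟨n, ⟨z0, z1⟩, ⟨h1, h2⟩, h3⟩ := main (U ×ˢ Set.univ) (V ×ˢ Set.univ)
    (hU.prod isOpen_univ) (hV.prod isOpen_univ)
    ⟨(η, η), ⟨hηU, trivial⟩, hη, hη⟩ ⟨(ξ, ξ), ⟨hξV, trivial⟩, hξ, hξ⟩
  exact ⟨n, z0, ⟨h1.1, h2.1⟩, h3.1⟩
end

section
/- Let T be an ergodic automorphism of a standard probability space and suppose that T^n has simple spectrum for every n ≥ 1. Then J₂(T^n) = J₂(T) for all n ≥ 1; consequently the set of periodic points of the lens T̃ on C₂(μ), which equals ⋃_{n≥1} J₂(T^n), is closed (equal to the fixed point set J₂(T)). -/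
open MeasureTheory Filter

variable {X : Type*} [MeasurableSpace X]

/-- The group of measurable self-equivalences of `X`, with composition as
multiplication (`⇑(a * b) = ⇑a ∘ ⇑b`). -/
noncomputable instance : Group (X ≃ᵐ X) where
  mul a b := b.trans a
  one := MeasurableEquiv.refl X
  inv := MeasurableEquiv.symm
  mul_assoc a b c := rfl
  one_mul a := by ext x; rfl
  mul_one a := by ext x; rfl
  inv_mul_cancel a := by ext x; exact a.symm_apply_apply x

/-- An automorphism `S` has simple spectrum if its Koopman operator on `L²(μ; ℂ)` has a
cyclic vector: some `f` whose orbit `{U_S^k f : k ∈ ℤ}` spans a dense subspace. -/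
def HasSimpleSpectrum (μ : Measure X) (S : X ≃ᵐ X) : Prop :=
  ∃ f : Lp ℂ 2 μ,
    (Submodule.span ℂ
        {g : Lp ℂ 2 μ | ∃ k : ℤ, ⇑g =ᵐ[μ] (⇑f ∘ ⇑(S ^ k))}).topologicalClosure = ⊤

/-- The space `C₂(μ)` of 2-couplings of `μ`, with the weak* topology. -/
def Couplings {X : Type*} [MeasurableSpace X] (μ : Measure X) : Type _ :=
  {ξ : ProbabilityMeasure (X × X) //
    (ξ : Measure (X × X)).map Prod.fst = μ ∧ (ξ : Measure (X × X)).map Prod.snd = μ}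

noncomputable instance {X : Type*} [MeasurableSpace X] [TopologicalSpace X]
    [SecondCountableTopology X] [OpensMeasurableSpace X] (μ : Measure X) :
    TopologicalSpace (Couplings μ) :=
  instTopologicalSpaceSubtype

open scoped InnerProductSpace Topology

/-- Bounded operators commuting with a unitary with a cyclic vector commute with each other
(version where one of the operators is unitary). -/
theorem aux_commute {H : Type*} [NormedAddCommGroup H] [InnerProductSpace ℂ H] [CompleteSpace H]
    (U V M : H →L[ℂ] H) (hU : U ∈ unitary (H →L[ℂ] H)) (hV : V ∈ unitary (H →L[ℂ] H))
    (hUV : V * U = U * V) (hMV : V * M = M * V) (f : H) (O : Set H)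
    (hO : ∀ g ∈ O, ∃ k : ℕ, g = (V ^ k) f ∨ g = ((star V) ^ k) f)
    (hd : (Submodule.span ℂ O).topologicalClosure = ⊤) (x y : H) :
    ⟪M (U x), y⟫_ℂ = ⟪U (M x), y⟫_ℂ := by
  obtain ⟨hV1, hV2⟩ := Unitary.mem_iff.1 hV
  obtain ⟨hU1, hU2⟩ := Unitary.mem_iff.1 hU
  have key : ∀ W : H →L[ℂ] H, V * W = W * V → star V * W = W * star V := by
    intro W hW
    calc star V * W = star V * W * (V * star V) := by rw [hV2, mul_one]
      _ = star V * (W * V) * star V := by simp only [mul_assoc]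
      _ = star V * (V * W) * star V := by rw [hW]
      _ = (star V * V) * W * star V := by simp only [mul_assoc]
      _ = W * star V := by rw [hV1, one_mul]
  let C : StarSubalgebra ℂ (H →L[ℂ] H) := StarSubalgebra.centralizer ℂ {V}
  let S : StarSubalgebra ℂ (H →L[ℂ] H) := StarSubalgebra.centralizer ℂ (C : Set (H →L[ℂ] H))
  have hC : ∀ W : H →L[ℂ] H, V * W = W * V → W ∈ C := by
    intro W hW
    rw [StarSubalgebra.mem_centralizer_iff]
    rintro g rfl
    exact ⟨hW, key W hW⟩
  have hUC : U ∈ C := hC U hUV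
  have hMC : M ∈ C := hC M hMV
  have hVC : V ∈ C := hC V rfl
  have hVS : V ∈ S := by
    rw [StarSubalgebra.mem_centralizer_iff]
    intro g hg
    have h1 := (StarSubalgebra.mem_centralizer_iff ℂ).1 hg V rfl
    have h2 := (StarSubalgebra.mem_centralizer_iff ℂ).1 (star_mem hg : star g ∈ C) V rfl
    exact ⟨h1.1.symm, h2.1.symm⟩
  have hSC : ∀ b ∈ S, ∀ c ∈ C, c * b = b * c := fun b hb c hc =>
    ((StarSubalgebra.mem_centralizer_iff ℂ).1 hb c hc).1
  have hSleC : ∀ b ∈ S, b ∈ C := fun b hb => hC b (hSC b hb V hVC)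
  let D : Submodule ℂ H := (Subalgebra.toSubmodule S.toSubalgebra).map
    (ContinuousLinearMap.apply ℂ H f).toLinearMap
  have hDmem : ∀ z, z ∈ D ↔ ∃ b ∈ S, b f = z := by
    intro z
    rfl
  have hOD : Submodule.span ℂ O ≤ D := by
    rw [Submodule.span_le]
    intro g hg
    obtain ⟨k, h | h⟩ := hO g hg
    · exact (hDmem g).2 ⟨V ^ k, pow_mem hVS k, h.symm⟩
    · exact (hDmem g).2 ⟨star V ^ k, pow_mem (star_mem hVS) k, h.symm⟩
  have hdense : Dense (D : Set H) := by
    have h0 : Dense (Submodule.span ℂ O : Set H) := by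
      rw [Submodule.dense_iff_topologicalClosure_eq_top]; exact hd
    exact h0.mono hOD
  obtain ⟨z, hz, hzlim⟩ := mem_closure_iff_seq_limit.1 (hdense (U f))
  choose b hbS hb using fun n => (hDmem (z n)).1 (hz n)
  have hlim : ∀ w ∈ D, Tendsto (fun n => b n w) atTop (𝓝 (U w)) := by
    intro w hw
    obtain ⟨q, hq, rfl⟩ := (hDmem w).1 hw
    have h1 : ∀ n, b n (q f) = q (z n) := by
      intro n
      rw [← hb n]
      exact DFunLike.congr_fun (hSC q hq (b n) (hSleC _ (hbS n))) f
    have h2 : U (q f) = q (U f) := DFunLike.congr_fun (hSC q hq U hUC) f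
    simp only [h1, h2]
    exact (q.continuous.tendsto _).comp hzlim
  have hlim' : ∀ w ∈ D, Tendsto (fun n => (star (b n)) w) atTop (𝓝 (star U w)) := by
    intro w hw
    have h1 := hlim w hw
    rw [tendsto_iff_norm_sub_tendsto_zero] at h1 ⊢
    refine h1.congr fun n => ?_
    have hn : IsStarNormal (b n - U) := by
      constructor
      have e1 := hSC _ (hbS n) _ (hSleC _ (star_mem (hbS n)))
      have e2 := hSC _ (hbS n) _ (star_mem hUC)
      have e3 := hSC _ (star_mem (hbS n)) _ hUC
      show star (b n - U) * (b n - U) = (b n - U) * star (b n - U)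
      simp only [star_sub, sub_mul, mul_sub, e1, e2, e3, hU1, hU2]
      abel
    have := (ContinuousLinearMap.isStarNormal_iff_norm_eq_adjoint.1 hn) w
    rw [← ContinuousLinearMap.star_eq_adjoint, star_sub] at this
    exact this
  have hmain : ∀ x ∈ D, ∀ y ∈ D, ⟪M (U x), y⟫_ℂ = ⟪U (M x), y⟫_ℂ := by
    intro x hx y hy
    have t1 : Tendsto (fun n => ⟪M (b n x), y⟫_ℂ) atTop (𝓝 ⟪M (U x), y⟫_ℂ) :=
      ((M.continuous.tendsto _).comp (hlim x hx)).inner tendsto_const_nhds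
    have t2 : Tendsto (fun n => ⟪M x, (star (b n)) y⟫_ℂ) atTop (𝓝 ⟪M x, star U y⟫_ℂ) :=
      tendsto_const_nhds.inner (hlim' y hy)
    have e : ∀ n, ⟪M (b n x), y⟫_ℂ = ⟪M x, (star (b n)) y⟫_ℂ := by
      intro n
      rw [ContinuousLinearMap.star_eq_adjoint, ContinuousLinearMap.adjoint_inner_right]
      congr 1
      exact DFunLike.congr_fun (hSC _ (hbS n) M hMC) x
    simp only [e] at t1
    rw [tendsto_nhds_unique t1 t2, ContinuousLinearMap.star_eq_adjoint,
      ContinuousLinearMap.adjoint_inner_right]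
  have h1 : ∀ x ∈ D, ∀ y, ⟪M (U x), y⟫_ℂ = ⟪U (M x), y⟫_ℂ := by
    intro x hx
    have := Continuous.ext_on hdense (f := fun y => ⟪M (U x), y⟫_ℂ)
      (g := fun y => ⟪U (M x), y⟫_ℂ) (by fun_prop) (by fun_prop) (fun y hy => hmain x hx y hy)
    exact fun y => congr_fun this y
  have := Continuous.ext_on hdense (f := fun x => ⟪M (U x), y⟫_ℂ)
      (g := fun x => ⟪U (M x), y⟫_ℂ) (by fun_prop) (by fun_prop) (fun x hx => h1 x hx y)
  exact congr_fun this x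

theorem aux_coe_pow {X : Type*} [MeasurableSpace X] (S : X ≃ᵐ X) (n : ℕ) :
    ⇑(S ^ n) = (⇑S)^[n] := by
  induction n with
  | zero => rfl
  | succ k ih =>
    rw [pow_succ, Function.iterate_succ, ← ih]
    rfl

theorem aux_unitary {X : Type*} [MeasurableSpace X] (μ : Measure X) (S R : X ≃ᵐ X)
    (hSR : S * R = 1) (hS : MeasurePreserving ⇑S μ μ) (hR : MeasurePreserving ⇑R μ μ) :
    (Lp.compMeasurePreservingₗᵢ (E := ℂ) (p := 2) ℂ ⇑S hS).toContinuousLinearMap ∈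
      unitary (Lp ℂ 2 μ →L[ℂ] Lp ℂ 2 μ) ∧
    star (Lp.compMeasurePreservingₗᵢ (E := ℂ) (p := 2) ℂ ⇑S hS).toContinuousLinearMap =
      (Lp.compMeasurePreservingₗᵢ (E := ℂ) (p := 2) ℂ ⇑R hR).toContinuousLinearMap := by
  have hRS : R * S = 1 := by rw [mul_eq_one_iff_eq_inv] at hSR; rw [hSR]; simp
  have hc : ∀ (A B : X ≃ᵐ X) (hA : MeasurePreserving ⇑A μ μ) (hB : MeasurePreserving ⇑B μ μ)
      (h : A * B = 1) (x : Lp ℂ 2 μ),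
      Lp.compMeasurePreserving ⇑B hB (Lp.compMeasurePreserving ⇑A hA x) = x := by
    intro A B hA hB h x
    apply Lp.ext
    have h1 := Lp.coeFn_compMeasurePreserving (Lp.compMeasurePreserving ⇑A hA x) hB
    have h2 := hB.quasiMeasurePreserving.ae_eq_comp (Lp.coeFn_compMeasurePreserving x hA)
    refine h1.trans (h2.trans ?_)
    have : ⇑A ∘ ⇑B = id := by
      have := congrArg (fun e : X ≃ᵐ X => (⇑e : X → X)) h
      exact this
    rw [Function.comp_assoc, this]
    rfl
  set KS := (Lp.compMeasurePreservingₗᵢ (E := ℂ) (p := 2) ℂ ⇑S hS).toContinuousLinearMap with hKS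
  set KR := (Lp.compMeasurePreservingₗᵢ (E := ℂ) (p := 2) ℂ ⇑R hR).toContinuousLinearMap with hKR
  have h1 : ∀ x, KS (KR x) = x := fun x => hc R S hR hS hRS x
  have h2 : ∀ x, KR (KS x) = x := fun x => hc S R hS hR hSR x
  have hstar : star KS = KR := by
    rw [ContinuousLinearMap.star_eq_adjoint]
    symm
    rw [ContinuousLinearMap.eq_adjoint_iff]
    intro x y
    conv_rhs => rw [← h1 x]
    exact ((Lp.compMeasurePreservingₗᵢ (E := ℂ) (p := 2) ℂ ⇑S hS).inner_map_map _ _).symm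
  refine ⟨Unitary.mem_iff.2 ⟨?_, ?_⟩, hstar⟩
  · rw [hstar]; ext1 x; exact h2 x
  · rw [hstar]; ext1 x; exact h1 x

theorem aux_inner_indicator (𝕜 : Type*) [RCLike 𝕜] {X : Type*} [MeasurableSpace X]
    (μ : Measure X) [IsProbabilityMeasure μ] (ξ : Measure (X × X)) [IsProbabilityMeasure ξ]
    (h1 : MeasurePreserving Prod.fst ξ μ) (h2 : MeasurePreserving Prod.snd ξ μ)
    {A B : Set X} (hA : MeasurableSet A) (hB : MeasurableSet B) :
    ⟪Lp.compMeasurePreservingₗᵢ (E := 𝕜) (p := 2) 𝕜 Prod.fst h1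
        (indicatorConstLp 2 hA (measure_ne_top μ A) (1 : 𝕜)),
      Lp.compMeasurePreservingₗᵢ (E := 𝕜) (p := 2) 𝕜 Prod.snd h2
        (indicatorConstLp 2 hB (measure_ne_top μ B) (1 : 𝕜))⟫_𝕜 = (ξ.real (A ×ˢ B) : 𝕜) := by
  change ⟪Lp.compMeasurePreserving Prod.fst h1 (indicatorConstLp 2 hA _ (1 : 𝕜)),
    Lp.compMeasurePreserving Prod.snd h2 (indicatorConstLp 2 hB _ (1 : 𝕜))⟫_𝕜 = _
  rw [Lp.indicatorConstLp_compMeasurePreserving, Lp.indicatorConstLp_compMeasurePreserving,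
    L2.inner_indicatorConstLp_one_indicatorConstLp_one]
  rfl

theorem aux_inv_iff {X : Type*} [MeasurableSpace X] (T : X ≃ᵐ X) (ξ : Measure (X × X))
    [IsProbabilityMeasure ξ] :
    ξ.map (Prod.map ⇑T ⇑T) = ξ ↔ ∀ A B : Set X, MeasurableSet A → MeasurableSet B →
      ξ.real ((⇑T ⁻¹' A) ×ˢ (⇑T ⁻¹' B)) = ξ.real (A ×ˢ B) := by
  have hm : Measurable (Prod.map ⇑T ⇑T) := T.measurable.prodMap T.measurable
  have hp : ∀ A B : Set X, Prod.map ⇑T ⇑T ⁻¹' (A ×ˢ B) = (⇑T ⁻¹' A) ×ˢ (⇑T ⁻¹' B) :=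
    fun A B => rfl
  constructor
  · intro h A B hA hB
    conv_rhs => rw [← h]
    rw [map_measureReal_apply hm (hA.prod hB), hp]
  · intro h
    have : IsProbabilityMeasure (ξ.map (Prod.map ⇑T ⇑T)) :=
      Measure.isProbabilityMeasure_map hm.aemeasurable
    apply Measure.ext_prod
    intro A B hA hB
    rw [Measure.map_apply hm (hA.prod hB), hp]
    have := h A B hA hB
    rwa [measureReal_def, measureReal_def,
      ENNReal.toReal_eq_toReal_iff' (measure_ne_top _ _) (measure_ne_top _ _)] at this

set_option maxHeartbeats 1600000 in
theorem aux_main {X : Type*} [MeasurableSpace X]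
    (μ : Measure X) [IsProbabilityMeasure μ] (T : X ≃ᵐ X) (hT : MeasurePreserving ⇑T μ μ)
    (n : ℕ) (hss : HasSimpleSpectrum μ (T ^ n)) (ξ : Measure (X × X)) [IsProbabilityMeasure ξ]
    (h1 : MeasurePreserving Prod.fst ξ μ) (h2 : MeasurePreserving Prod.snd ξ μ)
    (h : ξ.map (Prod.map ⇑(T ^ n) ⇑(T ^ n)) = ξ) : ξ.map (Prod.map ⇑T ⇑T) = ξ := by
  rw [aux_inv_iff]
  intro A B hA hB
  obtain ⟨f, hf⟩ := hss
  have hTi : MeasurePreserving ⇑(T⁻¹) μ μ := hT.symm T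
  have hS : MeasurePreserving ⇑(T ^ n) μ μ := by rw [aux_coe_pow]; exact hT.iterate n
  have hSi : MeasurePreserving ⇑((T ^ n)⁻¹) μ μ := hS.symm (T ^ n)
  obtain ⟨hU, hUs⟩ := aux_unitary μ T T⁻¹ (mul_inv_cancel T) hT hTi
  obtain ⟨hV, hVs⟩ := aux_unitary μ (T ^ n) (T ^ n)⁻¹ (mul_inv_cancel _) hS hSi
  have hW : MeasurePreserving (Prod.map ⇑(T ^ n) ⇑(T ^ n)) ξ ξ :=
    ⟨(T ^ n).measurable.prodMap (T ^ n).measurable, h⟩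
  -- powers
  have hpow : ∀ (S : X ≃ᵐ X) (hS : MeasurePreserving ⇑S μ μ) (k : ℕ) (g : Lp ℂ 2 μ),
      ⇑g =ᵐ[μ] ⇑f ∘ ⇑(S ^ k) →
      g = ((Lp.compMeasurePreservingₗᵢ (E := ℂ) (p := 2) ℂ ⇑S hS).toContinuousLinearMap ^ k) f := by
    intro S hS k g hg
    have e : ((Lp.compMeasurePreservingₗᵢ (E := ℂ) (p := 2) ℂ ⇑S hS).toContinuousLinearMap ^ k) f
        = Lp.compMeasurePreserving _ (hS.iterate k) f := by
      rw [FunLike.coe_pow_eq_iterate, ← Lp.compMeasurePreserving_iterate]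
      rfl
    rw [e]
    apply Lp.ext
    rw [aux_coe_pow] at hg
    exact hg.trans (Lp.coeFn_compMeasurePreserving f (hS.iterate k)).symm
  set U := (Lp.compMeasurePreservingₗᵢ (E := ℂ) (p := 2) ℂ ⇑T hT).toContinuousLinearMap with hUdef
  set V := (Lp.compMeasurePreservingₗᵢ (E := ℂ) (p := 2) ℂ ⇑(T ^ n) hS).toContinuousLinearMap
    with hVdef
  let P := (Lp.compMeasurePreservingₗᵢ (E := ℂ) (p := 2) ℂ Prod.fst h1)
  let Q := (Lp.compMeasurePreservingₗᵢ (E := ℂ) (p := 2) ℂ Prod.snd h2)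
  let W := (Lp.compMeasurePreservingₗᵢ (E := ℂ) (p := 2) ℂ _ hW)
  have hWP : ∀ x, W (P x) = P (V x) := by
    intro x
    exact (Lp.compMeasurePreserving_comp_apply x h1 hW).symm.trans
      (Lp.compMeasurePreserving_comp_apply x hS h1)
  have hWQ : ∀ x, W (Q x) = Q (V x) := by
    intro x
    exact (Lp.compMeasurePreserving_comp_apply x h2 hW).symm.trans
      (Lp.compMeasurePreserving_comp_apply x hS h2)
  let M : Lp ℂ 2 μ →L[ℂ] Lp ℂ 2 μ :=
    (ContinuousLinearMap.adjoint Q.toContinuousLinearMap).comp P.toContinuousLinearMap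
  have hM : ∀ x y, ⟪M x, y⟫_ℂ = ⟪P x, Q y⟫_ℂ := by
    intro x y
    exact ContinuousLinearMap.adjoint_inner_left Q.toContinuousLinearMap y (P x)
  have hMinv : ∀ x y, ⟪M (V x), V y⟫_ℂ = ⟪M x, y⟫_ℂ := by
    intro x y
    rw [hM, hM, ← hWP, ← hWQ]
    exact W.inner_map_map _ _
  obtain ⟨hV1, hV2⟩ := Unitary.mem_iff.1 hV
  obtain ⟨hU1, hU2⟩ := Unitary.mem_iff.1 hU
  have hMV : V * M = M * V := by
    have e : star V * (M * V) = M := by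
      ext1 x
      apply ext_inner_right ℂ
      intro y
      rw [← hMinv x y, ContinuousLinearMap.star_eq_adjoint]
      exact ContinuousLinearMap.adjoint_inner_left V y (M (V x))
    calc V * M = V * (star V * (M * V)) := by rw [e]
      _ = M * V := by rw [← mul_assoc, hV2, one_mul]
  have hUV : V * U = U * V := by
    ext1 x
    have hc : ⇑(T ^ n) ∘ ⇑T = ⇑T ∘ ⇑(T ^ n) :=
      congrArg (fun e : X ≃ᵐ X => (⇑e : X → X)) ((Commute.refl T).pow_left n).eq
    have e1 := Lp.compMeasurePreserving_comp_apply x hS hT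
    have e2 := Lp.compMeasurePreserving_comp_apply x hT hS
    have e3 : Lp.compMeasurePreserving _ (hS.comp hT) x =
        Lp.compMeasurePreserving _ (hT.comp hS) x := by
      congr 2
    exact e2.symm.trans (e3.symm.trans e1)
  have hcomm := aux_commute U V M hU hV hUV hMV f _ (by
    rintro g ⟨k, hk⟩
    cases k with
    | ofNat k =>
      refine ⟨k, Or.inl ?_⟩
      apply hpow _ hS
      rw [Int.ofNat_eq_natCast, zpow_natCast] at hk
      exact hk
    | negSucc k =>
      refine ⟨k + 1, Or.inr ?_⟩
      rw [hVs]
      apply hpow _ hSi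
      rw [zpow_negSucc, ← inv_pow] at hk
      exact hk) hf
  have hfin : ∀ x y, ⟪P (U x), Q (U y)⟫_ℂ = ⟪P x, Q y⟫_ℂ := by
    intro x y
    rw [← hM, ← hM, hcomm]
    exact (Lp.compMeasurePreservingₗᵢ (E := ℂ) (p := 2) ℂ ⇑T hT).inner_map_map _ _
  have hUind : ∀ {A : Set X} (hA : MeasurableSet A),
      U (indicatorConstLp 2 hA (measure_ne_top μ A) (1 : ℂ)) =
        indicatorConstLp 2 (T.measurable hA) (measure_ne_top μ _) (1 : ℂ) := by
    intro A hA
    exact Lp.indicatorConstLp_compMeasurePreserving _ _ _ hT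
  have := hfin (indicatorConstLp 2 hA (measure_ne_top μ A) (1 : ℂ))
    (indicatorConstLp 2 hB (measure_ne_top μ B) (1 : ℂ))
  rw [hUind, hUind] at this
  have e1 := aux_inner_indicator ℂ μ ξ h1 h2 (T.measurable hA) (T.measurable hB)
  have e2 := aux_inner_indicator ℂ μ ξ h1 h2 hA hB
  exact Complex.ofReal_injective (e1.symm.trans (this.trans e2))

theorem Couplings.mp1 {X : Type*} [MeasurableSpace X] {μ : Measure X} (ξ : Couplings μ) :
    MeasurePreserving Prod.fst (ξ.1 : Measure (X × X)) μ := ⟨measurable_fst, ξ.2.1⟩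

theorem Couplings.mp2 {X : Type*} [MeasurableSpace X] {μ : Measure X} (ξ : Couplings μ) :
    MeasurePreserving Prod.snd (ξ.1 : Measure (X × X)) μ := ⟨measurable_snd, ξ.2.2⟩

theorem aux_cont_inner {X : Type*} [MetricSpace X] [CompactSpace X]
    [SecondCountableTopology X] [MeasurableSpace X] [BorelSpace X]
    (μ : Measure X) [IsProbabilityMeasure μ] (x y : Lp ℝ 2 μ) :
    Continuous (fun ξ : Couplings μ =>
      ⟪Lp.compMeasurePreservingₗᵢ (E := ℝ) (p := 2) ℝ Prod.fst ξ.mp1 x,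
       Lp.compMeasurePreservingₗᵢ (E := ℝ) (p := 2) ℝ Prod.snd ξ.mp2 y⟫_ℝ) := by
  have hdr := ContinuousMap.toLp_denseRange (p := 2) ℝ μ ℝ (by simp)
  have hbd : ∀ (ξ : Couplings μ) (u v : Lp ℝ 2 μ),
      |⟪Lp.compMeasurePreservingₗᵢ (E := ℝ) (p := 2) ℝ Prod.fst ξ.mp1 u,
       Lp.compMeasurePreservingₗᵢ (E := ℝ) (p := 2) ℝ Prod.snd ξ.mp2 v⟫_ℝ| ≤ ‖u‖ * ‖v‖ := by
    intro ξ u v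
    refine (abs_real_inner_le_norm _ _).trans ?_
    rw [LinearIsometry.norm_map, LinearIsometry.norm_map]
  apply continuous_of_uniform_approx_of_continuous
  rw [Metric.uniformity_basis_dist.forall_iff (by
    intro s t hst h
    obtain ⟨F, hF, hF'⟩ := h
    exact ⟨F, hF, fun y => hst (hF' y)⟩)]
  intro ε hε
  obtain ⟨φ, hφ⟩ := hdr.exists_dist_lt x (ε := ε / 2 / (‖y‖ + 1)) (by positivity)
  set u := ContinuousMap.toLp 2 μ ℝ φ with hu
  obtain ⟨ψ, hψ⟩ := hdr.exists_dist_lt y (ε := ε / 2 / (‖u‖ + 1)) (by positivity)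
  set v := ContinuousMap.toLp 2 μ ℝ ψ with hv
  refine ⟨fun ξ : Couplings μ =>
      ⟪Lp.compMeasurePreservingₗᵢ (E := ℝ) (p := 2) ℝ Prod.fst ξ.mp1 u,
       Lp.compMeasurePreservingₗᵢ (E := ℝ) (p := 2) ℝ Prod.snd ξ.mp2 v⟫_ℝ, ?_, ?_⟩
  · have e : ∀ ξ : Couplings μ,
      ⟪Lp.compMeasurePreservingₗᵢ (E := ℝ) (p := 2) ℝ Prod.fst ξ.mp1 u,
       Lp.compMeasurePreservingₗᵢ (E := ℝ) (p := 2) ℝ Prod.snd ξ.mp2 v⟫_ℝ =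
       ∫ z, (BoundedContinuousFunction.mkOfCompact
        (⟨fun z : X × X => ψ z.2 * φ z.1, by fun_prop⟩ : C(X × X, ℝ))) z
          ∂(ξ.1 : Measure (X × X)) := by
      intro ξ
      rw [L2.inner_def]
      apply integral_congr_ae
      have a1 := (Lp.coeFn_compMeasurePreserving u ξ.mp1).trans
        (ξ.mp1.quasiMeasurePreserving.ae_eq_comp (ContinuousMap.coeFn_toLp (p := 2) (𝕜 := ℝ) μ φ))
      have a2 := (Lp.coeFn_compMeasurePreserving v ξ.mp2).trans
        (ξ.mp2.quasiMeasurePreserving.ae_eq_comp (ContinuousMap.coeFn_toLp (p := 2) (𝕜 := ℝ) μ ψ))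
      filter_upwards [a1, a2] with z hz1 hz2
      change ⟪(Lp.compMeasurePreserving Prod.fst ξ.mp1 u) z,
        (Lp.compMeasurePreserving Prod.snd ξ.mp2 v) z⟫_ℝ = _
      rw [hz1, hz2]
      simp
    simp only [e]
    exact (ProbabilityMeasure.continuous_integral_boundedContinuousFunction _).comp
      continuous_subtype_val
  · intro ξ
    have d1 := hbd ξ (x - u) y
    have d2 := hbd ξ u (y - v)
    rw [map_sub, inner_sub_left] at d1
    rw [map_sub, inner_sub_right] at d2
    rw [dist_eq_norm] at hφ hψ
    have b1 : ‖x - u‖ * ‖y‖ < ε / 2 := by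
      rw [lt_div_iff₀ (by positivity)] at hφ
      nlinarith [norm_nonneg (x - u)]
    have b2 : ‖u‖ * ‖y - v‖ < ε / 2 := by
      rw [lt_div_iff₀ (by positivity)] at hψ
      nlinarith [norm_nonneg (y - v)]
    show dist _ _ < ε
    rw [Real.dist_eq]
    refine lt_of_le_of_lt (abs_sub_le _ ⟪Lp.compMeasurePreservingₗᵢ (E := ℝ) (p := 2) ℝ Prod.fst ξ.mp1 u,
       Lp.compMeasurePreservingₗᵢ (E := ℝ) (p := 2) ℝ Prod.snd ξ.mp2 y⟫_ℝ _) ?_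
    linarith

theorem aux_cont {X : Type*} [MetricSpace X] [CompactSpace X]
    [SecondCountableTopology X] [MeasurableSpace X] [BorelSpace X]
    (μ : Measure X) [IsProbabilityMeasure μ] {A B : Set X} (hA : MeasurableSet A)
    (hB : MeasurableSet B) :
    Continuous (fun ξ : Couplings μ => (ξ.1 : Measure (X × X)).real (A ×ˢ B)) := by
  have := aux_cont_inner μ (indicatorConstLp 2 hA (measure_ne_top μ A) (1 : ℝ))
    (indicatorConstLp 2 hB (measure_ne_top μ B) (1 : ℝ))
  refine this.congr fun ξ => ?_
  exact aux_inner_indicator ℝ μ (ξ.1 : Measure (X × X)) ξ.mp1 ξ.mp2 hA hB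

/-- Let `T` be an ergodic automorphism such that `T^n` has simple
spectrum for every `n ≥ 1`.  Then `J₂(T^n) = J₂(T)` for all `n ≥ 1`; consequently the
set of periodic points of the lens `T̃` on `C₂(μ)`, which is `⋃_{n ≥ 1} J₂(T^n)`, is
closed (being equal to the fixed-point set `J₂(T)`). -/
theorem lens_stmt17 {X : Type*} [MetricSpace X] [CompactSpace X]
    [SecondCountableTopology X] [MeasurableSpace X] [BorelSpace X]
    (μ : Measure X) [IsProbabilityMeasure μ]
    (T : X ≃ᵐ X) (hT : MeasurePreserving ⇑T μ μ) (herg : Ergodic ⇑T μ)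
    (hss : ∀ n : ℕ, 1 ≤ n → HasSimpleSpectrum μ (T ^ n)) :
    (∀ n : ℕ, 1 ≤ n →
      {ξ : Couplings μ |
          (ξ.1 : Measure (X × X)).map (Prod.map ⇑(T ^ n) ⇑(T ^ n)) = ξ.1} =
        {ξ : Couplings μ |
          (ξ.1 : Measure (X × X)).map (Prod.map ⇑T ⇑T) = ξ.1}) ∧
    IsClosed {ξ : Couplings μ | ∃ n : ℕ, 1 ≤ n ∧
      (ξ.1 : Measure (X × X)).map (Prod.map ⇑(T ^ n) ⇑(T ^ n)) = ξ.1} := by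
  have hfirst : ∀ n : ℕ, 1 ≤ n →
      {ξ : Couplings μ |
          (ξ.1 : Measure (X × X)).map (Prod.map ⇑(T ^ n) ⇑(T ^ n)) = ξ.1} =
        {ξ : Couplings μ |
          (ξ.1 : Measure (X × X)).map (Prod.map ⇑T ⇑T) = ξ.1} := by
    intro n hn
    ext ξ
    constructor
    · intro h
      exact aux_main μ T hT n (hss n hn) (ξ.1 : Measure (X × X)) ξ.mp1 ξ.mp2 h
    · intro h
      have hm : MeasurePreserving (Prod.map ⇑T ⇑T) (ξ.1 : Measure (X × X)) ξ.1 :=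
        ⟨T.measurable.prodMap T.measurable, h⟩
      have := (hm.iterate n).map_eq
      rw [Prod.map_iterate, ← aux_coe_pow] at this
      exact this
  refine ⟨hfirst, ?_⟩
  have heq : {ξ : Couplings μ | ∃ n : ℕ, 1 ≤ n ∧
      (ξ.1 : Measure (X × X)).map (Prod.map ⇑(T ^ n) ⇑(T ^ n)) = ξ.1} =
      ⋂ (A : Set X) (B : Set X) (_ : MeasurableSet A) (_ : MeasurableSet B),
        {ξ : Couplings μ | (ξ.1 : Measure (X × X)).real ((⇑T ⁻¹' A) ×ˢ (⇑T ⁻¹' B)) =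
          (ξ.1 : Measure (X × X)).real (A ×ˢ B)} := by
    ext ξ
    simp only [Set.mem_iInter]
    refine Iff.trans ?_ (aux_inv_iff T (ξ.1 : Measure (X × X)))
    constructor
    · rintro ⟨n, hn, h⟩
      exact (Set.ext_iff.1 (hfirst n hn) ξ).1 h
    · intro h
      exact ⟨1, le_rfl, by rw [pow_one]; exact h⟩
  rw [heq]
  refine isClosed_iInter fun A => isClosed_iInter fun B => isClosed_iInter fun hA =>
    isClosed_iInter fun hB => ?_
  exact isClosed_eq (aux_cont μ (T.measurable hA) (T.measurable hB)) (aux_cont μ hA hB)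
end
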